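/- Suppose ψ ∈ L¹(ℝ^d) satisfies ‖R(ψ − ψ(·−y))‖₁ ≤ C < ∞ for all |y| ≤ 1, and suppose λ ∈ L¹(ℝ^d) with |y|λ(y) ∈ L¹ and ∫_{ℝ^d} λ(y) dy = 1. Then ψ − ψ*λ belongs to H¹ and ‖R(ψ − ψ*λ)‖₁ ≤ C ∫_{ℝ^d} (|y| + 1) |λ(y)| dy. (In the proof one first shows the linear growth estimate ‖R(ψ − ψ(·−y))‖₁ ≤ C(|y| + 1) for all y ∈ ℝ^d.) -/

import Mathlib

open MeasureTheory Filter Matrix Set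
open scoped ENNReal NNReal Topology

noncomputable section

namespace AffinePaper

/-- Embed an integer lattice point `k ∈ ℤ^d` into `ℝ^d`. -/
def intVec {d : ℕ} (k : Fin d → ℤ) : Fin d → ℝ := fun i => (k i : ℝ)

/-- Euclidean norm `|x|` on `ℝ^d`. -/
def eucNorm {d : ℕ} (x : Fin d → ℝ) : ℝ := Real.sqrt (∑ i, x i ^ 2)

/-- The constant `C_d = Γ((d+1)/2) π^{-(d+1)/2}` of the Riesz kernel. -/
def rieszConst (d : ℕ) : ℝ :=
  Real.Gamma (((d : ℝ) + 1) / 2) / Real.pi ^ (((d : ℝ) + 1) / 2)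

/-- The (vector-valued) Riesz kernel `Z(x) = C_d x / |x|^{d+1}`, with `Z(0) = 0`. -/
def rieszKernel (d : ℕ) (x : Fin d → ℝ) : Fin d → ℝ :=
  if x = 0 then 0 else fun i => rieszConst d * x i / eucNorm x ^ (d + 1)

/-- The truncated singular integral `∫_{|y| > ε} f(x-y) Z(y) dy` (vector-valued). -/
def truncRiesz {d : ℕ} (f : (Fin d → ℝ) → ℂ) (x : Fin d → ℝ) (ε : ℝ) : Fin d → ℂ :=
  ∫ y in {y : Fin d → ℝ | ε < eucNorm y}, (fun i => f (x - y) * ((rieszKernel d y i : ℝ) : ℂ))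

/-- `g` is the Riesz transform `Rf = f * Z` of `f`, in the principal value sense:
for a.e. `x` the truncated integrals converge to `g(x)` as `ε → 0+`. -/
def HasRiesz {d : ℕ} (f : (Fin d → ℝ) → ℂ) (g : (Fin d → ℝ) → Fin d → ℂ) : Prop :=
  ∀ᵐ x : Fin d → ℝ, Tendsto (fun ε : ℝ => truncRiesz f x ε) (𝓝[>] 0) (𝓝 (g x))

/-- Membership in the Hardy space `H¹(ℝ^d) = { f ∈ L¹ : Rf ∈ L¹ }`. -/
def MemH1 {d : ℕ} (f : (Fin d → ℝ) → ℂ) : Prop :=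
  Integrable f volume ∧ ∃ g : (Fin d → ℝ) → Fin d → ℂ, Integrable g volume ∧ HasRiesz f g

/-- The Hardy norm `‖f‖_{H¹} = ‖f‖₁ + ‖Rf‖₁`, as a value in `[0,∞]` (equal to `∞` when
`f` admits no integrable Riesz transform; the Riesz transform is a.e. unique, so the
infimum below is over a set of at most one value). -/
def hardyNorm {d : ℕ} (f : (Fin d → ℝ) → ℂ) : ℝ≥0∞ :=
  ENNReal.ofReal (∫ x : Fin d → ℝ, ‖f x‖) +
    sInf {r : ℝ≥0∞ | ∃ g : (Fin d → ℝ) → Fin d → ℂ,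
      Integrable g volume ∧ HasRiesz f g ∧ r = ENNReal.ofReal (∫ x : Fin d → ℝ, ‖g x‖)}

/-- The centered open unit cube `C₀ = (-1/2, 1/2)^d`. -/
def centeredCube (d : ℕ) : Set (Fin d → ℝ) :=
  Set.univ.pi fun _ => Set.Ioo (-(1/2) : ℝ) (1/2)

/-- `ν` is a smooth cut-off function: supported in the centered unit cube `C₀` and
identically `1` near the origin. -/
structure IsCutoff (d : ℕ) (ν : (Fin d → ℝ) → ℝ) : Prop where
  smooth : ContDiff ℝ (⊤ : ℕ∞) ν
  supp : tsupport ν ⊆ centeredCube d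
  one_near_zero : ∀ᶠ ξ in 𝓝 0, ν ξ = 1

/-- The periodic function `ζ(ξ) = -i (ξ b⁻¹ / |ξ b⁻¹|) ν(ξ)` (vector-valued), whose Fourier
coefficients define the discrete Riesz kernel. -/
def zetaFn {d : ℕ} (b : Matrix (Fin d) (Fin d) ℝ) (ν : (Fin d → ℝ) → ℝ)
    (ξ : Fin d → ℝ) : Fin d → ℂ :=
  fun i => -Complex.I * ((((ξ ᵥ* b⁻¹) i / eucNorm (ξ ᵥ* b⁻¹) : ℝ)) : ℂ) * ((ν ξ : ℝ) : ℂ)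

/-- The discrete Riesz kernel `z = {z_k}`, defined through its Fourier series
`Σ_k z_k e^{-2πi ξ k} = ζ(ξ)`, `ξ ∈ C₀`; that is, `z_k = ∫_{C₀} ζ(ξ) e^{2πi ξ k} dξ`. -/
def zKernel {d : ℕ} (b : Matrix (Fin d) (Fin d) ℝ) (ν : (Fin d → ℝ) → ℝ)
    (k : Fin d → ℤ) : Fin d → ℂ :=
  ∫ ξ in centeredCube d,
    Complex.exp (((2 * Real.pi * ∑ i, ξ i * (k i : ℝ) : ℝ)) * Complex.I) • zetaFn b ν ξ

/-- Discrete convolution `(s * z)_k = Σ_l s_{k-l} z_l` of a scalar sequence with the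
(vector-valued) kernel `z`, in the `k`-index. -/
def dConv {d : ℕ} (s : (Fin d → ℤ) → ℂ) (z : (Fin d → ℤ) → Fin d → ℂ)
    (k : Fin d → ℤ) : Fin d → ℂ :=
  ∑' l : Fin d → ℤ, s (k - l) • z l

/-- The discrete Hardy norm `‖s‖_{h¹} = ‖s‖_{ℓ¹} + ‖s * z‖_{ℓ¹}` (value in `[0,∞]`). -/
def h1Norm {d : ℕ} (b : Matrix (Fin d) (Fin d) ℝ) (ν : (Fin d → ℝ) → ℝ)
    (s : (Fin d → ℤ) → ℂ) : ℝ≥0∞ :=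
  (∑' k : Fin d → ℤ, (‖s k‖₊ : ℝ≥0∞)) +
    ∑' k : Fin d → ℤ, (‖dConv s (zKernel b ν) k‖₊ : ℝ≥0∞)

/-- The mixed norm `‖c‖_{ℓ¹(h¹)} = Σ_j ‖c_j‖_{h¹}` (value in `[0,∞]`). -/
def l1h1Norm {d : ℕ} (b : Matrix (Fin d) (Fin d) ℝ) (ν : (Fin d → ℝ) → ℝ)
    (c : ℕ → (Fin d → ℤ) → ℂ) : ℝ≥0∞ :=
  ∑' j : ℕ, h1Norm b ν (c j)

/-- `ψ_{j,k}(x) = |det a_j| ψ(a_j x - bk)` for isotropic dilations `a_j = α_j I`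
(Hardy-space normalization, `p = 1`). -/
def rescH {d : ℕ} (α : ℕ → ℝ) (b : Matrix (Fin d) (Fin d) ℝ) (ψ : (Fin d → ℝ) → ℂ)
    (j : ℕ) (k : Fin d → ℤ) (x : Fin d → ℝ) : ℂ :=
  ((|α j| ^ d : ℝ) : ℂ) * ψ (α j • x - b *ᵥ intVec k)

/-- The synthesis series `Sc = Σ_j Σ_k c_{j,k} ψ_{j,k}` converges to `f` in `H¹`:
for each `j` the sum over `k` converges absolutely in `L¹` to a function belonging to
`H¹`, and the sum over `j` converges absolutely in `H¹`, with limit `f`. -/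
def H1SynthesisTo {d : ℕ} (α : ℕ → ℝ) (b : Matrix (Fin d) (Fin d) ℝ)
    (ψ : (Fin d → ℝ) → ℂ) (c : ℕ → (Fin d → ℤ) → ℂ) (f : (Fin d → ℝ) → ℂ) : Prop :=
  (∀ j : ℕ, Summable fun k : Fin d → ℤ => ∫ x : Fin d → ℝ, ‖c j k * rescH α b ψ j k x‖) ∧
  (∀ j : ℕ, MemH1 (fun x => ∑' k : Fin d → ℤ, c j k * rescH α b ψ j k x)) ∧
  Summable (fun j : ℕ =>
    (hardyNorm (fun x => ∑' k : Fin d → ℤ, c j k * rescH α b ψ j k x)).toReal) ∧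
  Tendsto (fun J : ℕ => hardyNorm
      (fun x => f x - ∑ j ∈ Finset.range J, ∑' k : Fin d → ℤ, c j k * rescH α b ψ j k x))
    atTop (𝓝 0)

/-- Analysis operator at scale `j` in the Hardy-space setting (`p = 1`, `q = ∞`):
`(T_j f)_k = |det b| ⟨f, φ_{j,k}⟩` with `φ_{j,k}(x) = φ(α_j x - bk)`. -/
def TjH {d : ℕ} (α : ℕ → ℝ) (b : Matrix (Fin d) (Fin d) ℝ) (φ : (Fin d → ℝ) → ℂ)
    (f : (Fin d → ℝ) → ℂ) (j : ℕ) (k : Fin d → ℤ) : ℂ :=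
  ((|b.det| : ℝ) : ℂ) *
    ∫ x : Fin d → ℝ, f x * (starRingEnd ℂ) (φ (α j • x - b *ᵥ intVec k))

/-- Dot product of row vector `ξ` and column vector `x`. -/
def dotP {d : ℕ} (ξ x : Fin d → ℝ) : ℝ := ∑ i, ξ i * x i

/-- Fourier transform `f̂(ξ) = ∫ f(x) e^{-2πi ξ x} dx`. -/
def ft {d : ℕ} (f : (Fin d → ℝ) → ℂ) (ξ : Fin d → ℝ) : ℂ :=
  ∫ x : Fin d → ℝ, Complex.exp ((-(2 * Real.pi * dotP ξ x) : ℝ) * Complex.I) * f x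

/-- Inverse Fourier transform `ǧ(x) = ∫ g(ξ) e^{2πi ξ x} dξ`. -/
def ftInv {d : ℕ} (g : (Fin d → ℝ) → ℂ) (x : Fin d → ℝ) : ℂ :=
  ∫ ξ : Fin d → ℝ, Complex.exp (((2 * Real.pi * dotP ξ x) : ℝ) * Complex.I) * g ξ

/-- `f` is a Schwartz function. -/
def IsSchwartz {d : ℕ} (f : (Fin d → ℝ) → ℂ) : Prop :=
  ∃ Φ : SchwartzMap (Fin d → ℝ) ℂ, ∀ x, f x = Φ x

/-- Convolution `(f * g)(x) = ∫ f(y) g(x - y) dy`. -/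
def conv {d : ℕ} (f g : (Fin d → ℝ) → ℂ) (x : Fin d → ℝ) : ℂ :=
  ∫ y : Fin d → ℝ, f y * g (x - y)

/-- The periodization `Pg(x) = |det b| Σ_{k ∈ ℤ^d} g(x - bk)` of a real-valued function. -/
def periodization {d : ℕ} (b : Matrix (Fin d) (Fin d) ℝ) (g : (Fin d → ℝ) → ℝ)
    (x : Fin d → ℝ) : ℝ :=
  |b.det| * ∑' k : Fin d → ℤ, g (x - b *ᵥ intVec k)

section Kernel

variable {E : Type*} [NormedAddCommGroup E]

/-- The Euclidean length `√(|x|² + η²)` of the point `(x, η)` of the half space. -/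
def hyp (x : E) (η : ℝ) : ℝ := Real.sqrt (‖x‖ ^ 2 + η ^ 2)

lemma norm_le_hyp (x : E) (η : ℝ) : ‖x‖ ≤ hyp x η :=
  Real.le_sqrt_of_sq_le (by nlinarith [sq_nonneg η])

lemma abs_le_hyp (x : E) (η : ℝ) : |η| ≤ hyp x η :=
  Real.le_sqrt_of_sq_le (by rw [sq_abs]; nlinarith [sq_nonneg ‖x‖])

lemma hyp_le (x : E) (η : ℝ) : hyp x η ≤ ‖x‖ + |η| := by
  refine Real.sqrt_le_iff.2 ⟨by positivity, ?_⟩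
  nlinarith [sq_abs η, norm_nonneg x, abs_nonneg η, mul_nonneg (norm_nonneg x) (abs_nonneg η)]

lemma hyp_zero (x : E) : hyp x 0 = ‖x‖ := by simp [hyp]

lemma hyp_nonneg (x : E) (η : ℝ) : 0 ≤ hyp x η := Real.sqrt_nonneg _

lemma hyp_neg (x : E) (η : ℝ) : hyp (-x) η = hyp x η := by simp [hyp]

lemma hyp_pos (x : E) {η : ℝ} (h : 0 < η) : 0 < hyp x η :=
  (abs_pos.2 h.ne').trans_le (abs_le_hyp x η)

lemma hyp_eq_norm (x : E) (η : ℝ) : hyp x η = ‖WithLp.toLp 2 (x, η)‖ := by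
  rw [WithLp.prod_norm_eq_of_L2]; simp [hyp]

lemma abs_hyp_sub_hyp_le (x y : E) (η θ : ℝ) :
    |hyp x η - hyp y θ| ≤ ‖x - y‖ + |η - θ| := by
  refine le_trans ?_ (hyp_le (x - y) (η - θ))
  simp only [hyp_eq_norm]
  have := abs_norm_sub_norm_le (WithLp.toLp 2 (x, η)) (WithLp.toLp 2 (y, θ))
  simpa [← WithLp.toLp_sub] using this

lemma abs_inv_pow_sub_inv_pow_le {a b r : ℝ} (hr : 0 < r) (ha : r ≤ a) (hb : r ≤ b) (m : ℕ) :
    |(a ^ m)⁻¹ - (b ^ m)⁻¹| ≤ m * |a - b| / r ^ (m + 1) := by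
  have ha0 := hr.trans_le ha
  have hb0 := hr.trans_le hb
  rcases m with _ | m
  · simp
  have h1 : |a⁻¹ - b⁻¹| ≤ |a - b| / r ^ 2 := by
    rw [inv_sub_inv ha0.ne' hb0.ne', abs_div, abs_of_pos (mul_pos ha0 hb0), abs_sub_comm, sq]
    gcongr
  have h2 : max |a⁻¹| |b⁻¹| ≤ r⁻¹ := by
    rw [abs_of_pos (inv_pos.2 ha0), abs_of_pos (inv_pos.2 hb0)]
    exact max_le (inv_anti₀ hr ha) (inv_anti₀ hr hb)
  have h3 := abs_pow_sub_pow_le a⁻¹ b⁻¹ (m + 1)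
  rw [inv_pow, inv_pow] at h3
  refine h3.trans ?_
  calc |a⁻¹ - b⁻¹| * ((m + 1 : ℕ) : ℝ) * max |a⁻¹| |b⁻¹| ^ (m + 1 - 1)
      ≤ (|a - b| / r ^ 2) * ((m + 1 : ℕ) : ℝ) * (r⁻¹) ^ m := by
        simp only [Nat.add_sub_cancel]
        gcongr
    _ = _ := by
        rw [inv_pow]; field_simp; ring

variable [InnerProductSpace ℝ E]

/-- The conjugate Poisson kernel in direction `v` (not normalized); it is the Riesz kernel when
`η = 0`. -/
def conjPoisson (v : E) (η : ℝ) (x : E) : ℝ :=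
  inner ℝ v x / hyp x η ^ (Module.finrank ℝ E + 1)

/-- The Poisson-like majorant `ε / (ε + |x|)^{n+1}`. -/
def maj (ε : ℝ) (x : E) : ℝ := ε / (ε + ‖x‖) ^ (Module.finrank ℝ E + 1)

lemma conjPoisson_neg (v : E) (η : ℝ) (x : E) : conjPoisson v η (-x) = -conjPoisson v η x := by
  simp [conjPoisson, hyp_neg, neg_div]

lemma abs_conjPoisson_le {v : E} {η r : ℝ} (x : E) (hr : 0 < r) (h : r ≤ hyp x η) :
    |conjPoisson v η x| ≤ ‖v‖ / r ^ (Module.finrank ℝ E) := by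
  have hp := hr.trans_le h
  rw [conjPoisson, abs_div, abs_of_nonneg (pow_nonneg (hyp_nonneg x η) _), pow_succ]
  calc |inner ℝ v x| / (hyp x η ^ Module.finrank ℝ E * hyp x η)
      ≤ (‖v‖ * hyp x η) / (hyp x η ^ Module.finrank ℝ E * hyp x η) := by
        gcongr
        exact (abs_real_inner_le_norm v x).trans (by gcongr; exact norm_le_hyp x η)
    _ = ‖v‖ / hyp x η ^ Module.finrank ℝ E := by field_simp
    _ ≤ _ := by gcongr

lemma abs_conjPoisson_sub_le {v x y : E} {η θ r : ℝ} (hr : 0 < r) (hx : r ≤ hyp x η)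
    (hy : r ≤ hyp y θ) :
    |conjPoisson v η x - conjPoisson v θ y| ≤
      ‖v‖ * (‖x - y‖ + (Module.finrank ℝ E + 1) * (‖x - y‖ + |η - θ|) * (‖x‖ / r)) /
        r ^ (Module.finrank ℝ E + 1) := by
  set n := Module.finrank ℝ E
  have e : conjPoisson v η x - conjPoisson v θ y =
      inner ℝ v x * ((hyp x η ^ (n + 1))⁻¹ - (hyp y θ ^ (n + 1))⁻¹) +
        inner ℝ v (x - y) * (hyp y θ ^ (n + 1))⁻¹ := by
    simp only [conjPoisson, inner_sub_right]; ring
  have h1 := abs_inv_pow_sub_inv_pow_le hr hx hy (n + 1)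
  have h2 := abs_hyp_sub_hyp_le x y η θ
  have h3 : (hyp y θ ^ (n + 1))⁻¹ ≤ (r ^ (n + 1))⁻¹ := by gcongr
  have h4 : 0 ≤ (hyp y θ ^ (n + 1))⁻¹ := inv_nonneg.2 (pow_nonneg (hyp_nonneg _ _) _)
  rw [e]
  refine (abs_add_le _ _).trans ?_
  rw [abs_mul, abs_mul, abs_of_nonneg h4]
  calc |inner ℝ v x| * |(hyp x η ^ (n + 1))⁻¹ - (hyp y θ ^ (n + 1))⁻¹| +
        |inner ℝ v (x - y)| * (hyp y θ ^ (n + 1))⁻¹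
      ≤ (‖v‖ * ‖x‖) * (((n + 1 : ℕ) : ℝ) * (‖x - y‖ + |η - θ|) / r ^ (n + 1 + 1)) +
        (‖v‖ * ‖x - y‖) * (r ^ (n + 1))⁻¹ := by
        gcongr
        · exact abs_real_inner_le_norm v x
        · exact h1.trans (by gcongr)
        · exact abs_real_inner_le_norm v _
    _ = _ := by
        push_cast
        field_simp
        ring

lemma maj_nonneg {ε : ℝ} (hε : 0 ≤ ε) (x : E) : 0 ≤ maj ε x := by
  unfold maj; positivity

lemma maj_le {ε : ℝ} (hε : 0 < ε) (x : E) : maj ε x ≤ 1 / ε ^ Module.finrank ℝ E := by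
  unfold maj
  rw [div_le_div_iff₀ (by positivity) (by positivity), one_mul, mul_comm, ← pow_succ]
  gcongr
  simp

/-- The constant in the regularity estimates of the kernel. -/
def regC (v : E) : ℝ :=
  ‖v‖ * (2 * Module.finrank ℝ E + 3) * 3 ^ (Module.finrank ℝ E + 1)

lemma regC_nonneg (v : E) : 0 ≤ regC v := by unfold regC; positivity

lemma abs_conjPoisson_sub_le_maj {v x y : E} {η ρ : ℝ} (hρ : 0 < ρ) (hx : 2 * ρ ≤ ‖x‖)
    (hy : ‖x - y‖ ≤ ρ) :
    |conjPoisson v η x - conjPoisson v η y| ≤ regC v * maj ρ x := by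
  set n := Module.finrank ℝ E with hn
  have hx0 : 0 < ‖x‖ := by linarith
  have hyx : ‖x‖ / 2 ≤ ‖y‖ := by
    have := norm_sub_norm_le x y
    linarith
  have h := abs_conjPoisson_sub_le (v := v) (η := η) (θ := η) (r := ‖x‖ / 2) (by positivity)
    ((by linarith : ‖x‖ / 2 ≤ ‖x‖).trans (norm_le_hyp x η)) (hyx.trans (norm_le_hyp y η))
  refine h.trans ?_
  have e : ‖x‖ / (‖x‖ / 2) = 2 := by field_simp
  rw [sub_self, abs_zero, add_zero, ← hn, e, regC, maj, ← hn]
  calc ‖v‖ * (‖x - y‖ + (n + 1) * ‖x - y‖ * 2) / (‖x‖ / 2) ^ (n + 1)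
      ≤ ‖v‖ * (ρ + (n + 1) * ρ * 2) / ((ρ + ‖x‖) / 3) ^ (n + 1) := by
        refine div_le_div₀ (by positivity) (by gcongr) (by positivity) ?_
        exact pow_le_pow_left₀ (by positivity) (by linarith) _
    _ = _ := by
        rw [div_pow]; field_simp; ring

lemma abs_conjPoisson_sub_le_maj' {v x : E} {η θ ρ : ℝ} (hρ : 0 < ρ) (hx : ρ ≤ ‖x‖)
    (h : |η - θ| ≤ ρ) :
    |conjPoisson v η x - conjPoisson v θ x| ≤ regC v * maj ρ x := by
  set n := Module.finrank ℝ E with hn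
  have hx0 : 0 < ‖x‖ := by linarith
  have h := abs_conjPoisson_sub_le (v := v) (η := η) (θ := θ) (r := ‖x‖) (by positivity)
    (norm_le_hyp x η) (norm_le_hyp x θ)
  refine h.trans ?_
  rw [sub_self, norm_zero, zero_add, zero_add, ← hn, div_self hx0.ne', regC, maj, ← hn]
  calc ‖v‖ * ((n + 1) * |η - θ| * 1) / ‖x‖ ^ (n + 1)
      ≤ ‖v‖ * ((2 * n + 3) * ρ * 1) / ((ρ + ‖x‖) / 3) ^ (n + 1) := by
        gcongr
        · linarith
        · norm_num
        · linarith
    _ = _ := by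
        rw [div_pow]; field_simp

lemma abs_conjPoisson_le_maj {v x : E} {ρ : ℝ} (hρ : 0 < ρ) (hx : ‖x‖ ≤ 2 * ρ) :
    |conjPoisson v ρ x| ≤ regC v * maj ρ x := by
  set n := Module.finrank ℝ E with hn
  have h := abs_conjPoisson_le (v := v) x hρ (η := ρ) ((le_abs_self ρ).trans (abs_le_hyp x ρ))
  refine h.trans ?_
  rw [regC, maj, ← hn]
  calc ‖v‖ / ρ ^ n = ‖v‖ * (1 * ρ) / ρ ^ (n + 1) := by field_simp; ring
    _ ≤ ‖v‖ * ((2 * n + 3) * ρ) / ((ρ + ‖x‖) / 3) ^ (n + 1) := by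
        gcongr
        · linarith
        · linarith
    _ = _ := by
        rw [div_pow]; field_simp

end Kernel

section Lebesgue

variable {E : Type*} [NormedAddCommGroup E] [InnerProductSpace ℝ E]

lemma maj_eq_smul {ε : ℝ} (hε : 0 < ε) (x : E) :
    maj ε x = (ε ^ Module.finrank ℝ E)⁻¹ * maj 1 (ε⁻¹ • x) := by
  have : ε + ‖x‖ = ε * (1 + ‖ε⁻¹ • x‖) := by
    rw [norm_smul, Real.norm_eq_abs, abs_of_pos (inv_pos.2 hε)]; field_simp
  unfold maj
  rw [this, mul_pow]
  have : 0 < 1 + ‖ε⁻¹ • x‖ := by positivity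
  field_simp
  ring

lemma continuous_maj {ε : ℝ} (hε : 0 < ε) : Continuous (maj ε : E → ℝ) := by
  unfold maj
  refine continuous_const.div (by fun_prop) fun x => ?_
  positivity

lemma maj_le_dyadic {ε : ℝ} (hε : 0 < ε) (x : E) :
    ∃ j : ℕ, ‖x‖ ≤ 2 ^ j * ε ∧
      maj ε x ≤ 2 ^ (Module.finrank ℝ E + 1) * (1 / 2) ^ j / (2 ^ j * ε) ^ Module.finrank ℝ E := by
  classical
  set n := Module.finrank ℝ E with hn
  have hex : ∃ j : ℕ, ‖x‖ ≤ 2 ^ j * ε := by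
    obtain ⟨j, hj⟩ := pow_unbounded_of_one_lt (‖x‖ / ε) (one_lt_two (α := ℝ))
    exact ⟨j, ((div_lt_iff₀ hε).1 hj).le⟩
  refine ⟨Nat.find hex, Nat.find_spec hex, ?_⟩
  have hlow : 2 ^ Nat.find hex * ε / 2 ≤ ε + ‖x‖ := by
    rcases h : Nat.find hex with _ | m
    · simp; linarith [norm_nonneg x]
    · have := Nat.find_min hex (m := m) (by omega)
      rw [pow_succ]; linarith
  set j := Nat.find hex
  calc maj ε x ≤ ε / (2 ^ j * ε / 2) ^ (n + 1) := by
        unfold maj; gcongr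
    _ = _ := by
        rw [div_pow, one_div, inv_pow]; field_simp; ring

variable [FiniteDimensional ℝ E] [MeasurableSpace E] [BorelSpace E]

lemma integrable_maj_one : Integrable (maj 1 : E → ℝ) := by
  have h := integrable_one_add_norm (E := E) (μ := volume) (r := Module.finrank ℝ E + 1) (by simp)
  refine h.congr (Eventually.of_forall fun x => ?_)
  have h0 : 0 ≤ 1 + ‖x‖ := by positivity
  simp only [maj]
  rw [Real.rpow_neg h0, one_div]
  norm_cast

lemma integrable_maj {ε : ℝ} (hε : 0 < ε) : Integrable (maj ε : E → ℝ) := by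
  have := ((integrable_maj_one (E := E)).comp_smul (inv_pos.2 hε).ne').const_mul
    (ε ^ Module.finrank ℝ E)⁻¹
  exact this.congr (Eventually.of_forall fun x => (maj_eq_smul hε x).symm)

lemma integral_maj {ε : ℝ} (hε : 0 < ε) : ∫ x : E, maj ε x = ∫ x : E, maj 1 x := by
  simp_rw [maj_eq_smul hε]
  rw [integral_const_mul, Measure.integral_comp_smul, inv_pow, inv_inv,
    abs_of_pos (by positivity), smul_eq_mul, inv_mul_cancel_left₀ (by positivity)]

lemma volume_real_closedBall (x : E) {r : ℝ} (hr : 0 ≤ r) :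
    volume.real (Metric.closedBall x r) =
      r ^ Module.finrank ℝ E * volume.real (Metric.ball (0 : E) 1) := by
  rw [measureReal_def, Measure.addHaar_closedBall _ _ hr, ENNReal.toReal_mul,
    ENNReal.toReal_ofReal (by positivity), measureReal_def]

lemma volume_real_unitBall_pos : 0 < volume.real (Metric.ball (0 : E) 1) :=
  ENNReal.toReal_pos (Metric.measure_ball_pos _ _ one_pos).ne' measure_ball_lt_top.ne

lemma integral_norm_sub_mul_maj_le {f : E → ℂ} (hf : Integrable f) (x : E) {A : ℝ → ℝ}
    (hA0 : ∀ r, 0 < r → 0 ≤ A r)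
    (hA : ∀ r, 0 < r → ∫ y in Metric.closedBall x r, ‖f y - f x‖ ≤
      r ^ Module.finrank ℝ E * A r) {ε : ℝ} (hε : 0 < ε)
    (hs : Summable fun j : ℕ => (1 / 2 : ℝ) ^ j * A (2 ^ j * ε)) :
    ∫ y, ‖f y - f x‖ * maj ε (x - y) ≤
      2 ^ (Module.finrank ℝ E + 1) * ∑' j : ℕ, (1 / 2 : ℝ) ^ j * A (2 ^ j * ε) := by
  set n := Module.finrank ℝ E with hn
  have hsum0 : ∀ j : ℕ, 0 ≤ (1 / 2 : ℝ) ^ j * A (2 ^ j * ε) := fun j =>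
    mul_nonneg (by positivity) (hA0 _ (by positivity))
  have hmeas : AEStronglyMeasurable (fun y => ‖f y - f x‖ * maj ε (x - y)) :=
    ((hf.aestronglyMeasurable.sub aestronglyMeasurable_const).norm).mul
      ((continuous_maj hε).comp (continuous_const.sub continuous_id)).aestronglyMeasurable
  have hnn : ∀ y, 0 ≤ ‖f y - f x‖ * maj ε (x - y) := fun y =>
    mul_nonneg (norm_nonneg _) (maj_nonneg hε.le _)
  rw [integral_eq_lintegral_of_nonneg_ae (Eventually.of_forall hnn) hmeas]
  refine ENNReal.toReal_le_of_le_ofReal (mul_nonneg (by positivity) (tsum_nonneg hsum0)) ?_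
  set c : ℕ → ℝ := fun j => 2 ^ (n + 1) * (1 / 2) ^ j / (2 ^ j * ε) ^ n with hc
  have hc0 : ∀ j, 0 ≤ c j := fun j => by simp only [hc]; positivity
  have hfm : AEMeasurable (fun y => ENNReal.ofReal ‖f y - f x‖) :=
    (hf.aestronglyMeasurable.sub aestronglyMeasurable_const).norm.aemeasurable.ennreal_ofReal
  calc ∫⁻ y, ENNReal.ofReal (‖f y - f x‖ * maj ε (x - y))
      ≤ ∫⁻ y, ∑' j : ℕ, (Metric.closedBall x (2 ^ j * ε)).indicator
          (fun y => ENNReal.ofReal (c j) * ENNReal.ofReal ‖f y - f x‖) y := by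
        refine lintegral_mono fun y => ?_
        obtain ⟨j, hj, hj'⟩ := maj_le_dyadic hε (x - y)
        refine le_trans ?_ (ENNReal.le_tsum j)
        rw [indicator_of_mem (by rw [Metric.mem_closedBall, dist_comm, dist_eq_norm]; exact hj),
          ← ENNReal.ofReal_mul (hc0 j)]
        refine ENNReal.ofReal_le_ofReal ?_
        rw [mul_comm]
        gcongr
    _ = ∑' j : ℕ, ENNReal.ofReal (c j) *
          ∫⁻ y in Metric.closedBall x (2 ^ j * ε), ENNReal.ofReal ‖f y - f x‖ := by
        rw [lintegral_tsum fun j => (hfm.const_mul _).indicator measurableSet_closedBall]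
        congr 1 with j
        rw [lintegral_indicator measurableSet_closedBall, lintegral_const_mul'' _ hfm.restrict]
    _ ≤ ∑' j : ℕ, ENNReal.ofReal (2 ^ (n + 1) * ((1 / 2 : ℝ) ^ j * A (2 ^ j * ε))) := by
        refine ENNReal.tsum_le_tsum fun j => ?_
        have hr : (0 : ℝ) < 2 ^ j * ε := by positivity
        have hi : IntegrableOn (fun y => ‖f y - f x‖) (Metric.closedBall x (2 ^ j * ε)) :=
          (hf.integrableOn.sub (integrableOn_const measure_closedBall_lt_top.ne)).norm
        rw [← ofReal_integral_eq_lintegral_ofReal hi (Eventually.of_forall fun y => norm_nonneg _),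
          ← ENNReal.ofReal_mul (hc0 j)]
        refine ENNReal.ofReal_le_ofReal ?_
        calc c j * ∫ y in Metric.closedBall x (2 ^ j * ε), ‖f y - f x‖
            ≤ c j * ((2 ^ j * ε) ^ n * A (2 ^ j * ε)) := by
              gcongr
              exact hA _ hr
          _ = _ := by simp only [hc]; field_simp
    _ = ENNReal.ofReal (2 ^ (n + 1) * ∑' j : ℕ, (1 / 2 : ℝ) ^ j * A (2 ^ j * ε)) := by
        rw [← tsum_mul_left, ENNReal.ofReal_tsum_of_nonneg _ (hs.mul_left _)]
        exact fun j => mul_nonneg (by positivity) (hsum0 j)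

lemma ae_tendsto_integral_norm_sub_mul_maj {f : E → ℂ} (hf : Integrable f) :
    ∀ᵐ x, Tendsto (fun ε => ∫ y, ‖f y - f x‖ * maj ε (x - y)) (𝓝[>] 0) (𝓝 0) := by
  set n := Module.finrank ℝ E with hn
  filter_upwards [IsUnifLocDoublingMeasure.ae_tendsto_average_norm_sub volume
    hf.locallyIntegrable 1] with x hx
  set ω := volume.real (Metric.ball (0 : E) 1) with hω
  have hω0 : 0 < ω := volume_real_unitBall_pos
  set A : ℝ → ℝ := fun r => ω * ⨍ y in Metric.closedBall x r, ‖f y - f x‖ with hAdef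
  have hA0 : ∀ r, 0 ≤ A r := fun r => by
    refine mul_nonneg hω0.le ?_
    rw [setAverage_eq]
    exact smul_nonneg (by positivity) (integral_nonneg fun _ => norm_nonneg _)
  have hA : ∀ r, 0 < r → ∫ y in Metric.closedBall x r, ‖f y - f x‖ = r ^ n * A r := by
    intro r hr
    simp only [hAdef]
    rw [setAverage_eq, volume_real_closedBall x hr.le, ← hω, smul_eq_mul, ← hn]
    field_simp
  have hlim : Tendsto A (𝓝[>] 0) (𝓝 0) := by
    have h1 := hx (l := 𝓝[>] (0 : ℝ)) (fun _ => x) id tendsto_id (by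
      filter_upwards [self_mem_nhdsWithin] with r hr
      simpa using (le_of_lt hr))
    simpa using h1.const_mul ω
  obtain ⟨r₀, hr₀, hr₀'⟩ : ∃ r₀ > 0, ∀ r, 0 < r → r < r₀ → A r ≤ 1 := by
    have := hlim.eventually_le_const (zero_lt_one)
    rw [eventually_nhdsWithin_iff, Metric.eventually_nhds_iff] at this
    obtain ⟨δ, hδ, h⟩ := this
    exact ⟨δ, hδ, fun r hr hr' => h (by simpa [abs_of_pos hr] using hr') hr⟩
  set B : ℝ := 1 + (∫ y, ‖f y‖) / r₀ ^ n + ω * ‖f x‖ with hB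
  have hI0 : 0 ≤ ∫ y, ‖f y‖ := integral_nonneg fun _ => norm_nonneg _
  have hAB : ∀ r, 0 < r → A r ≤ B := by
    intro r hr
    rcases lt_or_ge r r₀ with h | h
    · have := hr₀' r hr h
      have h2 : 0 ≤ (∫ y, ‖f y‖) / r₀ ^ n + ω * ‖f x‖ := by positivity
      linarith
    · have h1 : ∫ y in Metric.closedBall x r, ‖f y - f x‖ ≤
          (∫ y, ‖f y‖) + r ^ n * ω * ‖f x‖ := by
        have hc : IntegrableOn (fun _ : E => ‖f x‖) (Metric.closedBall x r) :=
          integrableOn_const measure_closedBall_lt_top.ne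
        calc ∫ y in Metric.closedBall x r, ‖f y - f x‖
            ≤ ∫ y in Metric.closedBall x r, (‖f y‖ + ‖f x‖) := by
              refine integral_mono_of_nonneg (Eventually.of_forall fun _ => norm_nonneg _)
                (hf.norm.integrableOn.add hc) (Eventually.of_forall fun y => norm_sub_le _ _)
          _ = (∫ y in Metric.closedBall x r, ‖f y‖) + r ^ n * ω * ‖f x‖ := by
              rw [integral_add hf.norm.integrableOn hc, setIntegral_const,
                volume_real_closedBall x hr.le, smul_eq_mul]
          _ ≤ _ := by
              exact add_le_add_left (setIntegral_le_integral hf.norm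
                (Eventually.of_forall fun _ => norm_nonneg _)) _
      rw [hA r hr] at h1
      have h2 : A r ≤ (∫ y, ‖f y‖) / r ^ n + ω * ‖f x‖ := by
        rw [← mul_le_mul_iff_right₀ (pow_pos hr n)]
        refine h1.trans (le_of_eq ?_)
        field_simp
      have h3 : (∫ y, ‖f y‖) / r ^ n ≤ (∫ y, ‖f y‖) / r₀ ^ n := by gcongr
      linarith
  have hgeo : Summable fun j : ℕ => (1 / 2 : ℝ) ^ j * B :=
    (summable_geometric_of_lt_one (by norm_num) (by norm_num)).mul_right B
  have hbound : ∀ ε : ℝ, 0 < ε → ∀ j : ℕ,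
      ‖(1 / 2 : ℝ) ^ j * A (2 ^ j * ε)‖ ≤ (1 / 2 : ℝ) ^ j * B := fun ε hε j => by
    rw [Real.norm_of_nonneg (mul_nonneg (by positivity) (hA0 _))]
    gcongr
    exact hAB _ (by positivity)
  have hT : Tendsto (fun ε : ℝ => ∑' j : ℕ, (1 / 2 : ℝ) ^ j * A (2 ^ j * ε)) (𝓝[>] 0)
      (𝓝 (∑' _ : ℕ, (0 : ℝ))) := by
    refine tendsto_tsum_of_dominated_convergence hgeo (fun j => ?_) ?_
    · have h1 : Tendsto (fun ε : ℝ => 2 ^ j * ε) (𝓝[>] 0) (𝓝[>] 0) := by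
        refine tendsto_nhdsWithin_iff.2 ⟨?_, ?_⟩
        · have : Tendsto (fun ε : ℝ => (2 : ℝ) ^ j * ε) (𝓝 0) (𝓝 (2 ^ j * 0)) :=
            tendsto_id.const_mul _
          rw [mul_zero] at this
          exact this.mono_left nhdsWithin_le_nhds
        · filter_upwards [self_mem_nhdsWithin] with ε hε
          exact mul_pos (pow_pos two_pos j) (mem_Ioi.1 hε)
      simpa using (hlim.comp h1).const_mul ((1 / 2 : ℝ) ^ j)
    · filter_upwards [self_mem_nhdsWithin] with ε hε j
      exact hbound ε hε j
  rw [tsum_zero] at hT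
  have hT' := hT.const_mul ((2 : ℝ) ^ (n + 1))
  rw [mul_zero] at hT'
  refine squeeze_zero' ?_ ?_ hT'
  · filter_upwards [self_mem_nhdsWithin] with ε hε
    exact integral_nonneg fun y => mul_nonneg (norm_nonneg _) (maj_nonneg (le_of_lt hε) _)
  · filter_upwards [self_mem_nhdsWithin] with ε hε
    exact integral_norm_sub_mul_maj_le hf x (fun r _ => hA0 r) (fun r hr => (hA r hr).le) hε
      (hgeo.of_norm_bounded (hbound ε hε))

end Lebesgue

section Mollifier

variable {E : Type*} [NormedAddCommGroup E] [InnerProductSpace ℝ E]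

lemma continuous_conjPoisson (v : E) {η : ℝ} (hη : 0 < η) : Continuous (conjPoisson v η) := by
  unfold conjPoisson
  refine Continuous.div (by fun_prop) ?_ fun x => pow_ne_zero _ (hyp_pos x hη).ne'
  unfold hyp
  fun_prop

lemma abs_conjPoisson_le_const (v : E) {η : ℝ} (hη : 0 < η) (x : E) :
    |conjPoisson v η x| ≤ ‖v‖ / η ^ Module.finrank ℝ E :=
  abs_conjPoisson_le x hη ((le_abs_self η).trans (abs_le_hyp x η))

lemma norm_ofReal_conjPoisson_le (v : E) {η : ℝ} (hη : 0 < η) (x : E) :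
    ‖(conjPoisson v η x : ℂ)‖ ≤ ‖v‖ / η ^ Module.finrank ℝ E := by
  rw [Complex.norm_real]
  exact abs_conjPoisson_le_const v hη x

/-- The locally integrable function `|x|^{1-n}`. -/
def sing (x : E) : ℝ := ‖x‖ * (‖x‖ ^ Module.finrank ℝ E)⁻¹

lemma abs_conjPoisson_mul_norm_le (v : E) (η : ℝ) (x : E) :
    |conjPoisson v η x| * ‖x‖ ≤ ‖v‖ * sing x := by
  rcases eq_or_ne x 0 with rfl | hx
  · simp [sing]
  · have := abs_conjPoisson_le (v := v) x (norm_pos_iff.2 hx) (norm_le_hyp x η)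
    calc |conjPoisson v η x| * ‖x‖ ≤ ‖v‖ / ‖x‖ ^ Module.finrank ℝ E * ‖x‖ := by gcongr
      _ = _ := by unfold sing; ring

variable [FiniteDimensional ℝ E] [MeasurableSpace E] [BorelSpace E]

variable (E) in
/-- The mass of the unnormalized tent function. -/
def tentMass : ℝ := ∫ x : E, max (1 - ‖x‖) 0

/-- The normalized tent function supported in the ball of radius `ε`. -/
def tent (ε : ℝ) (x : E) : ℝ :=
  (tentMass E * ε ^ Module.finrank ℝ E)⁻¹ * max (1 - ‖ε⁻¹ • x‖) 0

lemma integrable_tent_one : Integrable fun x : E => max (1 - ‖x‖) 0 := by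
  refine Continuous.integrable_of_hasCompactSupport (by fun_prop) ?_
  refine HasCompactSupport.of_support_subset_isCompact (isCompact_closedBall (0 : E) 1) ?_
  intro x hx
  by_contra h
  simp only [Metric.mem_closedBall, dist_zero_right, not_le] at h
  exact hx (max_eq_right (by linarith))

lemma tentMass_pos : 0 < tentMass E := by
  unfold tentMass
  refine (integral_pos_iff_support_of_nonneg (f := fun x : E => max (1 - ‖x‖) 0)
    (fun x => le_max_right _ _) integrable_tent_one).2 ?_
  refine (Metric.measure_ball_pos volume (0 : E) one_pos).trans_le (measure_mono fun x hx => ?_)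
  rw [mem_ball_zero_iff] at hx
  exact (lt_max_of_lt_left (by linarith)).ne'

lemma tent_nonneg {ε : ℝ} (hε : 0 < ε) (x : E) : 0 ≤ tent ε x := by
  have := tentMass_pos (E := E)
  exact mul_nonneg (by positivity) (le_max_right _ _)

lemma tent_neg (ε : ℝ) (x : E) : tent ε (-x) = tent ε x := by simp [tent]

lemma tent_eq_zero {ε : ℝ} (hε : 0 < ε) {x : E} (hx : ε ≤ ‖x‖) : tent ε x = 0 := by
  rw [tent, max_eq_right, mul_zero]
  rw [norm_smul, Real.norm_eq_abs, abs_of_pos (inv_pos.2 hε), sub_nonpos, ← div_eq_inv_mul,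
    one_le_div hε]
  exact hx

lemma continuous_tent (ε : ℝ) : Continuous (tent ε : E → ℝ) := by
  unfold tent; fun_prop

lemma integrable_tent {ε : ℝ} (hε : 0 < ε) : Integrable (tent ε : E → ℝ) :=
  ((integrable_tent_one (E := E)).comp_smul (inv_pos.2 hε).ne').const_mul _

lemma integral_tent {ε : ℝ} (hε : 0 < ε) : ∫ x : E, tent ε x = 1 := by
  have h := tentMass_pos (E := E)
  simp only [tent]
  rw [integral_const_mul, Measure.integral_comp_smul volume (fun x : E => max (1 - ‖x‖) 0),
    inv_pow, inv_inv, abs_of_pos (by positivity), smul_eq_mul]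
  change _ * (_ * tentMass E) = 1
  field_simp

lemma tent_le {ε : ℝ} (hε : 0 < ε) (x : E) :
    tent ε x ≤ (tentMass E * ε ^ Module.finrank ℝ E)⁻¹ := by
  have := tentMass_pos (E := E)
  refine mul_le_of_le_one_right (by positivity) (max_le ?_ zero_le_one)
  simp

lemma tent_le_maj {ε : ℝ} (hε : 0 < ε) (x : E) :
    tent ε x ≤ (tentMass E)⁻¹ * 2 ^ (Module.finrank ℝ E + 1) * maj ε x := by
  have h0 := tentMass_pos (E := E)
  rcases le_or_gt ε ‖x‖ with h | h
  · rw [tent_eq_zero hε h]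
    have := maj_nonneg hε.le x
    positivity
  · refine (tent_le hε x).trans ?_
    set n := Module.finrank ℝ E with hn
    unfold maj
    rw [← hn]
    calc (tentMass E * ε ^ n)⁻¹ = (tentMass E)⁻¹ * (ε / ε ^ (n + 1)) := by
          field_simp; ring
      _ ≤ (tentMass E)⁻¹ * (ε / ((ε + ‖x‖) / 2) ^ (n + 1)) := by
          gcongr
          linarith
      _ = _ := by rw [div_pow]; field_simp

lemma abs_tent_sub_le {ε : ℝ} (hε : 0 < ε) (x y : E) :
    |tent ε x - tent ε y| ≤ (tentMass E * ε ^ Module.finrank ℝ E)⁻¹ * (ε⁻¹ * ‖x - y‖) := by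
  have h0 := tentMass_pos (E := E)
  rw [tent, tent, ← mul_sub, abs_mul, abs_of_pos (inv_pos.2 (by positivity))]
  gcongr
  refine (abs_max_sub_max_le_abs _ _ _).trans ?_
  rw [show (1 - ‖ε⁻¹ • x‖ - (1 - ‖ε⁻¹ • y‖)) = ‖ε⁻¹ • y‖ - ‖ε⁻¹ • x‖ by ring]
  refine (abs_norm_sub_norm_le _ _).trans ?_
  rw [← smul_sub, norm_smul, Real.norm_eq_abs, abs_of_pos (inv_pos.2 hε), norm_sub_rev]

lemma integrableOn_sing [Nontrivial E] (r : ℝ) : IntegrableOn (sing : E → ℝ) (Metric.ball 0 r) := by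
  have h := (integrableOn_fun_norm_addHaar (E := E) volume (r := r)
    (f := fun t : ℝ => t * (t ^ Module.finrank ℝ E)⁻¹)).2
  refine h ?_
  have h1 : IntegrableOn (fun _ : ℝ => (1 : ℝ)) (Ioo 0 r) := integrableOn_const (by simp)
  refine h1.congr_fun (fun t ht => ?_) measurableSet_Ioo
  have h2 : 0 < Module.finrank ℝ E := Module.finrank_pos
  have h3 : t ^ Module.finrank ℝ E = t ^ (Module.finrank ℝ E - 1) * t := by
    rw [← pow_succ, Nat.sub_add_cancel h2]
  have h4 : t ≠ 0 := ht.1.ne'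
  rw [h3, smul_eq_mul]
  field_simp

lemma setIntegral_sing [Nontrivial E] {ε : ℝ} (hε : 0 < ε) (r : ℝ) :
    ∫ x in Metric.ball (0 : E) (r * ε), sing x = ε * ∫ x in Metric.ball (0 : E) r, sing x := by
  rw [← integral_indicator measurableSet_ball, ← integral_indicator measurableSet_ball]
  have h := Measure.integral_comp_smul (volume : Measure E)
    ((Metric.ball (0 : E) (r * ε)).indicator sing) ε
  have h2 : ∀ x : E, (Metric.ball (0 : E) (r * ε)).indicator sing (ε • x) =
      ε * (ε ^ Module.finrank ℝ E)⁻¹ * (Metric.ball (0 : E) r).indicator sing x := by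
    intro x
    by_cases hx : x ∈ Metric.ball (0 : E) r
    · have : ε • x ∈ Metric.ball (0 : E) (r * ε) := by
        rw [mem_ball_zero_iff] at hx ⊢
        rw [norm_smul, Real.norm_of_nonneg hε.le, mul_comm]
        gcongr
      rw [indicator_of_mem hx, indicator_of_mem this, sing, sing, norm_smul,
        Real.norm_of_nonneg hε.le, mul_pow, mul_inv]
      ring
    · have : ε • x ∉ Metric.ball (0 : E) (r * ε) := by
        rw [mem_ball_zero_iff, not_lt] at hx ⊢
        rw [norm_smul, Real.norm_of_nonneg hε.le, mul_comm r]
        gcongr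
      rw [indicator_of_notMem hx, indicator_of_notMem this, mul_zero]
  simp_rw [h2] at h
  rw [integral_const_mul, smul_eq_mul, abs_of_pos (by positivity), mul_comm ε, mul_assoc] at h
  exact (mul_left_cancel₀ (by positivity) h).symm

/-- The mollified conjugate Poisson kernel. -/
def mollKernel (v : E) (η ε : ℝ) (x : E) : ℝ := ∫ y, conjPoisson v η y * tent ε (x - y)

lemma integrable_conjPoisson_mul_tent (v : E) {η ε : ℝ} (hη : 0 < η) (hε : 0 < ε) (x : E) :
    Integrable fun y => conjPoisson v η y * tent ε (x - y) := by
  refine ((integrable_tent hε).comp_sub_left x).bdd_mul (c := ‖v‖ / η ^ Module.finrank ℝ E)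
    (continuous_conjPoisson v hη).aestronglyMeasurable (Eventually.of_forall fun y => ?_)
  exact abs_conjPoisson_le_const v hη y

variable (E) in
/-- The constant in the near-field estimate of the mollified kernel. -/
def nearC : ℝ := (tentMass E)⁻¹ * (∫ x in Metric.ball (0 : E) 3, sing x) *
  3 ^ (Module.finrank ℝ E + 1)

lemma integral_sing_nonneg : 0 ≤ ∫ x in Metric.ball (0 : E) 3, sing x :=
  integral_nonneg fun x => by unfold sing; positivity

lemma nearC_nonneg : 0 ≤ nearC E := by
  have h0 := tentMass_pos (E := E)
  have := integral_sing_nonneg (E := E)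
  unfold nearC
  positivity

lemma integral_tent_sub {ε : ℝ} (hε : 0 < ε) (x : E) : ∫ y : E, tent ε (x - y) = 1 := by
  rw [integral_sub_left_eq_self (fun y : E => tent ε y) volume x, integral_tent hε]

lemma abs_mollKernel_sub_le_of_far (v : E) {η ε : ℝ} (hη : 0 < η) (hε : 0 < ε) {x : E}
    (hx : 2 * ε ≤ ‖x‖) : |mollKernel v η ε x - conjPoisson v η x| ≤ regC v * maj ε x := by
  have ht : Integrable fun y : E => tent ε (x - y) := (integrable_tent hε).comp_sub_left x
  have e : mollKernel v η ε x - conjPoisson v η x =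
      ∫ y, (conjPoisson v η y - conjPoisson v η x) * tent ε (x - y) := by
    simp_rw [sub_mul]
    rw [integral_sub (integrable_conjPoisson_mul_tent v hη hε x) (ht.const_mul _),
      integral_const_mul, integral_tent_sub hε, mul_one]
    rfl
  rw [e, ← Real.norm_eq_abs]
  calc _ ≤ ∫ y, regC v * maj ε x * tent ε (x - y) := by
        refine norm_integral_le_of_norm_le (ht.const_mul _) (Eventually.of_forall fun y => ?_)
        rw [norm_mul, Real.norm_eq_abs, Real.norm_of_nonneg (tent_nonneg hε _)]
        rcases le_or_gt ε ‖x - y‖ with h | h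
        · rw [tent_eq_zero hε h]; simp
        · gcongr
          · exact tent_nonneg hε _
          · rw [abs_sub_comm]
            exact abs_conjPoisson_sub_le_maj hε hx h.le
    _ = _ := by rw [integral_const_mul, integral_tent_sub hε, mul_one]

lemma abs_mollKernel_le_of_near [Nontrivial E] (v : E) {η ε : ℝ} (hη : 0 < η) (hε : 0 < ε) {x : E}
    (hx : ‖x‖ < 2 * ε) : |mollKernel v η ε x| ≤ ‖v‖ * nearC E * maj ε x := by
  set n := Module.finrank ℝ E with hn
  set B := Metric.ball (0 : E) (3 * ε) with hB
  have h0 := tentMass_pos (E := E)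
  have hkB : IntegrableOn (conjPoisson v η) B := by
    refine Measure.integrableOn_of_bounded (M := ‖v‖ / η ^ n) measure_ball_lt_top.ne
      (continuous_conjPoisson v hη).aestronglyMeasurable (Eventually.of_forall fun y => ?_)
    exact abs_conjPoisson_le_const v hη y
  have hodd : ∫ y in B, conjPoisson v η y = 0 := by
    rw [← integral_indicator measurableSet_ball]
    have h1 := integral_neg_eq_self (B.indicator (conjPoisson v η)) volume
    have h2 : ∀ y, B.indicator (conjPoisson v η) (-y) = -B.indicator (conjPoisson v η) y := by
      intro y
      by_cases hy : y ∈ B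
      · rw [indicator_of_mem hy, indicator_of_mem (by simpa [hB] using hy), conjPoisson_neg]
      · rw [indicator_of_notMem hy, indicator_of_notMem (by simpa [hB] using hy), neg_zero]
    simp_rw [h2] at h1
    rw [integral_neg] at h1
    linarith
  have e : mollKernel v η ε x =
      ∫ y in B, conjPoisson v η y * (tent ε (x - y) - tent ε x) := by
    simp_rw [mul_sub]
    rw [integral_sub (integrable_conjPoisson_mul_tent v hη hε x).integrableOn
      (hkB.mul_const _), integral_mul_const, hodd, zero_mul, sub_zero, mollKernel,
      setIntegral_eq_integral_of_forall_compl_eq_zero]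
    intro y hy
    rw [hB, mem_ball_zero_iff, not_lt] at hy
    rw [tent_eq_zero hε, mul_zero]
    have := norm_sub_norm_le y x
    rw [norm_sub_rev]
    linarith
  rw [e, ← Real.norm_eq_abs]
  set c := (tentMass E * ε ^ n)⁻¹ with hc
  calc _ ≤ ∫ y in B, ‖v‖ * (c * ε⁻¹) * sing y := by
        refine norm_integral_le_of_norm_le ((integrableOn_sing (3 * ε)).const_mul _)
          (Eventually.of_forall fun y => ?_)
        rw [norm_mul, Real.norm_eq_abs, Real.norm_eq_abs]
        have h1 := abs_tent_sub_le hε (x - y) x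
        rw [sub_sub_cancel_left, norm_neg, ← hn, ← hc] at h1
        calc |conjPoisson v η y| * |tent ε (x - y) - tent ε x|
            ≤ |conjPoisson v η y| * (c * (ε⁻¹ * ‖y‖)) := by gcongr
          _ = c * ε⁻¹ * (|conjPoisson v η y| * ‖y‖) := by ring
          _ ≤ c * ε⁻¹ * (‖v‖ * sing y) :=
            mul_le_mul_of_nonneg_left (abs_conjPoisson_mul_norm_le v η y) (by positivity)
          _ = _ := by ring
    _ = ‖v‖ * ((tentMass E)⁻¹ * (∫ x in Metric.ball (0 : E) 3, sing x)) *
          (ε / ε ^ (n + 1)) := by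
        rw [integral_const_mul, hB, setIntegral_sing hε, hc]
        field_simp
        ring
    _ ≤ ‖v‖ * ((tentMass E)⁻¹ * (∫ x in Metric.ball (0 : E) 3, sing x)) *
          (ε / ((ε + ‖x‖) / 3) ^ (n + 1)) := by
        have := integral_sing_nonneg (E := E)
        gcongr
        linarith
    _ = _ := by
        unfold nearC maj
        rw [div_pow, ← hn]
        field_simp

/-- The constant in the comparison of the mollified kernel with the kernel itself. -/
def mollC (v : E) : ℝ := 2 * regC v + ‖v‖ * nearC E

lemma mollC_nonneg (v : E) : 0 ≤ mollC v := by
  have := regC_nonneg v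
  have := nearC_nonneg (E := E)
  unfold mollC
  positivity

lemma abs_mollKernel_sub_le [Nontrivial E] (v : E) {η ε : ℝ} (hη : 0 < η) (hηε : η ≤ ε) (x : E) :
    |mollKernel v η ε x - conjPoisson v ε x| ≤ mollC v * maj ε x := by
  have hε := hη.trans_le hηε
  have hm := maj_nonneg hε.le x
  have hr := mul_nonneg (regC_nonneg v) hm
  have hN := mul_nonneg (mul_nonneg (norm_nonneg v) (nearC_nonneg (E := E))) hm
  have e : mollC v * maj ε x = regC v * maj ε x + regC v * maj ε x +
    ‖v‖ * nearC E * maj ε x := by unfold mollC; ring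
  rw [e]
  rcases le_or_gt (2 * ε) ‖x‖ with hx | hx
  · have h1 := abs_mollKernel_sub_le_of_far v hη hε hx
    have h2 := abs_conjPoisson_sub_le_maj' (v := v) (x := x) (η := η) (θ := ε) hε (by linarith)
      (by rw [abs_sub_comm, abs_of_nonneg (by linarith)]; linarith)
    have := abs_sub_le (mollKernel v η ε x) (conjPoisson v η x) (conjPoisson v ε x)
    linarith
  · have h1 := abs_mollKernel_le_of_near v hη hε hx
    have h2 := abs_conjPoisson_le_maj (v := v) hε hx.le
    have := abs_sub (mollKernel v η ε x) (conjPoisson v ε x)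
    linarith

lemma mollKernel_neg (v : E) (η ε : ℝ) (x : E) :
    mollKernel v η ε (-x) = -mollKernel v η ε x := by
  unfold mollKernel
  rw [← integral_neg_eq_self, ← integral_neg]
  congr 1 with y
  rw [conjPoisson_neg, ← tent_neg]
  simp only [neg_sub_neg, neg_mul]
  congr 3
  abel

end Mollifier

section Plancherel

open FourierTransform

variable {E : Type*} [NormedAddCommGroup E] [InnerProductSpace ℝ E] [FiniteDimensional ℝ E]
  [MeasurableSpace E] [BorelSpace E]

lemma integrable_gaussian {c : ℝ} (hc : 0 < c) :
    Integrable fun ξ : E => Real.exp (-c * ‖ξ‖ ^ 2) := by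
  have h := (GaussianFourier.integrable_cexp_neg_mul_sq_norm_add (V := E) (b := (c : ℂ))
    (by simpa using hc) 0 0).norm
  refine h.congr (Eventually.of_forall fun ξ => ?_)
  simp only [zero_mul, add_zero]
  rw [Complex.norm_exp]
  congr 1
  norm_cast

lemma mul_exp_neg_mul_sq_le {c : ℝ} (hc : 0 < c) (t : ℝ) :
    t * Real.exp (-c * t ^ 2) ≤ (√c)⁻¹ * Real.exp (-(c / 2) * t ^ 2) := by
  have h1 : √c * t ≤ Real.exp (c / 2 * t ^ 2) := by
    have := Real.add_one_le_exp (c / 2 * t ^ 2)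
    nlinarith [sq_nonneg (√c * t - 1), Real.sq_sqrt hc.le]
  have h2 : Real.exp (-(c / 2) * t ^ 2) = Real.exp (c / 2 * t ^ 2) * Real.exp (-c * t ^ 2) := by
    rw [← Real.exp_add]; congr 1; ring
  rw [h2, ← mul_assoc, ]
  gcongr
  rw [← div_eq_inv_mul, le_div_iff₀ (Real.sqrt_pos.2 hc), mul_comm]
  exact h1

lemma integrable_norm_mul_gaussian {c : ℝ} (hc : 0 < c) :
    Integrable fun ξ : E => ‖ξ‖ * Real.exp (-c * ‖ξ‖ ^ 2) := by
  refine ((integrable_gaussian (E := E) (half_pos hc)).const_mul (√c)⁻¹).mono'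
    (by fun_prop) (Eventually.of_forall fun ξ => ?_)
  rw [Real.norm_of_nonneg (by positivity)]
  exact mul_exp_neg_mul_sq_le hc _

lemma fourier_gaussian_ofReal {c : ℝ} (hc : 0 < c) (z : E) :
    𝓕 (fun ξ : E => (Real.exp (-c * ‖ξ‖ ^ 2) : ℂ)) z =
      ((√(Real.pi / c) ^ Module.finrank ℝ E * Real.exp (-(Real.pi ^ 2 / c) * ‖z‖ ^ 2) : ℝ) : ℂ) := by
  have h := fourier_gaussian_innerProductSpace (V := E) (b := (c : ℂ)) (by simpa using hc) z
  have e : (fun ξ : E => (Real.exp (-c * ‖ξ‖ ^ 2) : ℂ)) = fun ξ => Complex.exp (-c * ‖ξ‖ ^ 2) := by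
    ext ξ; push_cast; rfl
  have hp : (0 : ℝ) ≤ Real.pi / c := by positivity
  rw [e, h, Complex.ofReal_mul]
  congr 1
  · rw [← Real.rpow_natCast, Real.sqrt_eq_rpow, ← Real.rpow_mul hp, Complex.ofReal_cpow hp]
    push_cast
    ring_nf
  · push_cast
    ring_nf

lemma fourier_inner_mul_gaussian (v : E) {c : ℝ} (hc : 0 < c) (z : E) :
    𝓕 (fun ξ : E => ((inner ℝ ξ v * Real.exp (-c * ‖ξ‖ ^ 2) : ℝ) : ℂ)) z =
      -Complex.I * ((Real.pi / c * √(Real.pi / c) ^ Module.finrank ℝ E *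
        (inner ℝ v z * Real.exp (-(Real.pi ^ 2 / c) * ‖z‖ ^ 2)) : ℝ) : ℂ) := by
  set f : E → ℂ := fun ξ => (Real.exp (-c * ‖ξ‖ ^ 2) : ℂ) with hf
  have hi : Integrable f := (integrable_gaussian hc).ofReal
  have hi2 : Integrable fun ξ => ‖ξ‖ * ‖f ξ‖ := by
    refine (integrable_norm_mul_gaussian (E := E) hc).congr (Eventually.of_forall fun ξ => ?_)
    simp only [hf, Complex.norm_real, Real.norm_of_nonneg (Real.exp_pos _).le]
  have h1 := Real.hasFDerivAt_fourier hi hi2 z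
  have hxf : Integrable (VectorFourier.fourierSMulRight (innerSL ℝ) f) := by
    refine (hi2.const_mul (2 * Real.pi * ‖innerSL ℝ (E := E)‖)).mono'
      ((hi.aestronglyMeasurable).fourierSMulRight) (Eventually.of_forall fun ξ => ?_)
    refine (VectorFourier.norm_fourierSMulRight_le _ _ _).trans (le_of_eq (by ring))
  have h2 : HasFDerivAt (𝓕 f) (Complex.ofRealCLM.comp
      ((√(Real.pi / c) ^ Module.finrank ℝ E *
        Real.exp (-(Real.pi ^ 2 / c) * ‖z‖ ^ 2)) • ((-(Real.pi ^ 2 / c)) • (2 • innerSL ℝ z)))) z := by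
    have e : 𝓕 f = fun z => ((√(Real.pi / c) ^ Module.finrank ℝ E *
        Real.exp (-(Real.pi ^ 2 / c) * ‖z‖ ^ 2) : ℝ) : ℂ) := funext (fourier_gaussian_ofReal hc)
    rw [e]
    have h3 := (((hasStrictFDerivAt_norm_sq z).hasFDerivAt.const_mul (-(Real.pi ^ 2 / c))).exp).const_mul
      (√(Real.pi / c) ^ Module.finrank ℝ E)
    rw [smul_smul] at h3
    exact Complex.ofRealCLM.hasFDerivAt.comp z h3
  have h3 := congrArg (fun L => L v) (h1.unique h2)
  rw [Real.fourier_continuousLinearMap_apply hxf] at h3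
  have e1 : (fun ξ => VectorFourier.fourierSMulRight (innerSL ℝ) f ξ v) =
      (-(2 * Real.pi * Complex.I)) • fun ξ : E =>
        ((inner ℝ ξ v * Real.exp (-c * ‖ξ‖ ^ 2) : ℝ) : ℂ) := by
    ext ξ
    simp [hf]
    rfl
  rw [e1] at h3
  have h4 : ∀ (r : ℂ) (g : E → ℂ), 𝓕 (r • g) z = r • 𝓕 g z := fun r g =>
    congrFun (VectorFourier.fourierIntegral_const_smul Real.fourierChar volume (innerₗ E) g r) z
  rw [h4] at h3
  have h5 : (2 * Real.pi * Complex.I : ℂ) ≠ 0 := Complex.two_pi_I_ne_zero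
  refine mul_left_cancel₀ (neg_ne_zero.2 h5) ?_
  rw [← smul_eq_mul, h3]
  simp only [ContinuousLinearMap.comp_apply, _root_.smul_apply, innerSL_apply_apply,
    Complex.ofRealCLM_apply, smul_eq_mul, nsmul_eq_mul]
  rw [real_inner_comm]
  push_cast
  linear_combination (-2 * Real.pi *
    (Real.pi / c * √(Real.pi / c) ^ Module.finrank ℝ E *
      (inner ℝ v z * Complex.exp (-(Real.pi ^ 2 / c) * ‖z‖ ^ 2))) : ℂ) * Complex.I_sq

lemma integrable_conv {f g : E → ℝ} (hf : Integrable f) (hg : Integrable g) :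
    Integrable fun x => ∫ y, f y * g (x - y) :=
  hf.integrable_convolution (ContinuousLinearMap.mul ℝ ℝ) hg

lemma integral_conv {f g : E → ℝ} (hf : Integrable f) (hg : Integrable g) :
    ∫ x, ∫ y, f y * g (x - y) = (∫ x, f x) * ∫ x, g x :=
  integral_convolution (ContinuousLinearMap.mul ℝ ℝ) hf hg

lemma integral_mul_fourier_sub {H a b : E → ℂ} (hH : Integrable H) (ha : Integrable a)
    (hb : Integrable b) :
    ∫ x, a x * ∫ y, b y * 𝓕 H (x - y) = ∫ ξ, H ξ * (𝓕 a ξ * 𝓕 b (-ξ)) := by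
  have key : ∀ {f g : E → ℂ}, Integrable f → Integrable g →
      ∫ ξ, 𝓕 f ξ * g ξ = ∫ x, f x * 𝓕 g x := by
    intro f g hf hg
    have := VectorFourier.integral_fourierIntegral_smul_eq_flip (μ := (volume : Measure E))
      (ν := (volume : Measure E)) (L := innerₗ E) Real.continuous_fourierChar
      continuous_inner hf hg
    simp only [smul_eq_mul] at this
    rw [flip_innerₗ] at this
    exact this
  have hb' : Integrable fun y => b (-y) := hb.comp_neg
  have hF : 𝓕 (fun y => b (-y)) = fun ξ => 𝓕 b (-ξ) := by
    rw [← Real.fourierInv_eq_fourier_comp_neg]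
    exact funext fun ξ => Real.fourierInv_eq_fourier_neg b ξ
  have hbc : Continuous fun ξ => 𝓕 b (-ξ) :=
    (VectorFourier.fourierIntegral_continuous Real.continuous_fourierChar
      (L := innerₗ E) continuous_inner hb).comp continuous_neg
  have hbb : ∀ ξ, ‖𝓕 b (-ξ)‖ ≤ ∫ y, ‖b y‖ := fun ξ =>
    VectorFourier.norm_fourierIntegral_le_integral_norm _ _ _ _ _
  have hg : Integrable fun ξ => H ξ * 𝓕 b (-ξ) :=
    hH.mul_bdd hbc.aestronglyMeasurable (Eventually.of_forall hbb)
  calc _ = ∫ x, a x * 𝓕 (fun ξ => H ξ * 𝓕 b (-ξ)) x := by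
        congr 1 with x
        congr 1
        have hHx : Integrable fun ξ => Real.fourierChar (-(inner ℝ ξ x)) • H ξ :=
          (Real.fourierIntegral_convergent_iff x).2 hH
        rw [Real.fourier_eq]
        calc _ = ∫ y, b (-y) * 𝓕 H (x - -y) := by
              rw [integral_neg_eq_self (fun y => b y * 𝓕 H (x - y))]
          _ = ∫ y, b (-y) * 𝓕 (fun ξ => Real.fourierChar (-(inner ℝ ξ x)) • H ξ) y := by
              congr 1 with y
              congr 1
              rw [Real.fourier_eq, Real.fourier_eq]
              congr 1 with ξ
              rw [smul_smul, ← AddChar.map_add_eq_mul, sub_neg_eq_add, inner_add_right, neg_add,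
                add_comm]
          _ = _ := by
              rw [← key hb' hHx, hF]
              congr 1 with ξ
              simp only [Circle.smul_def, smul_eq_mul]
              ring
    _ = _ := by
        rw [← key ha hg]
        congr 1 with ξ
        ring

lemma lintegral_enorm_fourier_sq_le {a : E → ℂ} (ha : Integrable a)
    (ha2 : Integrable fun x => ‖a x‖ ^ 2) :
    ∫⁻ ξ, ‖𝓕 a ξ‖ₑ ^ 2 ≤ ENNReal.ofReal (∫ x, ‖a x‖ ^ 2) := by
  have hac : Continuous (𝓕 a) :=
    VectorFourier.fourierIntegral_continuous Real.continuous_fourierChar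
      (L := innerₗ E) continuous_inner ha
  have hab : ∀ ξ, ‖𝓕 a ξ‖ ≤ ∫ y, ‖a y‖ := fun ξ =>
    VectorFourier.norm_fourierIntegral_le_integral_norm _ _ _ _ _
  have hstep : ∀ c : ℝ, 0 < c →
      ∫⁻ ξ, ENNReal.ofReal (Real.exp (-c * ‖ξ‖ ^ 2)) * ‖𝓕 a ξ‖ₑ ^ 2 ≤
        ENNReal.ofReal (∫ x, ‖a x‖ ^ 2) := by
    intro c hc
    set G : E → ℝ := fun z => √(Real.pi / c) ^ Module.finrank ℝ E *
      Real.exp (-(Real.pi ^ 2 / c) * ‖z‖ ^ 2) with hG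
    have hGi : Integrable G := (integrable_gaussian (by positivity)).const_mul _
    have hG0 : ∀ z, 0 ≤ G z := fun z => by positivity
    have hG1 : ∫ z, G z = 1 := by
      rw [hG, integral_const_mul, GaussianFourier.integral_rexp_neg_mul_sq_norm (by positivity),
        Real.sqrt_eq_rpow, ← Real.rpow_natCast, ← Real.rpow_mul (by positivity),
        one_div_mul_eq_div, ← Real.mul_rpow (by positivity) (by positivity)]
      rw [show Real.pi / c * (Real.pi / (Real.pi ^ 2 / c)) = 1 by field_simp, Real.one_rpow]
    have hI : Integrable fun ξ => Real.exp (-c * ‖ξ‖ ^ 2) * ‖𝓕 a ξ‖ ^ 2 := by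
      refine (integrable_gaussian hc).mul_bdd (c := (∫ y, ‖a y‖) ^ 2)
        (by fun_prop) (Eventually.of_forall fun ξ => ?_)
      rw [norm_pow, norm_norm]
      gcongr
      exact hab ξ
    have hac' : Integrable fun x => (starRingEnd ℂ) (a x) :=
      Complex.conjCLE.toContinuousLinearMap.integrable_comp ha
    have hHi : Integrable fun ξ : E => (Real.exp (-c * ‖ξ‖ ^ 2) : ℂ) :=
      (integrable_gaussian hc).ofReal
    have hP := integral_mul_fourier_sub hHi ha hac'
    have hconj : ∀ ξ, 𝓕 (fun x => (starRingEnd ℂ) (a x)) (-ξ) = (starRingEnd ℂ) (𝓕 a ξ) := by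
      intro ξ
      rw [Real.fourier_eq', Real.fourier_eq', ← integral_conj]
      congr 1 with x
      simp [← Complex.exp_conj, Complex.conj_ofNat]
    have hF : ∀ z, 𝓕 (fun ξ : E => (Real.exp (-c * ‖ξ‖ ^ 2) : ℂ)) z = (G z : ℂ) :=
      fourier_gaussian_ofReal hc
    have hR : ∫ ξ, (Real.exp (-c * ‖ξ‖ ^ 2) : ℂ) *
        (𝓕 a ξ * 𝓕 (fun x => (starRingEnd ℂ) (a x)) (-ξ)) =
        ((∫ ξ, Real.exp (-c * ‖ξ‖ ^ 2) * ‖𝓕 a ξ‖ ^ 2 : ℝ) : ℂ) := by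
      rw [← integral_complex_ofReal]
      congr 1 with ξ
      rw [hconj, Complex.mul_conj, Complex.normSq_eq_norm_sq]
      push_cast
      rfl
    have hle : ∫ ξ, Real.exp (-c * ‖ξ‖ ^ 2) * ‖𝓕 a ξ‖ ^ 2 ≤ ∫ x, ‖a x‖ ^ 2 := by
      have h0 : 0 ≤ ∫ ξ, Real.exp (-c * ‖ξ‖ ^ 2) * ‖𝓕 a ξ‖ ^ 2 :=
        integral_nonneg fun ξ => by positivity
      rw [← Real.norm_of_nonneg h0, ← Complex.norm_real]
      refine (congrArg norm (hR.symm.trans hP.symm)).le.trans ?_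
      simp only [hF]
      have hGx : ∀ x, Integrable fun y => G (x - y) := fun x => hGi.comp_sub_left x
      have hG1' : ∀ x, ∫ y, G (x - y) = 1 := fun x => by
        rw [integral_sub_left_eq_self (fun y : E => G y) volume x, hG1]
      have hGb : ∀ z, ‖G z‖ ≤ √(Real.pi / c) ^ Module.finrank ℝ E := fun z => by
        rw [Real.norm_of_nonneg (hG0 z)]
        refine mul_le_of_le_one_right (by positivity) (Real.exp_le_one_iff.2 ?_)
        rw [neg_mul]
        exact neg_nonpos.2 (by positivity)
      have hi2 : ∀ x, Integrable fun y => ‖a y‖ ^ 2 * G (x - y) := fun x =>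
        ha2.mul_bdd (hGx x).aestronglyMeasurable (Eventually.of_forall fun y => hGb _)
      calc _ ≤ ∫ x, (‖a x‖ ^ 2 / 2 + (∫ y, ‖a y‖ ^ 2 * G (x - y)) / 2) := by
            refine norm_integral_le_of_norm_le ((ha2.div_const 2).add
              ((integrable_conv ha2 hGi).div_const 2)) (Eventually.of_forall fun x => ?_)
            rw [← integral_const_mul]
            have e : ‖a x‖ ^ 2 / 2 + (∫ y, ‖a y‖ ^ 2 * G (x - y)) / 2 =
                ∫ y, (‖a x‖ ^ 2 / 2 * G (x - y) + ‖a y‖ ^ 2 * G (x - y) / 2) := by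
              rw [integral_add ((hGx x).const_mul _) ((hi2 x).div_const 2), integral_const_mul,
                hG1', mul_one, integral_div]
            rw [e]
            refine norm_integral_le_of_norm_le (((hGx x).const_mul _).add ((hi2 x).div_const 2))
              (Eventually.of_forall fun y => ?_)
            rw [norm_mul, norm_mul, RCLike.norm_conj, Complex.norm_real, Real.norm_of_nonneg (hG0 _)]
            nlinarith [mul_nonneg (sq_nonneg (‖a x‖ - ‖a y‖)) (hG0 (x - y))]
        _ = _ := by
            rw [integral_add (ha2.div_const 2) ((integrable_conv ha2 hGi).div_const 2),
              integral_div, integral_div, integral_conv ha2 hGi, hG1]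
            ring
    calc _ = ∫⁻ ξ, ENNReal.ofReal (Real.exp (-c * ‖ξ‖ ^ 2) * ‖𝓕 a ξ‖ ^ 2) := by
          congr 1 with ξ
          rw [ENNReal.ofReal_mul (Real.exp_pos _).le, ENNReal.ofReal_pow (norm_nonneg _),
            ofReal_norm]
      _ = ENNReal.ofReal (∫ ξ, Real.exp (-c * ‖ξ‖ ^ 2) * ‖𝓕 a ξ‖ ^ 2) :=
          (ofReal_integral_eq_lintegral_ofReal hI
            (Eventually.of_forall fun ξ => by positivity)).symm
      _ ≤ _ := ENNReal.ofReal_le_ofReal hle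
  have hlim : ∀ ξ : E, Tendsto (fun k : ℕ =>
      ENNReal.ofReal (Real.exp (-(1 / ((k : ℝ) + 1)) * ‖ξ‖ ^ 2)) * ‖𝓕 a ξ‖ₑ ^ 2) atTop
      (𝓝 (‖𝓕 a ξ‖ₑ ^ 2)) := by
    intro ξ
    have h1 : Tendsto (fun k : ℕ => ENNReal.ofReal (Real.exp (-(1 / ((k : ℝ) + 1)) * ‖ξ‖ ^ 2))) atTop
        (𝓝 1) := by
      have h2 := (tendsto_one_div_add_atTop_nhds_zero_nat (𝕜 := ℝ)).neg.mul_const (‖ξ‖ ^ 2)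
      have h3 := (ENNReal.continuous_ofReal.comp Real.continuous_exp).tendsto _ |>.comp h2
      simpa [Function.comp_def] using h3
    have h4 := ENNReal.Tendsto.mul_const (b := ‖𝓕 a ξ‖ₑ ^ 2) h1 (Or.inl one_ne_zero)
    simpa using h4
  calc _ = ∫⁻ ξ, liminf (fun k : ℕ =>
        ENNReal.ofReal (Real.exp (-(1 / ((k : ℝ) + 1)) * ‖ξ‖ ^ 2)) * ‖𝓕 a ξ‖ₑ ^ 2) atTop :=
        lintegral_congr fun ξ => (hlim ξ).liminf_eq.symm
    _ ≤ _ := lintegral_liminf_le fun k => by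
        have := hac.measurable
        fun_prop
    _ ≤ _ := liminf_le_of_frequently_le' (Eventually.frequently
        (Eventually.of_forall fun k => hstep _ (by positivity)))

end Plancherel

section Bilinear

open FourierTransform

lemma ofReal_mul_lintegral_inv_sq_mul_exp_le {r : ℝ} (hr : 0 ≤ r) :
    ENNReal.ofReal r * ∫⁻ w in Ioi (0 : ℝ),
      ENNReal.ofReal ((w ^ 2)⁻¹ * Real.exp (-(Real.pi ^ 2 / w ^ 2) * r ^ 2)) ≤ 1 := by
  rcases hr.eq_or_lt with rfl | hr
  · simp
  set g : ℝ → ℝ := fun u => Real.exp (-(Real.pi ^ 2 * r ^ 2) * u ^ 2) with hg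
  have hgi : IntegrableOn g (Ioi 0) := (integrable_exp_neg_mul_sq (by positivity)).integrableOn
  have hp : (-1 : ℝ) ≠ 0 := by norm_num
  have h1 := integral_comp_rpow_Ioi g hp
  have h2 := (integrableOn_Ioi_comp_rpow_iff g hp).2 hgi
  have e : ∀ w ∈ Ioi (0 : ℝ), (|(-1 : ℝ)| * w ^ ((-1 : ℝ) - 1)) • g (w ^ (-1 : ℝ)) =
      (w ^ 2)⁻¹ * Real.exp (-(Real.pi ^ 2 / w ^ 2) * r ^ 2) := by
    intro w hw
    have hw0 : (0 : ℝ) < w := hw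
    have e1 : w ^ ((-1 : ℝ) - 1) = (w ^ 2)⁻¹ := by
      rw [show (-1 : ℝ) - 1 = -((2 : ℕ) : ℝ) by norm_num, Real.rpow_neg hw0.le, Real.rpow_natCast]
    rw [e1, Real.rpow_neg_one, abs_neg, abs_one, one_mul, smul_eq_mul, hg]
    congr 2
    field_simp
  rw [setIntegral_congr_fun measurableSet_Ioi e, integral_gaussian_Ioi] at h1
  have h2' := h2.congr_fun e measurableSet_Ioi
  rw [← ofReal_integral_eq_lintegral_ofReal h2' (Eventually.of_forall fun w => by positivity), h1,
    ← ENNReal.ofReal_mul hr.le]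
  refine ENNReal.ofReal_le_one.2 ?_
  have h3 : √(Real.pi / (Real.pi ^ 2 * r ^ 2)) ≤ 1 / r := by
    rw [Real.sqrt_le_left (by positivity), div_pow, one_pow,
      div_le_div_iff₀ (by positivity) (by positivity)]
    nlinarith [Real.pi_gt_three, mul_pos Real.pi_pos (pow_pos hr 2)]
  calc r * (√(Real.pi / (Real.pi ^ 2 * r ^ 2)) / 2) ≤ r * (1 / r / 2) := by gcongr
    _ = 1 / 2 := by field_simp
    _ ≤ 1 := by norm_num

variable {E : Type*} [NormedAddCommGroup E] [InnerProductSpace ℝ E]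

lemma conjPoisson_eq_integral (v : E) {η : ℝ} (hη : 0 < η) (z : E) :
    conjPoisson v η z = 2 / Real.Gamma ((Module.finrank ℝ E + 1) / 2) * ∫ w in Ioi (0 : ℝ),
      Real.exp (-η ^ 2 * w ^ 2) * (w ^ Module.finrank ℝ E *
        (inner ℝ v z * Real.exp (-w ^ 2 * ‖z‖ ^ 2))) := by
  set n := Module.finrank ℝ E with hn
  have hz := hyp_pos z hη
  have h := integral_rpow_mul_exp_neg_mul_rpow (p := 2) (q := n) (b := hyp z η ^ 2)
    (by norm_num) (by have : (0 : ℝ) ≤ n := by positivity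
                      linarith) (by positivity)
  have e : ∫ w in Ioi (0 : ℝ), Real.exp (-η ^ 2 * w ^ 2) * (w ^ n *
        (inner ℝ v z * Real.exp (-w ^ 2 * ‖z‖ ^ 2))) =
      inner ℝ v z * ∫ w in Ioi (0 : ℝ), w ^ (n : ℝ) * Real.exp (-hyp z η ^ 2 * w ^ (2 : ℝ)) := by
    rw [← integral_const_mul]
    congr 1 with w
    have e2 : hyp z η ^ 2 = ‖z‖ ^ 2 + η ^ 2 := Real.sq_sqrt (by positivity)
    rw [e2, Real.rpow_natCast, Real.rpow_ofNat,
      show -(‖z‖ ^ 2 + η ^ 2) * w ^ 2 = -η ^ 2 * w ^ 2 + -w ^ 2 * ‖z‖ ^ 2 by ring, Real.exp_add]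
    ring
  have hG : 0 < Real.Gamma (((n : ℝ) + 1) / 2) := Real.Gamma_pos_of_pos (by positivity)
  have e3 : (hyp z η ^ 2) ^ (-((n : ℝ) + 1) / 2) = (hyp z η ^ (n + 1))⁻¹ := by
    rw [← Real.rpow_natCast (hyp z η) 2, ← Real.rpow_mul hz.le, ← Real.rpow_natCast,
      ← Real.rpow_neg hz.le]
    congr 1
    push_cast
    ring
  rw [e, h, e3, conjPoisson, ← hn]
  field_simp

/-- A bound for the operator norm on `L²` of convolution with the conjugate Poisson kernel. -/
def multC (v : E) : ℝ :=
  2 / Real.Gamma ((Module.finrank ℝ E + 1) / 2) *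
    (Real.pi * √Real.pi ^ Module.finrank ℝ E) * ‖v‖

lemma multC_nonneg (v : E) : 0 ≤ multC v := by
  have : 0 < Real.Gamma (((Module.finrank ℝ E : ℝ) + 1) / 2) := Real.Gamma_pos_of_pos (by positivity)
  unfold multC
  positivity

variable [FiniteDimensional ℝ E] [MeasurableSpace E] [BorelSpace E]

lemma pow_mul_inner_mul_exp_eq_fourier (v : E) {w : ℝ} (hw : 0 < w) (z : E) :
    ((w ^ Module.finrank ℝ E * (inner ℝ v z * Real.exp (-w ^ 2 * ‖z‖ ^ 2)) : ℝ) : ℂ) =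
      (Complex.I * ((Real.pi * √Real.pi ^ Module.finrank ℝ E * (w ^ 2)⁻¹ : ℝ) : ℂ)) *
        𝓕 (fun ξ : E => ((inner ℝ ξ v * Real.exp (-(Real.pi ^ 2 / w ^ 2) * ‖ξ‖ ^ 2) : ℝ) : ℂ)) z := by
  rw [fourier_inner_mul_gaussian v (by positivity)]
  have h1 : Real.pi / (Real.pi ^ 2 / w ^ 2) = w ^ 2 / Real.pi := by field_simp
  have h2 : Real.pi ^ 2 / (Real.pi ^ 2 / w ^ 2) = w ^ 2 := by field_simp
  have h3 : √(w ^ 2 / Real.pi) = w / √Real.pi := by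
    rw [Real.sqrt_div (by positivity), Real.sqrt_sq hw.le]
  have h4 : √Real.pi ≠ 0 := (Real.sqrt_pos.2 Real.pi_pos).ne'
  rw [h1, h2, h3, div_pow]
  rw [show ∀ a b : ℂ, Complex.I * a * (-Complex.I * b) = -(Complex.I * Complex.I) * (a * b) by
    intros; ring, Complex.I_mul_I, neg_neg, one_mul, ← Complex.ofReal_mul]
  congr 1
  field_simp

lemma lintegral_enorm_fourier_mul_le {a b : E → ℂ} (ha : Integrable a) (hb : Integrable b)
    (ha2 : Integrable fun x => ‖a x‖ ^ 2) (hb2 : Integrable fun x => ‖b x‖ ^ 2) :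
    ∫⁻ ξ, ‖𝓕 a ξ‖ₑ * ‖𝓕 b (-ξ)‖ₑ ≤
      ENNReal.ofReal (√(∫ x, ‖a x‖ ^ 2) * √(∫ x, ‖b x‖ ^ 2)) := by
  have hc : ∀ {f : E → ℂ}, Integrable f → Measurable (𝓕 f) := fun hf =>
    (VectorFourier.fourierIntegral_continuous Real.continuous_fourierChar
      (L := innerₗ E) continuous_inner hf).measurable
  have hs : ∀ {f : E → ℂ}, Integrable f → Integrable (fun x => ‖f x‖ ^ 2) →
      (∫⁻ ξ, ‖𝓕 f ξ‖ₑ ^ (2 : ℝ)) ^ (1 / (2 : ℝ)) ≤ ENNReal.ofReal √(∫ x, ‖f x‖ ^ 2) := by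
    intro f hf hf2
    rw [Real.sqrt_eq_rpow, ← ENNReal.ofReal_rpow_of_nonneg
      (integral_nonneg fun x => by positivity) (by norm_num)]
    gcongr
    simpa using lintegral_enorm_fourier_sq_le hf hf2
  have hneg : ∫⁻ ξ, ‖𝓕 b (-ξ)‖ₑ ^ (2 : ℝ) = ∫⁻ ξ, ‖𝓕 b ξ‖ₑ ^ (2 : ℝ) :=
    lintegral_neg_eq_self (fun ξ => ‖𝓕 b ξ‖ₑ ^ (2 : ℝ))
  have h := ENNReal.lintegral_mul_le_Lp_mul_Lq (volume : Measure E) (p := 2) (q := 2)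
    Real.HolderConjugate.two_two (hc ha).enorm.aemeasurable
    ((hc hb).comp measurable_neg).enorm.aemeasurable
  simp only [Pi.mul_apply, Function.comp_apply] at h
  refine h.trans ?_
  rw [hneg, ENNReal.ofReal_mul (Real.sqrt_nonneg _)]
  exact mul_le_mul' (hs ha ha2) (hs hb hb2)

theorem norm_integral_mul_conjPoisson_conv_le [Nontrivial E] (v : E) {η : ℝ} (hη : 0 < η)
    {a b : E → ℂ} (ha : Integrable a) (hb : Integrable b)
    (ha2 : Integrable fun x => ‖a x‖ ^ 2) (hb2 : Integrable fun x => ‖b x‖ ^ 2) :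
    ‖∫ x, a x * ∫ y, b y * (conjPoisson v η (x - y) : ℂ)‖ ≤
      multC v * √(∫ x, ‖a x‖ ^ 2) * √(∫ x, ‖b x‖ ^ 2) := by
  set n := Module.finrank ℝ E with hn
  have hn1 : 0 < n := Module.finrank_pos
  set g : ℝ := 2 / Real.Gamma ((n + 1) / 2) with hg
  have hg0 : 0 ≤ g := by
    have : 0 < Real.Gamma (((n : ℝ) + 1) / 2) := Real.Gamma_pos_of_pos (by positivity)
    positivity
  set e : ℝ → ℝ := fun w => Real.exp (-η ^ 2 * w ^ 2) with he
  set K : ℝ → E → ℝ := fun w z => w ^ n * (inner ℝ v z * Real.exp (-w ^ 2 * ‖z‖ ^ 2)) with hK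
  have hKc : Continuous fun q : ℝ × E => K q.1 q.2 := by fun_prop
  have hKb : ∀ w, 0 < w → ∀ z, |K w z| ≤ ‖v‖ * w ^ (n - 1) := by
    intro w hw z
    have h1 : w * ‖z‖ * Real.exp (-w ^ 2 * ‖z‖ ^ 2) ≤ 1 := by
      have := mul_exp_neg_mul_sq_le one_pos (w * ‖z‖)
      simp only [Real.sqrt_one, inv_one, one_mul] at this
      rw [show -w ^ 2 * ‖z‖ ^ 2 = -1 * (w * ‖z‖) ^ 2 by ring]
      refine this.trans (Real.exp_le_one_iff.2 ?_)
      nlinarith [sq_nonneg (w * ‖z‖)]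
    have h2 : w ^ n = w ^ (n - 1) * w := by rw [← pow_succ, Nat.sub_add_cancel hn1]
    rw [hK]
    simp only
    rw [abs_mul, abs_mul, abs_of_pos (pow_pos hw n), abs_of_pos (Real.exp_pos _), h2]
    calc w ^ (n - 1) * w * (|inner ℝ v z| * Real.exp (-w ^ 2 * ‖z‖ ^ 2))
        ≤ w ^ (n - 1) * w * (‖v‖ * ‖z‖ * Real.exp (-w ^ 2 * ‖z‖ ^ 2)) := by
          gcongr
          exact abs_real_inner_le_norm v z
      _ = ‖v‖ * w ^ (n - 1) * (w * ‖z‖ * Real.exp (-w ^ 2 * ‖z‖ ^ 2)) := by ring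
      _ ≤ _ := mul_le_of_le_one_right (by positivity) h1
  have hab : Integrable fun p : E × E => a p.1 * b p.2 := ha.mul_prod hb
  set Φ : (E × E) × ℝ → ℂ := fun q => a q.1.1 * b q.1.2 * ((e q.2 * K q.2 (q.1.1 - q.1.2) : ℝ) : ℂ)
    with hΦ
  have hΦi : Integrable Φ ((volume : Measure (E × E)).prod (volume.restrict (Ioi (0 : ℝ)))) := by
    have hw : IntegrableOn (fun w : ℝ => e w * (‖v‖ * w ^ (n - 1))) (Ioi 0) := by
      have h := integrableOn_rpow_mul_exp_neg_mul_sq (b := η ^ 2) (by positivity)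
        (s := ((n - 1 : ℕ) : ℝ)) (by have : (0 : ℝ) ≤ ((n - 1 : ℕ) : ℝ) := by positivity
                                     linarith)
      refine (h.const_mul ‖v‖).congr (Eventually.of_forall fun w => ?_)
      simp only [he, Real.rpow_natCast]
      ring
    refine (hab.norm.mul_prod hw).mono' ?_ ?_
    · refine (hab.aestronglyMeasurable.comp_fst (ν := volume.restrict (Ioi (0 : ℝ)))).mul
        (Continuous.aestronglyMeasurable ?_)
      fun_prop
    · have : ∀ᵐ q : (E × E) × ℝ ∂((volume : Measure (E × E)).prod (volume.restrict (Ioi (0 : ℝ)))),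
          q.2 ∈ Ioi (0 : ℝ) :=
        Measure.quasiMeasurePreserving_snd.ae (ae_restrict_mem measurableSet_Ioi)
      filter_upwards [this] with q hq
      have he0 : ‖e q.2‖ = e q.2 := Real.norm_of_nonneg (Real.exp_pos _).le
      have he0' : 0 ≤ e q.2 := (Real.exp_pos _).le
      rw [norm_mul, Complex.norm_real, norm_mul (e q.2), he0]
      refine mul_le_mul le_rfl (mul_le_mul_of_nonneg_left (hKb _ hq _) he0')
        (mul_nonneg he0' (norm_nonneg _)) (norm_nonneg _)
  have hQ : ∫ x, a x * ∫ y, b y * (conjPoisson v η (x - y) : ℂ) =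
      g * ∫ w in Ioi (0 : ℝ), e w * ∫ x, a x * ∫ y, b y * (K w (x - y) : ℂ) := by
    calc _ = g * ∫ x, ∫ y, ∫ w in Ioi (0 : ℝ), Φ ((x, y), w) := by
          rw [← integral_const_mul]
          congr 1 with x
          rw [← integral_const_mul, ← integral_const_mul]
          congr 1 with y
          change _ = (g : ℂ) * ∫ w in Ioi (0 : ℝ), a x * b y * ((e w * K w (x - y) : ℝ) : ℂ)
          rw [integral_const_mul, integral_complex_ofReal, conjPoisson_eq_integral v hη,
            Complex.ofReal_mul]
          ring
      _ = g * ∫ p : E × E, ∫ w in Ioi (0 : ℝ), Φ (p, w) := by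
          congr 1
          exact (integral_prod _ hΦi.integral_prod_left).symm
      _ = g * ∫ w in Ioi (0 : ℝ), ∫ p : E × E, Φ (p, w) := by
          rw [integral_integral_swap hΦi]
      _ = _ := by
          congr 1
          refine setIntegral_congr_fun measurableSet_Ioi fun w hw => ?_
          have hi : Integrable fun p : E × E => a p.1 * b p.2 * (K w (p.1 - p.2) : ℂ) := by
            refine hab.mul_bdd (c := ‖v‖ * w ^ (n - 1)) (Continuous.aestronglyMeasurable
              (by fun_prop)) (Eventually.of_forall fun p => ?_)
            rw [Complex.norm_real]
            exact hKb w hw _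
          have e1 : ∫ p : E × E, a p.1 * b p.2 * (K w (p.1 - p.2) : ℂ) =
              ∫ x, a x * ∫ y, b y * (K w (x - y) : ℂ) := by
            rw [Measure.volume_eq_prod, integral_prod _ hi]
            simp_rw [mul_assoc, integral_const_mul]
          rw [← e1, ← integral_const_mul]
          congr 1 with p
          simp only [hΦ]
          push_cast
          ring
  set M : E → ℝ≥0∞ := fun ξ => ‖𝓕 a ξ‖ₑ * ‖𝓕 b (-ξ)‖ₑ with hM
  have hMm : Measurable M := by
    have hc : ∀ {f : E → ℂ}, Integrable f → Measurable (𝓕 f) := fun hf =>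
      (VectorFourier.fourierIntegral_continuous Real.continuous_fourierChar
        (L := innerₗ E) continuous_inner hf).measurable
    exact (hc ha).enorm.mul ((hc hb).comp measurable_neg).enorm
  set q : ℝ → E → ℝ := fun w ξ => (w ^ 2)⁻¹ * Real.exp (-(Real.pi ^ 2 / w ^ 2) * ‖ξ‖ ^ 2) with hq
  have hqm : Measurable fun z : ℝ × E => q z.1 z.2 := by fun_prop
  set κ : ℝ := Real.pi * √Real.pi ^ n with hκ
  have hstep : ∀ w ∈ Ioi (0 : ℝ), ‖e w * ∫ x, a x * ∫ y, b y * (K w (x - y) : ℂ)‖ₑ ≤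
      ∫⁻ ξ, ENNReal.ofReal (κ * ‖v‖) * (ENNReal.ofReal ‖ξ‖ * ENNReal.ofReal (q w ξ) * M ξ) := by
    intro w hw
    have hw0 : (0 : ℝ) < w := hw
    have hc : 0 < Real.pi ^ 2 / w ^ 2 := by positivity
    set H : E → ℂ := fun ξ =>
      ((inner ℝ ξ v * Real.exp (-(Real.pi ^ 2 / w ^ 2) * ‖ξ‖ ^ 2) : ℝ) : ℂ) with hH
    have hHi : Integrable H := by
      have hr : Integrable fun ξ : E =>
          (inner ℝ ξ v * Real.exp (-(Real.pi ^ 2 / w ^ 2) * ‖ξ‖ ^ 2) : ℝ) := by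
        refine ((integrable_norm_mul_gaussian (E := E) hc).const_mul
          ‖v‖).mono' (Continuous.aestronglyMeasurable (by fun_prop))
          (Eventually.of_forall fun ξ => ?_)
        rw [norm_mul, Real.norm_of_nonneg (Real.exp_pos _).le, ← mul_assoc, mul_comm ‖v‖]
        gcongr
        exact norm_inner_le_norm ξ v
      exact hr.ofReal
    have e1 : ∫ x, a x * ∫ y, b y * (K w (x - y) : ℂ) =
        (Complex.I * ((κ * (w ^ 2)⁻¹ : ℝ) : ℂ)) * ∫ ξ, H ξ * (𝓕 a ξ * 𝓕 b (-ξ)) := by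
      rw [← integral_mul_fourier_sub hHi ha hb, ← integral_const_mul]
      congr 1 with x
      rw [mul_left_comm]
      congr 1
      rw [← integral_const_mul]
      refine integral_congr_ae (Eventually.of_forall fun y => ?_)
      simp only [hK]
      rw [pow_mul_inner_mul_exp_eq_fourier v hw0]
      ring
    have he1 : ‖(e w : ℂ)‖ₑ ≤ 1 := by
      rw [← ofReal_norm, Complex.norm_real, Real.norm_of_nonneg (Real.exp_pos _).le]
      refine ENNReal.ofReal_le_one.2 (Real.exp_le_one_iff.2 ?_)
      nlinarith [sq_nonneg (η * w)]
    rw [e1, ← integral_const_mul, enorm_mul]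
    refine (mul_le_of_le_one_left' he1).trans ((enorm_integral_le_lintegral_enorm _).trans
      (lintegral_mono fun ξ => ?_))
    rw [enorm_mul, enorm_mul, enorm_mul, enorm_mul (𝓕 a ξ)]
    change _ ≤ _ * (_ * (‖𝓕 a ξ‖ₑ * ‖𝓕 b (-ξ)‖ₑ))
    rw [← mul_assoc, ← mul_assoc (ENNReal.ofReal (κ * ‖v‖))]
    refine mul_le_mul' ?_ le_rfl
    rw [← ofReal_norm, ← ofReal_norm, ← ofReal_norm, ← ENNReal.ofReal_mul (by positivity),
      ← ENNReal.ofReal_mul (by positivity), ← ENNReal.ofReal_mul (by positivity),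
      ← ENNReal.ofReal_mul (by positivity)]
    refine ENNReal.ofReal_le_ofReal ?_
    rw [Complex.norm_I, one_mul, Complex.norm_real, Complex.norm_real, Real.norm_of_nonneg
      (by positivity), norm_mul, Real.norm_of_nonneg (Real.exp_pos _).le, hq]
    simp only
    calc κ * (w ^ 2)⁻¹ * (‖(inner ℝ ξ v : ℝ)‖ * Real.exp (-(Real.pi ^ 2 / w ^ 2) * ‖ξ‖ ^ 2))
        ≤ κ * (w ^ 2)⁻¹ * (‖ξ‖ * ‖v‖ * Real.exp (-(Real.pi ^ 2 / w ^ 2) * ‖ξ‖ ^ 2)) := by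
          gcongr
          exact norm_inner_le_norm ξ v
      _ = _ := by ring
  have hmain : ‖∫ x, a x * ∫ y, b y * (conjPoisson v η (x - y) : ℂ)‖ₑ ≤
      ENNReal.ofReal (multC v * √(∫ x, ‖a x‖ ^ 2) * √(∫ x, ‖b x‖ ^ 2)) := by
    calc _ ≤ ENNReal.ofReal g * ∫⁻ w in Ioi (0 : ℝ),
          ‖e w * ∫ x, a x * ∫ y, b y * (K w (x - y) : ℂ)‖ₑ := by
          rw [hQ, enorm_mul, ← ofReal_norm (g : ℂ), Complex.norm_real, Real.norm_of_nonneg hg0]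
          gcongr
          exact enorm_integral_le_lintegral_enorm _
      _ ≤ ENNReal.ofReal g * ∫⁻ w in Ioi (0 : ℝ), ∫⁻ ξ, ENNReal.ofReal (κ * ‖v‖) *
          (ENNReal.ofReal ‖ξ‖ * ENNReal.ofReal (q w ξ) * M ξ) := by
          exact mul_le_mul' le_rfl (setLIntegral_mono' measurableSet_Ioi hstep)
      _ = ENNReal.ofReal g * ∫⁻ ξ, ENNReal.ofReal (κ * ‖v‖) *
          ((ENNReal.ofReal ‖ξ‖ * ∫⁻ w in Ioi (0 : ℝ), ENNReal.ofReal (q w ξ)) * M ξ) := by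
          rw [lintegral_lintegral_swap (by fun_prop)]
          congr 1
          refine lintegral_congr fun ξ => ?_
          have : Measurable fun w => q w ξ := by fun_prop
          rw [lintegral_const_mul _ (by fun_prop), lintegral_mul_const _ (by fun_prop),
            lintegral_const_mul _ (by fun_prop)]
      _ ≤ ENNReal.ofReal g * ∫⁻ ξ, ENNReal.ofReal (κ * ‖v‖) * M ξ := by
          gcongr with ξ
          exact mul_le_of_le_one_left' (ofReal_mul_lintegral_inv_sq_mul_exp_le (norm_nonneg ξ))
      _ ≤ ENNReal.ofReal g * (ENNReal.ofReal (κ * ‖v‖) *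
          ENNReal.ofReal (√(∫ x, ‖a x‖ ^ 2) * √(∫ x, ‖b x‖ ^ 2))) := by
          rw [lintegral_const_mul _ hMm]
          gcongr
          exact lintegral_enorm_fourier_mul_le ha hb ha2 hb2
      _ = _ := by
          rw [← ENNReal.ofReal_mul (by positivity), ← ENNReal.ofReal_mul hg0]
          congr 1
          unfold multC
          ring
  rw [← ofReal_norm] at hmain
  have := multC_nonneg v
  exact (ENNReal.ofReal_le_ofReal_iff (by positivity)).1 hmain

end Bilinear

section CalderonZygmund

variable {E : Type*} [NormedAddCommGroup E] [InnerProductSpace ℝ E] [FiniteDimensional ℝ E]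
  [MeasurableSpace E] [BorelSpace E]

/-- The points lying in some ball on which the average of `‖f‖` exceeds `L`. -/
def excSet (f : E → ℂ) (L : ℝ) : Set E :=
  {x | ∃ c : E, ∃ r : ℝ, 0 < r ∧ x ∈ Metric.ball c r ∧
    L * volume.real (Metric.closedBall c r) < ∫ y in Metric.closedBall c r, ‖f y‖}

lemma isOpen_excSet (f : E → ℂ) (L : ℝ) : IsOpen (excSet f L) := by
  rw [isOpen_iff_forall_mem_open]
  rintro x ⟨c, r, hr, hx, h⟩
  exact ⟨Metric.ball c r, fun y hy => ⟨c, r, hr, hy, h⟩, Metric.isOpen_ball, hx⟩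

lemma setIntegral_le_of_notMem_excSet {f : E → ℂ} {L : ℝ} {x : E} (hx : x ∉ excSet f L) {r : ℝ}
    (hr : 0 < r) :
    ∫ y in Metric.closedBall x r, ‖f y‖ ≤ L * volume.real (Metric.closedBall x r) := by
  by_contra! h
  exact hx ⟨x, r, hr, Metric.mem_ball_self hr, h⟩

lemma ae_norm_le_of_notMem_excSet {f : E → ℂ} (hf : Integrable f) (L : ℝ) :
    ∀ᵐ x, x ∉ excSet f L → ‖f x‖ ≤ L := by
  filter_upwards [IsUnifLocDoublingMeasure.ae_tendsto_average volume hf.norm.locallyIntegrable 1]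
    with x hx hxe
  have h1 := hx (l := 𝓝[>] (0 : ℝ)) (fun _ => x) id tendsto_id (by
    filter_upwards [self_mem_nhdsWithin] with r hr
    simpa using (le_of_lt hr))
  refine le_of_tendsto h1 ?_
  filter_upwards [self_mem_nhdsWithin] with r hr
  have hr : 0 < r := hr
  have hv : 0 < volume.real (Metric.closedBall x r) := by
    rw [volume_real_closedBall x hr.le]
    exact mul_pos (pow_pos hr _) volume_real_unitBall_pos
  rw [id, setAverage_eq, smul_eq_mul, inv_mul_le_iff₀ hv, mul_comm]
  exact setIntegral_le_of_notMem_excSet hxe hr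

lemma ofReal_mul_volume_excSet_le [Nontrivial E] {f : E → ℂ} (hf : Integrable f) {L : ℝ}
    (hL : 0 < L) :
    ENNReal.ofReal L * volume (excSet f L) ≤
      4 ^ Module.finrank ℝ E * ∫⁻ x in excSet f L, ‖f x‖ₑ := by
  set n := Module.finrank ℝ E with hn
  have hn1 : 0 < n := Module.finrank_pos
  set ω := volume.real (Metric.ball (0 : E) 1) with hω
  have hω0 : 0 < ω := volume_real_unitBall_pos
  set t : Set (E × ℝ) := {p | 0 < p.2 ∧ L * volume.real (Metric.closedBall p.1 p.2) <
    ∫ y in Metric.closedBall p.1 p.2, ‖f y‖} with ht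
  have hR : ∀ p ∈ t, p.2 ≤ max 1 ((∫ y, ‖f y‖) / (L * ω)) := by
    rintro ⟨c, r⟩ ⟨hr, h⟩
    simp only at hr h ⊢
    rcases le_total r 1 with h1 | h1
    · exact h1.trans (le_max_left _ _)
    · refine le_trans ?_ (le_max_right _ _)
      rw [le_div_iff₀ (by positivity)]
      rw [volume_real_closedBall c hr.le] at h
      have h2 : ∫ y in Metric.closedBall c r, ‖f y‖ ≤ ∫ y, ‖f y‖ :=
        setIntegral_le_integral hf.norm (Eventually.of_forall fun _ => norm_nonneg _)
      have h3 : r ≤ r ^ n := le_self_pow₀ h1 hn1.ne'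
      calc r * (L * ω) ≤ r ^ n * (L * ω) := by gcongr
        _ = L * (r ^ n * ω) := by ring
        _ ≤ _ := h.le.trans h2
  obtain ⟨u, hut, hud, hu⟩ := Vitali.exists_disjoint_subfamily_covering_enlargement_closedBall t
    (fun p => p.1) (fun p => p.2) _ hR 4 (by norm_num)
  have hbd : u.PairwiseDisjoint fun p => Metric.ball p.1 p.2 :=
    hud.mono fun p => Metric.ball_subset_closedBall
  have huc : u.Countable := hbd.countable_of_isOpen (fun p _ => Metric.isOpen_ball)
    fun p hp => Metric.nonempty_ball.2 (hut hp).1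
  have hcov : excSet f L ⊆ ⋃ p ∈ u, Metric.closedBall p.1 (4 * p.2) := by
    rintro x ⟨c, r, hr, hx, h⟩
    obtain ⟨p, hp, hsub⟩ := hu (c, r) ⟨hr, h⟩
    exact mem_biUnion hp (hsub (Metric.ball_subset_closedBall hx))
  have hball : ∀ p ∈ u, ENNReal.ofReal L * volume (Metric.closedBall p.1 (4 * p.2)) ≤
      4 ^ n * ∫⁻ x in Metric.ball p.1 p.2, ‖f x‖ₑ := by
    rintro ⟨c, r⟩ hp
    obtain ⟨hr, h⟩ := hut hp
    simp only at hr h ⊢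
    have h1 : volume (Metric.closedBall c (4 * r)) = 4 ^ n * volume (Metric.closedBall c r) := by
      rw [Measure.addHaar_closedBall _ _ (by positivity), Measure.addHaar_closedBall _ _ hr.le,
        mul_pow, ENNReal.ofReal_mul (by positivity), ← mul_assoc,
        ENNReal.ofReal_pow (by norm_num)]
      simp [hn]
    have h2 : ∫⁻ x in Metric.ball c r, ‖f x‖ₑ = ∫⁻ x in Metric.closedBall c r, ‖f x‖ₑ := by
      rw [Measure.restrict_congr_set]
      refine Metric.ball_subset_closedBall.eventuallyLE.antisymm ?_
      rw [ae_le_set, Metric.closedBall_sdiff_ball]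
      exact Measure.addHaar_sphere _ _ _
    rw [h1, h2, mul_left_comm]
    refine mul_le_mul' le_rfl ?_
    rw [← ofReal_integral_norm_eq_lintegral_enorm hf.integrableOn,
      ← ENNReal.ofReal_toReal (measure_closedBall_lt_top (x := c) (r := r)).ne,
      ← ENNReal.ofReal_mul hL.le]
    exact ENNReal.ofReal_le_ofReal h.le
  calc ENNReal.ofReal L * volume (excSet f L)
      ≤ ENNReal.ofReal L * ∑' p : u, volume (Metric.closedBall p.1.1 (4 * p.1.2)) := by
        gcongr
        exact (measure_mono hcov).trans (measure_biUnion_le _ huc _)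
    _ = ∑' p : u, ENNReal.ofReal L * volume (Metric.closedBall p.1.1 (4 * p.1.2)) :=
        ENNReal.tsum_mul_left.symm
    _ ≤ ∑' p : u, 4 ^ n * ∫⁻ x in Metric.ball p.1.1 p.1.2, ‖f x‖ₑ :=
        ENNReal.tsum_le_tsum fun p => hball p.1 p.2
    _ = 4 ^ n * ∫⁻ x in ⋃ p ∈ u, Metric.ball p.1 p.2, ‖f x‖ₑ := by
        rw [ENNReal.tsum_mul_left, lintegral_biUnion huc (fun p _ => measurableSet_ball) hbd]
    _ ≤ _ := by
        gcongr
        exact iUnion₂_subset fun p hp x hx => ⟨p.1, p.2, (hut hp).1, hx, (hut hp).2⟩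

lemma tendsto_setLIntegral_excSet [Nontrivial E] {f : E → ℂ} (hf : Integrable f) :
    Tendsto (fun L => ∫⁻ x in excSet f L, ‖f x‖ₑ) atTop (𝓝 0) := by
  refine tendsto_setLIntegral_zero hf.2.ne ?_
  have h1 : Tendsto (fun L : ℝ => (ENNReal.ofReal L)⁻¹ *
      (4 ^ Module.finrank ℝ E * ∫⁻ x, ‖f x‖ₑ)) atTop (𝓝 0) := by
    have := ENNReal.Tendsto.mul_const (b := 4 ^ Module.finrank ℝ E * ∫⁻ x, ‖f x‖ₑ)
      (tendsto_inv_iff.2 ENNReal.tendsto_ofReal_atTop)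
      (Or.inr (ENNReal.mul_ne_top (by finiteness) hf.2.ne))
    simpa using this
  refine tendsto_of_tendsto_of_tendsto_of_le_of_le' tendsto_const_nhds h1
    (Eventually.of_forall fun _ => zero_le) ?_
  filter_upwards [eventually_gt_atTop 0] with L hL
  rw [mul_comm, ← div_eq_mul_inv, ENNReal.le_div_iff_mul_le
    (Or.inl (ENNReal.ofReal_pos.2 hL).ne') (Or.inl ENNReal.ofReal_ne_top), mul_comm]
  exact (ofReal_mul_volume_excSet_le hf hL).trans
    (mul_le_mul' le_rfl (setLIntegral_le_lintegral _ _))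

lemma volume_excSet_lt_top [Nontrivial E] {f : E → ℂ} (hf : Integrable f) {L : ℝ} (hL : 0 < L) :
    volume (excSet f L) < ∞ := by
  by_contra h
  rw [not_lt, top_le_iff] at h
  have := ofReal_mul_volume_excSet_le hf hL
  rw [h, ENNReal.mul_top (ENNReal.ofReal_pos.2 hL).ne', top_le_iff] at this
  exact (ENNReal.mul_ne_top (by finiteness)
    ((setLIntegral_le_lintegral _ _).trans_lt hf.2).ne) this

lemma excSet_compl_nonempty [Nontrivial E] {f : E → ℂ} (hf : Integrable f) {L : ℝ} (hL : 0 < L) :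
    (excSet f L)ᶜ.Nonempty := by
  rw [nonempty_compl]
  intro h
  have := volume_excSet_lt_top hf hL
  rw [h] at this
  have hE : NoncompactSpace E := NormedSpace.noncompactSpace ℝ E
  rw [measure_univ_of_isAddLeftInvariant] at this
  exact lt_irrefl _ this

end CalderonZygmund

section Spread

variable {E : Type*} [NormedAddCommGroup E] [InnerProductSpace ℝ E] [FiniteDimensional ℝ E]
  [MeasurableSpace E] [BorelSpace E]

open Classical in
/-- The normalised indicator function of the ball of radius `r` around the origin. -/
def ballAvg (r : ℝ) (x : E) : ℝ :=
  if ‖x‖ < r then (volume.real (Metric.ball (0 : E) 1) * r ^ Module.finrank ℝ E)⁻¹ else 0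

lemma ballAvg_nonneg (r : ℝ) (x : E) : 0 ≤ ballAvg r x := by
  unfold ballAvg
  split_ifs with h
  · have : 0 < r := (norm_nonneg x).trans_lt h
    positivity
  · rfl

lemma ballAvg_of_nonpos {r : ℝ} (hr : r ≤ 0) (x : E) : ballAvg r x = 0 :=
  if_neg (hr.trans (norm_nonneg x)).not_gt

lemma measurable_ballAvg {ρ : E → ℝ} (hρ : Measurable ρ) :
    Measurable fun p : E × E => ballAvg (ρ p.2) (p.1 - p.2) := by
  unfold ballAvg
  refine Measurable.ite (measurableSet_lt (by fun_prop) (by fun_prop)) (by fun_prop)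
    measurable_const

lemma ballAvg_sub_eq_indicator {r : ℝ} (y : E) :
    (fun x : E => ballAvg r (x - y)) = (Metric.ball y r).indicator fun _ =>
      (volume.real (Metric.ball (0 : E) 1) * r ^ Module.finrank ℝ E)⁻¹ := by
  ext x
  simp [ballAvg, indicator, dist_eq_norm]

lemma integrable_ballAvg_sub (r : ℝ) (y : E) : Integrable fun x : E => ballAvg r (x - y) := by
  rw [ballAvg_sub_eq_indicator]
  exact (integrable_indicator_iff measurableSet_ball).2
    (integrableOn_const measure_ball_lt_top.ne)

lemma integral_ballAvg_sub {r : ℝ} (hr : 0 < r) (y : E) : ∫ x : E, ballAvg r (x - y) = 1 := by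
  rw [ballAvg_sub_eq_indicator, integral_indicator_const _ measurableSet_ball, measureReal_def,
    Measure.addHaar_ball_of_pos _ _ hr, ENNReal.toReal_mul, ENNReal.toReal_ofReal (by positivity),
    ← measureReal_def, smul_eq_mul, mul_comm (r ^ _)]
  exact mul_inv_cancel₀ (mul_pos volume_real_unitBall_pos (pow_pos hr _)).ne'

lemma integral_ballAvg_sub' (r : ℝ) (y : E) :
    ∫ x : E, ballAvg r (x - y) = (Ioi (0 : ℝ)).indicator 1 r := by
  by_cases hr : 0 < r
  · simp [integral_ballAvg_sub hr, hr]
  · simp [ballAvg_of_nonpos (not_lt.1 hr), hr]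

/-- The function `f` with its mass at `y` spread uniformly over the ball of radius `ρ y`. -/
def spread (f : E → ℂ) (ρ : E → ℝ) (x : E) : ℂ := ∫ y, f y * (ballAvg (ρ y) (x - y) : ℂ)

lemma integral_norm_mul_ballAvg (f : E → ℂ) (ρ : E → ℝ) (y : E) :
    ∫ x, ‖f y * (ballAvg (ρ y) (x - y) : ℂ)‖ = {y | 0 < ρ y}.indicator (fun y => ‖f y‖) y := by
  have : ∀ x, ‖f y * (ballAvg (ρ y) (x - y) : ℂ)‖ = ‖f y‖ * ballAvg (ρ y) (x - y) := fun x => by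
    rw [norm_mul, Complex.norm_real, Real.norm_of_nonneg (ballAvg_nonneg _ _)]
  simp_rw [this]
  rw [integral_const_mul, integral_ballAvg_sub']
  by_cases h : 0 < ρ y <;> simp [h, indicator]

lemma integrable_mul_ballAvg {f : E → ℂ} (hf : Integrable f) {ρ : E → ℝ} (hρ : Measurable ρ) :
    Integrable (fun p : E × E => f p.2 * (ballAvg (ρ p.2) (p.1 - p.2) : ℂ))
      ((volume : Measure E).prod volume) := by
  have hm : AEStronglyMeasurable (fun p : E × E => f p.2 * (ballAvg (ρ p.2) (p.1 - p.2) : ℂ))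
      ((volume : Measure E).prod volume) := (hf.aestronglyMeasurable.comp_snd).mul
    (Complex.measurable_ofReal.comp (measurable_ballAvg hρ)).aestronglyMeasurable
  rw [integrable_prod_iff' hm]
  refine ⟨Eventually.of_forall fun y =>
    ((integrable_ballAvg_sub (ρ y) y).ofReal (𝕜 := ℂ)).const_mul (f y), ?_⟩
  simp only [integral_norm_mul_ballAvg]
  exact hf.norm.indicator (measurableSet_lt measurable_const hρ)

lemma integrable_spread {f : E → ℂ} (hf : Integrable f) {ρ : E → ℝ} (hρ : Measurable ρ) :
    Integrable (spread f ρ) :=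
  (integrable_mul_ballAvg hf hρ).integral_prod_left

lemma integral_norm_spread_le {f : E → ℂ} (hf : Integrable f) {ρ : E → ℝ} (hρ : Measurable ρ) :
    ∫ x, ‖spread f ρ x‖ ≤ ∫ y in {y | 0 < ρ y}, ‖f y‖ := by
  have hi := integrable_mul_ballAvg hf hρ
  calc ∫ x, ‖spread f ρ x‖ ≤ ∫ x, ∫ y, ‖f y * (ballAvg (ρ y) (x - y) : ℂ)‖ :=
        integral_mono (integrable_spread hf hρ).norm hi.norm.integral_prod_left
          fun x => norm_integral_le_integral_norm _
    _ = ∫ y, ∫ x, ‖f y * (ballAvg (ρ y) (x - y) : ℂ)‖ := integral_integral_swap hi.norm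
    _ = _ := by
        simp only [integral_norm_mul_ballAvg]
        exact integral_indicator (measurableSet_lt measurable_const hρ)

lemma abs_conjPoisson_sub_integral_ballAvg_le (v : E) {η r : ℝ} (hη : 0 < η) (hr : 0 < r)
    {x y : E} (hxy : 2 * r ≤ ‖x - y‖) :
    |conjPoisson v η (x - y) - ∫ z, ballAvg r (z - y) * conjPoisson v η (x - z)| ≤
      regC v * maj r (x - y) := by
  have hi := integrable_ballAvg_sub r y
  have hb : Integrable fun z => ballAvg r (z - y) * conjPoisson v η (x - z) :=
    hi.mul_bdd (c := ‖v‖ / η ^ Module.finrank ℝ E)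
      ((continuous_conjPoisson v hη).comp (by fun_prop)).aestronglyMeasurable
      (Eventually.of_forall fun z => abs_conjPoisson_le_const v hη _)
  have e : conjPoisson v η (x - y) - ∫ z, ballAvg r (z - y) * conjPoisson v η (x - z) =
      ∫ z, ballAvg r (z - y) * (conjPoisson v η (x - y) - conjPoisson v η (x - z)) := by
    simp_rw [mul_sub]
    rw [integral_sub (hi.mul_const _) hb, integral_mul_const, integral_ballAvg_sub hr, one_mul]
  rw [e]
  calc _ ≤ ∫ z, ballAvg r (z - y) * (regC v * maj r (x - y)) := by
        refine norm_integral_le_of_norm_le (f := fun z => ballAvg r (z - y) *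
          (conjPoisson v η (x - y) - conjPoisson v η (x - z))) (hi.mul_const _)
          (Eventually.of_forall fun z => ?_)
        rw [norm_mul, Real.norm_of_nonneg (ballAvg_nonneg _ _), Real.norm_eq_abs]
        by_cases hz : ‖z - y‖ < r
        · refine mul_le_mul_of_nonneg_left (abs_conjPoisson_sub_le_maj hr hxy ?_)
            (ballAvg_nonneg _ _)
          rw [sub_sub_sub_cancel_left]
          exact hz.le
        · simp [ballAvg, hz]
    _ = _ := by rw [integral_mul_const, integral_ballAvg_sub hr, one_mul]

lemma lintegral_conjPoisson_spread_le (v : E) {f : E → ℂ} (hf : Integrable f) {ρ : E → ℝ}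
    (hρ : Measurable ρ) {F : Set E} (hF : ∀ x ∈ F, ∀ y, 2 * ρ y ≤ ‖x - y‖)
    (hFm : MeasurableSet F) {η : ℝ} (hη : 0 < η) :
    ∫⁻ x in F, ‖∫ y, ({y | 0 < ρ y}.indicator f y - spread f ρ y) *
        (conjPoisson v η (x - y) : ℂ)‖ₑ ≤
      ENNReal.ofReal (regC v * ∫ x : E, maj 1 x) * ∫⁻ y in {y | 0 < ρ y}, ‖f y‖ₑ := by
  set Ω := {y | 0 < ρ y} with hΩ
  have hΩm : MeasurableSet Ω := measurableSet_lt measurable_const hρ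
  have hkm : Continuous (conjPoisson v η) := continuous_conjPoisson v hη
  have hkb := fun x => abs_conjPoisson_le_const v hη x
  have hpt : ∀ x ∈ F, ‖∫ y, (Ω.indicator f y - spread f ρ y) * (conjPoisson v η (x - y) : ℂ)‖ₑ ≤
      ∫⁻ y in Ω, ‖f y‖ₑ * ENNReal.ofReal (regC v * maj (ρ y) (x - y)) := by
    intro x hx
    have hkx : Continuous fun y => (conjPoisson v η (x - y) : ℂ) := by fun_prop
    have hkxb : ∀ y, ‖(conjPoisson v η (x - y) : ℂ)‖ ≤ ‖v‖ / η ^ Module.finrank ℝ E := fun y => by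
      rw [Complex.norm_real]; exact hkb _
    have h1 : Integrable fun y => Ω.indicator f y * (conjPoisson v η (x - y) : ℂ) :=
      (hf.indicator hΩm).mul_bdd hkx.aestronglyMeasurable (Eventually.of_forall hkxb)
    have h2 : Integrable fun y => spread f ρ y * (conjPoisson v η (x - y) : ℂ) :=
      (integrable_spread hf hρ).mul_bdd hkx.aestronglyMeasurable (Eventually.of_forall hkxb)
    have h3 : Integrable (fun p : E × E => f p.2 * (ballAvg (ρ p.2) (p.1 - p.2) : ℂ) *
        (conjPoisson v η (x - p.1) : ℂ)) ((volume : Measure E).prod volume) :=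
      (integrable_mul_ballAvg hf hρ).mul_bdd
        (Continuous.aestronglyMeasurable (by fun_prop)) (Eventually.of_forall fun p => hkxb _)
    have e3 : ∀ y, ∫ z, f y * (ballAvg (ρ y) (z - y) : ℂ) * (conjPoisson v η (x - z) : ℂ) =
        f y * ((∫ z, ballAvg (ρ y) (z - y) * conjPoisson v η (x - z) : ℝ) : ℂ) := fun y => by
      rw [← integral_complex_ofReal, ← integral_const_mul]
      congr 1 with z
      push_cast
      ring
    have h4 : ∫ y, spread f ρ y * (conjPoisson v η (x - y) : ℂ) =
        ∫ y, f y * ((∫ z, ballAvg (ρ y) (z - y) * conjPoisson v η (x - z) : ℝ) : ℂ) := by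
      simp_rw [← e3, spread, ← integral_mul_const]
      exact integral_integral_swap h3
    have h5 : Integrable fun y =>
        f y * ((∫ z, ballAvg (ρ y) (z - y) * conjPoisson v η (x - z) : ℝ) : ℂ) := by
      simp_rw [← e3]
      exact h3.integral_prod_right
    simp_rw [sub_mul]
    rw [integral_sub h1 h2, h4, ← integral_sub h1 h5]
    refine (enorm_integral_le_lintegral_enorm _).trans ?_
    rw [← lintegral_indicator hΩm]
    refine lintegral_mono fun y => ?_
    by_cases hy : y ∈ Ω
    · rw [indicator_of_mem hy, indicator_of_mem hy, ← mul_sub, ← Complex.ofReal_sub, enorm_mul]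
      gcongr
      rw [← ofReal_norm, Complex.norm_real]
      exact ENNReal.ofReal_le_ofReal
        (abs_conjPoisson_sub_integral_ballAvg_le v hη hy (hF x hx y))
    · have : ∀ z, ballAvg (ρ y) (z - y) = 0 := fun z => ballAvg_of_nonpos (not_lt.1 hy) _
      simp [indicator_of_notMem hy, this]
  have hmm : Measurable fun p : E × E => ENNReal.ofReal (regC v * maj (ρ p.2) (p.1 - p.2)) := by
    unfold maj
    fun_prop
  calc _ ≤ ∫⁻ x in F, ∫⁻ y in Ω, ‖f y‖ₑ * ENNReal.ofReal (regC v * maj (ρ y) (x - y)) :=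
        setLIntegral_mono' hFm hpt
    _ ≤ ∫⁻ x, ∫⁻ y in Ω, ‖f y‖ₑ * ENNReal.ofReal (regC v * maj (ρ y) (x - y)) :=
        setLIntegral_le_lintegral _ _
    _ = ∫⁻ y in Ω, ∫⁻ x, ‖f y‖ₑ * ENNReal.ofReal (regC v * maj (ρ y) (x - y)) := by
        refine lintegral_lintegral_swap ?_
        exact ((hf.aestronglyMeasurable.restrict (s := Ω)).comp_snd.enorm).mul hmm.aemeasurable
    _ = ∫⁻ y in Ω, ‖f y‖ₑ * ENNReal.ofReal (regC v * ∫ x : E, maj 1 x) := by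
        refine setLIntegral_congr_fun hΩm fun y hy => ?_
        have hy : 0 < ρ y := hy
        have hmi : Integrable fun x => regC v * maj (ρ y) (x - y) :=
          ((integrable_maj hy).comp_sub_right y).const_mul _
        rw [lintegral_const_mul _ (by unfold maj; fun_prop), ← ofReal_integral_eq_lintegral_ofReal
          hmi (Eventually.of_forall fun x => mul_nonneg (regC_nonneg v) (maj_nonneg hy.le _)),
          integral_const_mul, integral_sub_right_eq_self (fun x => maj (ρ y) x), integral_maj hy]
    _ = _ := by
        rw [lintegral_mul_const'' _ hf.aestronglyMeasurable.enorm.restrict, mul_comm]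

end Spread

section Decomposition

variable {E : Type*} [NormedAddCommGroup E] [InnerProductSpace ℝ E] [FiniteDimensional ℝ E]
  [MeasurableSpace E] [BorelSpace E]

lemma norm_spread_excSet_le {f : E → ℂ} (hf : Integrable f) {L : ℝ} (hL : 0 < L)
    (hne : (excSet f L)ᶜ.Nonempty) (x : E) :
    ‖spread f (fun y => Metric.infDist y (excSet f L)ᶜ / 4) x‖ ≤
      15 ^ Module.finrank ℝ E * L := by
  set F := (excSet f L)ᶜ with hF
  set n := Module.finrank ℝ E with hn
  set ω := volume.real (Metric.ball (0 : E) 1) with hω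
  have hω0 : 0 < ω := volume_real_unitBall_pos
  set D := Metric.infDist x F with hD
  have hD0 : 0 ≤ D := Metric.infDist_nonneg
  have hnear : ∀ y, ‖x - y‖ < Metric.infDist y F / 4 →
      ‖x - y‖ < D / 3 ∧ D / 5 ≤ Metric.infDist y F / 4 := by
    intro y hy
    have h1 : Metric.infDist y F ≤ D + ‖x - y‖ := by
      rw [← dist_eq_norm, dist_comm]
      exact Metric.infDist_le_infDist_add_dist
    have h2 : D ≤ Metric.infDist y F + ‖x - y‖ := by
      rw [← dist_eq_norm]
      exact Metric.infDist_le_infDist_add_dist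
    constructor <;> linarith
  rcases hD0.eq_or_lt with hD' | hD'
  · have : ∀ y, ballAvg (Metric.infDist y F / 4) (x - y) = 0 := fun y => by
      refine if_neg fun hy => ?_
      have := (hnear y hy).1
      rw [← hD', zero_div] at this
      exact (norm_nonneg _).not_gt this
    simp only [spread, this, Complex.ofReal_zero, mul_zero, integral_zero, norm_zero]
    positivity
  · obtain ⟨z, hz, hxz⟩ := (Metric.infDist_lt_iff hne).1 (show Metric.infDist x F < 2 * D by linarith)
    have hK : ∀ y, ‖f y * (ballAvg (Metric.infDist y F / 4) (x - y) : ℂ)‖ ≤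
        (Metric.closedBall z (3 * D)).indicator (fun y => ‖f y‖ * (ω * (D / 5) ^ n)⁻¹) y := by
      intro y
      rw [norm_mul, Complex.norm_real, Real.norm_of_nonneg (ballAvg_nonneg _ _)]
      by_cases hy : ‖x - y‖ < Metric.infDist y F / 4
      · obtain ⟨h1, h2⟩ := hnear y hy
        rw [indicator_of_mem]
        · rw [ballAvg, if_pos hy]
          gcongr
        · rw [Metric.mem_closedBall]
          have := dist_triangle y x z
          rw [dist_comm y x, dist_eq_norm x y] at this
          linarith
      · rw [ballAvg, if_neg hy, mul_zero]
        exact indicator_nonneg (fun _ _ => by positivity) _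
    have hi : Integrable ((Metric.closedBall z (3 * D)).indicator
        (fun y => ‖f y‖ * (ω * (D / 5) ^ n)⁻¹)) :=
      (hf.norm.mul_const _).indicator measurableSet_closedBall
    refine (norm_integral_le_of_norm_le hi (Eventually.of_forall hK)).trans ?_
    rw [integral_indicator measurableSet_closedBall, integral_mul_const]
    have h3 := setIntegral_le_of_notMem_excSet hz (r := 3 * D) (by positivity)
    rw [volume_real_closedBall z (by positivity)] at h3
    calc (∫ y in Metric.closedBall z (3 * D), ‖f y‖) * (ω * (D / 5) ^ n)⁻¹
        ≤ L * ((3 * D) ^ n * ω) * (ω * (D / 5) ^ n)⁻¹ := by gcongr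
      _ = ((3 * D) / (D / 5)) ^ n * L := by
          rw [div_pow (3 * D)]
          field_simp
      _ = 15 ^ n * L := by
          congr 2
          field_simp
          norm_num

/-- A Calderón–Zygmund decomposition at height `L`, without cancellation on individual cubes but
with a bad part whose conjugate Poisson integral is controlled off the exceptional set. -/
theorem exists_calderonZygmund [Nontrivial E] (v : E) {f : E → ℂ} (hf : Integrable f) {L : ℝ}
    (hL : 0 < L) :
    ∃ g : E → ℂ, Integrable g ∧ Integrable (fun x => ‖g x‖ ^ 2) ∧
      ∫ x, ‖g x‖ ^ 2 ≤ (1 + 15 ^ Module.finrank ℝ E) * L * ∫ x, ‖f x‖ ∧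
      ∫⁻ x, ‖f x - g x‖ₑ ≤ 2 * ∫⁻ x in excSet f L, ‖f x‖ₑ ∧
      ∀ η : ℝ, 0 < η → ∫⁻ x in (excSet f L)ᶜ,
        ‖∫ y, (f y - g y) * (conjPoisson v η (x - y) : ℂ)‖ₑ ≤
          ENNReal.ofReal (regC v * ∫ x : E, maj 1 x) * ∫⁻ x in excSet f L, ‖f x‖ₑ := by
  set Ω := excSet f L with hΩ
  have hΩo : IsOpen Ω := isOpen_excSet f L
  have hne : Ωᶜ.Nonempty := excSet_compl_nonempty hf hL
  set ρ : E → ℝ := fun y => Metric.infDist y Ωᶜ / 4 with hρ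
  have hρm : Measurable ρ := ((Metric.continuous_infDist_pt _).div_const 4).measurable
  have hpos : {y | 0 < ρ y} = Ω := by
    ext y
    have h1 := hΩo.isClosed_compl.notMem_iff_infDist_pos hne (x := y)
    rw [mem_compl_iff, not_not] at h1
    rw [h1]
    change 0 < Metric.infDist y Ωᶜ / 4 ↔ _
    constructor <;> intro h <;> linarith
  have hsi := integrable_spread hf hρm
  have hs1 : ∫ x, ‖spread f ρ x‖ ≤ ∫ y in Ω, ‖f y‖ := hpos ▸ integral_norm_spread_le hf hρm
  have hfF : Integrable (Ωᶜ.indicator f) := hf.indicator hΩo.measurableSet.compl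
  set g : E → ℂ := fun x => Ωᶜ.indicator f x + spread f ρ x with hg
  have hgi : Integrable g := hfF.add hsi
  have hfg : ∀ x, f x - g x = {y | 0 < ρ y}.indicator f x - spread f ρ x := fun x => by
    have := congr_fun (indicator_self_add_compl Ω f) x
    simp only [Pi.add_apply] at this
    rw [hpos]
    linear_combination -this
  have hgb : ∀ᵐ x, ‖g x‖ ≤ (1 + 15 ^ Module.finrank ℝ E) * L := by
    filter_upwards [ae_norm_le_of_notMem_excSet hf L] with x hx
    rw [add_mul, one_mul]
    refine (norm_add_le _ _).trans (add_le_add ?_ (norm_spread_excSet_le hf hL hne x))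
    by_cases h : x ∈ Ω
    · simpa [h] using hL.le
    · simpa [h] using hx h
  have hg1 : ∫ x, ‖g x‖ ≤ ∫ x, ‖f x‖ := by
    calc ∫ x, ‖g x‖ ≤ ∫ x, (‖Ωᶜ.indicator f x‖ + ‖spread f ρ x‖) :=
          integral_mono hgi.norm (hfF.norm.add hsi.norm) fun x => norm_add_le _ _
      _ ≤ (∫ x in Ωᶜ, ‖f x‖) + ∫ x in Ω, ‖f x‖ := by
          rw [integral_add hfF.norm hsi.norm]
          gcongr
          rw [← integral_indicator hΩo.measurableSet.compl]
          simp only [norm_indicator_eq_indicator_norm, le_refl]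
      _ = _ := by rw [add_comm, integral_add_compl hΩo.measurableSet hf.norm]
  have hg2b : ∀ᵐ x, ‖‖g x‖ ^ 2‖ ≤ (1 + 15 ^ Module.finrank ℝ E) * L * ‖g x‖ := by
    filter_upwards [hgb] with x hx
    rw [norm_pow, norm_norm, sq]
    gcongr
  have hg2 : Integrable fun x => ‖g x‖ ^ 2 :=
    (hgi.norm.const_mul _).mono' (hgi.aestronglyMeasurable.norm.pow 2) hg2b
  refine ⟨g, hgi, hg2, ?_, ?_, fun η hη => ?_⟩
  · calc ∫ x, ‖g x‖ ^ 2 ≤ ∫ x, (1 + 15 ^ Module.finrank ℝ E) * L * ‖g x‖ :=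
          integral_mono_ae hg2 (hgi.norm.const_mul _)
            (hg2b.mono fun x hx => (le_abs_self _).trans hx)
      _ ≤ _ := by
          rw [integral_const_mul]
          gcongr
  · simp_rw [hfg, hpos]
    have hm : AEMeasurable (fun x => ‖Ω.indicator f x‖ₑ) :=
      (hf.indicator hΩo.measurableSet).aestronglyMeasurable.enorm
    calc ∫⁻ x, ‖Ω.indicator f x - spread f ρ x‖ₑ
        ≤ ∫⁻ x, (‖Ω.indicator f x‖ₑ + ‖spread f ρ x‖ₑ) := lintegral_mono fun x => enorm_sub_le
      _ = (∫⁻ x in Ω, ‖f x‖ₑ) + ∫⁻ x, ‖spread f ρ x‖ₑ := by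
          rw [lintegral_add_left' hm, ← lintegral_indicator hΩo.measurableSet]
          simp only [enorm_indicator_eq_indicator_enorm]
      _ ≤ (∫⁻ x in Ω, ‖f x‖ₑ) + ∫⁻ x in Ω, ‖f x‖ₑ := by
          refine add_le_add le_rfl ?_
          rw [← ofReal_integral_norm_eq_lintegral_enorm hsi,
            ← ofReal_integral_norm_eq_lintegral_enorm hf.integrableOn]
          exact ENNReal.ofReal_le_ofReal hs1
      _ = _ := (two_mul _).symm
  · simp_rw [hfg]
    have h := lintegral_conjPoisson_spread_le v hf hρm (F := Ωᶜ) (fun x hx y => ?_)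
      hΩo.measurableSet.compl hη
    · rw [hpos] at h ⊢
      exact h
    · have := Metric.infDist_le_dist_of_mem (x := y) hx
      rw [dist_comm, dist_eq_norm] at this
      have h0 : 0 ≤ Metric.infDist y Ωᶜ := Metric.infDist_nonneg
      simp only [hρ]
      linarith

end Decomposition

section Limit

variable {E : Type*} [NormedAddCommGroup E] [InnerProductSpace ℝ E] [FiniteDimensional ℝ E]
  [MeasurableSpace E] [BorelSpace E]

/-- The conjugate Poisson integral of `f` at height `η`, in the direction `v`. -/
def conjInt (v : E) (η : ℝ) (f : E → ℂ) (x : E) : ℂ := ∫ y, f y * (conjPoisson v η (x - y) : ℂ)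

lemma integrable_mul_conjPoisson_sub (v : E) {η : ℝ} (hη : 0 < η) {f : E → ℂ} (hf : Integrable f)
    (x : E) : Integrable fun y => f y * (conjPoisson v η (x - y) : ℂ) := by
  have := continuous_conjPoisson v hη
  exact hf.mul_bdd (Continuous.aestronglyMeasurable (by fun_prop))
    (Eventually.of_forall fun y => norm_ofReal_conjPoisson_le v hη _)

lemma continuous_conjInt (v : E) {η : ℝ} (hη : 0 < η) {f : E → ℂ} (hf : Integrable f) :
    Continuous (conjInt v η f) := by
  have := continuous_conjPoisson v hη
  refine continuous_of_dominated (bound := fun y => ‖f y‖ * (‖v‖ / η ^ Module.finrank ℝ E))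
    (fun x => (integrable_mul_conjPoisson_sub v hη hf x).aestronglyMeasurable)
    (fun x => Eventually.of_forall fun y => ?_) (hf.norm.mul_const _)
    (Eventually.of_forall fun y => by fun_prop)
  rw [norm_mul]
  gcongr
  exact norm_ofReal_conjPoisson_le v hη _

lemma norm_conjInt_le (v : E) {η : ℝ} (hη : 0 < η) {f : E → ℂ} (hf : Integrable f) (x : E) :
    ‖conjInt v η f x‖ ≤ ‖v‖ / η ^ Module.finrank ℝ E * ∫ y, ‖f y‖ := by
  rw [mul_comm, ← integral_mul_const]
  refine norm_integral_le_of_norm_le (hf.norm.mul_const _) (Eventually.of_forall fun y => ?_)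
  rw [norm_mul]
  gcongr
  exact norm_ofReal_conjPoisson_le v hη _

lemma conjInt_sub (v : E) {η : ℝ} (hη : 0 < η) {f g : E → ℂ} (hf : Integrable f)
    (hg : Integrable g) (x : E) :
    conjInt v η (fun y => f y - g y) x = conjInt v η f x - conjInt v η g x := by
  simp only [conjInt, sub_mul]
  exact integral_sub (integrable_mul_conjPoisson_sub v hη hf x)
    (integrable_mul_conjPoisson_sub v hη hg x)

/-- Testing the conjugate Poisson integral of `f` against `φ` moves the kernel onto `φ`. -/
lemma integral_mul_conjInt (v : E) {η : ℝ} (hη : 0 < η) {f : E → ℂ} (hf : Integrable f)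
    {φ : E → ℝ} (hφ : Integrable φ) :
    ∫ x, (φ x : ℂ) * conjInt v η f x =
      ∫ y, f y * ((∫ x, φ x * conjPoisson v η (x - y) : ℝ) : ℂ) := by
  have hk := continuous_conjPoisson v hη
  have hi : Integrable (fun p : E × E => (φ p.1 : ℂ) * f p.2 * (conjPoisson v η (p.1 - p.2) : ℂ))
      ((volume : Measure E).prod volume) :=
    ((hφ.ofReal (𝕜 := ℂ)).mul_prod hf).mul_bdd (Continuous.aestronglyMeasurable (by fun_prop))
      (Eventually.of_forall fun y => norm_ofReal_conjPoisson_le v hη _)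
  calc _ = ∫ x, ∫ y, (φ x : ℂ) * f y * (conjPoisson v η (x - y) : ℂ) := by
        simp_rw [conjInt, mul_assoc, integral_const_mul]
    _ = ∫ y, ∫ x, (φ x : ℂ) * f y * (conjPoisson v η (x - y) : ℂ) := integral_integral_swap hi
    _ = _ := by
        congr 1 with y
        rw [← integral_complex_ofReal, ← integral_const_mul]
        congr 1 with x
        push_cast
        ring

lemma norm_integral_mul_conjInt_le (v : E) {η : ℝ} (hη : 0 < η) {f : E → ℂ} (hf : Integrable f)
    {φ : E → ℝ} (hφ : Integrable φ) {B : ℝ}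
    (hB : ∀ y, |∫ x, φ x * conjPoisson v η (x - y)| ≤ B) :
    ‖∫ x, (φ x : ℂ) * conjInt v η f x‖ ≤ B * ∫ y, ‖f y‖ := by
  rw [integral_mul_conjInt v hη hf hφ, mul_comm, ← integral_mul_const]
  refine norm_integral_le_of_norm_le (hf.norm.mul_const _) (Eventually.of_forall fun y => ?_)
  rw [norm_mul, Complex.norm_real]
  gcongr
  exact hB y

lemma norm_setIntegral_mul_conjInt_le [Nontrivial E] (v : E) {η : ℝ} (hη : 0 < η) {f : E → ℂ}
    (hf : Integrable f) {φ : E → ℝ} (hφ : Integrable φ) {A B : ℝ} (hA : ∀ x, |φ x| ≤ A)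
    (hB : ∀ y, |∫ x, φ x * conjPoisson v η (x - y)| ≤ B) {L : ℝ} (hL : 0 < L) {H : Set E}
    (hH : MeasurableSet H) (hHv : volume H ≠ ∞) (hLH : excSet f L ⊆ H) :
    ‖∫ x in H, (φ x : ℂ) * conjInt v η f x‖ ≤
      multC v * √(A ^ 2 * volume.real H) *
          √((1 + 15 ^ Module.finrank ℝ E) * L * ∫ x, ‖f x‖) +
        (2 * B + A * (regC v * ∫ x : E, maj 1 x)) * ∫ x in excSet f L, ‖f x‖ := by
  have hA0 : 0 ≤ A := (abs_nonneg _).trans (hA 0)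
  have hB0 : 0 ≤ B := (abs_nonneg _).trans (hB 0)
  have hR0 : 0 ≤ regC v * ∫ x : E, maj 1 x :=
    mul_nonneg (regC_nonneg v) (integral_nonneg fun x => maj_nonneg zero_le_one x)
  obtain ⟨g, hg, hg2, hgL, hbL, hbk⟩ := exists_calderonZygmund v hf hL
  have hb : Integrable fun x => f x - g x := hf.sub hg
  have hmul : ∀ {u : E → ℂ}, Integrable u → Integrable fun x => (φ x : ℂ) * conjInt v η u x :=
    fun hu => hφ.ofReal.mul_bdd (continuous_conjInt v hη hu).aestronglyMeasurable
      (Eventually.of_forall fun x => norm_conjInt_le v hη hu x)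
  have hsplit : ∫ x in H, (φ x : ℂ) * conjInt v η f x =
      (∫ x in H, (φ x : ℂ) * conjInt v η g x) +
        ((∫ x, (φ x : ℂ) * conjInt v η (fun y => f y - g y) x) -
          ∫ x in Hᶜ, (φ x : ℂ) * conjInt v η (fun y => f y - g y) x) := by
    rw [← integral_add_compl hH (hmul hb), add_sub_cancel_right,
      ← integral_add (hmul hg).integrableOn (hmul hb).integrableOn]
    congr 1 with x
    rw [conjInt_sub v hη hf hg]
    ring
  have hfa : Integrable (H.indicator fun x => (φ x : ℂ)) := hφ.ofReal.indicator hH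
  have hsq : ∀ x, ‖H.indicator (fun x => (φ x : ℂ)) x‖ ^ 2 ≤ H.indicator (fun _ => A ^ 2) x := by
    intro x
    by_cases hx : x ∈ H
    · simp only [hx, indicator_of_mem, Complex.norm_real, Real.norm_eq_abs]
      gcongr
      exact hA x
    · simp [hx]
  have hAi : Integrable (H.indicator fun _ : E => A ^ 2) :=
    (integrable_indicator_iff hH).2 (integrableOn_const hHv)
  have hsqi : Integrable fun x => ‖H.indicator (fun x => (φ x : ℂ)) x‖ ^ 2 :=
    hAi.mono' (hfa.aestronglyMeasurable.norm.pow 2) (Eventually.of_forall fun x => by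
      rw [Real.norm_of_nonneg (by positivity)]
      exact hsq x)
  have h1 : ‖∫ x in H, (φ x : ℂ) * conjInt v η g x‖ ≤ multC v * √(A ^ 2 * volume.real H) *
      √((1 + 15 ^ Module.finrank ℝ E) * L * ∫ x, ‖f x‖) := by
    have e : ∫ x in H, (φ x : ℂ) * conjInt v η g x =
        ∫ x, H.indicator (fun x => (φ x : ℂ)) x * conjInt v η g x := by
      rw [← integral_indicator hH]
      congr 1 with x
      by_cases hx : x ∈ H <;> simp [hx]
    rw [e]
    refine (norm_integral_mul_conjPoisson_conv_le v hη hfa hg hsqi hg2).trans ?_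
    have := multC_nonneg v
    gcongr
    calc _ ≤ ∫ x, H.indicator (fun _ => A ^ 2) x := integral_mono hsqi hAi hsq
      _ = _ := by rw [integral_indicator_const _ hH, smul_eq_mul, mul_comm]
  have hΩi : IntegrableOn f (excSet f L) := hf.integrableOn
  have hb1 : ∫ x, ‖f x - g x‖ ≤ 2 * ∫ x in excSet f L, ‖f x‖ := by
    rw [← ENNReal.ofReal_le_ofReal_iff (by positivity), ENNReal.ofReal_mul (by norm_num),
      ofReal_integral_norm_eq_lintegral_enorm hb, ofReal_integral_norm_eq_lintegral_enorm hΩi]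
    simpa using hbL
  have h2 : ‖∫ x, (φ x : ℂ) * conjInt v η (fun y => f y - g y) x‖ ≤
      2 * B * ∫ x in excSet f L, ‖f x‖ := by
    refine (norm_integral_mul_conjInt_le v hη hb hφ hB).trans ?_
    calc B * ∫ x, ‖f x - g x‖ ≤ B * (2 * ∫ x in excSet f L, ‖f x‖) := by gcongr
      _ = _ := by ring
  have h3 : ‖∫ x in Hᶜ, (φ x : ℂ) * conjInt v η (fun y => f y - g y) x‖ ≤
      A * (regC v * ∫ x : E, maj 1 x) * ∫ x in excSet f L, ‖f x‖ := by
    rw [← ENNReal.ofReal_le_ofReal_iff (by positivity), mul_assoc, ENNReal.ofReal_mul hA0,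
      ENNReal.ofReal_mul hR0, ofReal_integral_norm_eq_lintegral_enorm hΩi, ofReal_norm]
    calc _ ≤ ∫⁻ x in Hᶜ, ‖(φ x : ℂ) * conjInt v η (fun y => f y - g y) x‖ₑ :=
          enorm_integral_le_lintegral_enorm _
      _ ≤ ∫⁻ x in (excSet f L)ᶜ, ‖(φ x : ℂ) * conjInt v η (fun y => f y - g y) x‖ₑ :=
          lintegral_mono_set (compl_subset_compl.2 hLH)
      _ ≤ ∫⁻ x in (excSet f L)ᶜ, ENNReal.ofReal A * ‖conjInt v η (fun y => f y - g y) x‖ₑ := by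
          refine lintegral_mono fun x => ?_
          rw [enorm_mul, ← ofReal_norm (φ x : ℂ), Complex.norm_real]
          gcongr
          exact hA x
      _ ≤ _ := by
          rw [lintegral_const_mul' _ _ ENNReal.ofReal_ne_top]
          exact mul_le_mul' le_rfl (hbk η hη)
  rw [hsplit]
  refine (norm_add_le _ _).trans (add_le_add h1 ((norm_sub_le _ _).trans ?_))
  linarith

/-- Almost everywhere convergence of the conjugate Poisson integrals of an integrable function to
an integrable function implies weak convergence. -/
theorem tendsto_integral_mul_conjInt [Nontrivial E] (v : E) {η : ℕ → ℝ} (hη : ∀ j, 0 < η j)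
    {f g : E → ℂ} (hf : Integrable f) (hg : Integrable g)
    (hlim : ∀ᵐ x, Tendsto (fun j => conjInt v (η j) f x) atTop (𝓝 (g x)))
    {φ : E → ℝ} (hφ : Integrable φ) {A B : ℝ} (hA : ∀ x, |φ x| ≤ A)
    (hB : ∀ j y, |∫ x, φ x * conjPoisson v (η j) (x - y)| ≤ B)
    {S : Set E} (hS : MeasurableSet S) (hSv : volume S ≠ ∞) (hφS : ∀ x ∉ S, φ x = 0) :
    Tendsto (fun j => ∫ x, (φ x : ℂ) * conjInt v (η j) f x) atTop
      (𝓝 (∫ x, (φ x : ℂ) * g x)) := by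
  wlog hgm : StronglyMeasurable g generalizing g
  · have hae := hg.aestronglyMeasurable.ae_eq_mk
    have h := this (g := hg.aestronglyMeasurable.mk g) (hg.congr hae)
      (by filter_upwards [hlim, hae] with x h1 h2; rwa [← h2])
      hg.aestronglyMeasurable.stronglyMeasurable_mk
    convert h using 2
    refine integral_congr_ae ?_
    filter_upwards [hae] with x hx
    rw [hx]
  have hA0 : 0 ≤ A := (abs_nonneg _).trans (hA 0)
  set a : ℕ → ℝ := fun m => ∫ x in excSet f (m + 1), ‖f x‖ with ha
  have ha0 : ∀ m, 0 ≤ a m := fun m => integral_nonneg fun x => norm_nonneg _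
  have haE : ∀ m, ENNReal.ofReal (a m) = ∫⁻ x in excSet f (m + 1), ‖f x‖ₑ := fun m =>
    ofReal_integral_norm_eq_lintegral_enorm hf.integrableOn
  have hL : ∀ m : ℕ, (0 : ℝ) < m + 1 := fun m => by positivity
  have hLt : Tendsto (fun m : ℕ => (m : ℝ) + 1) atTop atTop :=
    tendsto_atTop_add_const_right _ _ tendsto_natCast_atTop_atTop
  have halim : Tendsto a atTop (𝓝 0) := by
    have h := (ENNReal.tendsto_toReal ENNReal.zero_ne_top).comp
      ((tendsto_setLIntegral_excSet hf).comp hLt)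
    refine h.congr fun m => ?_
    simp only [Function.comp_apply, ← haE, ENNReal.toReal_ofReal (ha0 m)]
  have hΩv : ∀ m : ℕ, volume (excSet f (m + 1)) ≠ ∞ := fun m =>
    (volume_excSet_lt_top hf (hL m)).ne
  have hΩ : ∀ m : ℕ, (m + 1) * volume.real (excSet f (m + 1)) ≤
      4 ^ Module.finrank ℝ E * a m := by
    intro m
    have h := ofReal_mul_volume_excSet_le hf (hL m)
    rw [← haE, ← ENNReal.ofReal_toReal (hΩv m), ← ENNReal.ofReal_mul (hL m).le,
      show (4 : ℝ≥0∞) ^ Module.finrank ℝ E = ENNReal.ofReal (4 ^ Module.finrank ℝ E) by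
        rw [ENNReal.ofReal_pow (by norm_num)]; simp,
      ← ENNReal.ofReal_mul (by positivity)] at h
    exact (ENNReal.ofReal_le_ofReal_iff (mul_nonneg (by positivity) (ha0 m))).1 h
  have hcm : ∀ j, StronglyMeasurable (conjInt v (η j) f) := fun j =>
    (continuous_conjInt v (hη j) hf).stronglyMeasurable
  have hT := fun m : ℕ => tendstoUniformlyOn_of_ae_tendsto (s := S) hcm hgm hS hSv
    (hlim.mono fun x hx _ => hx) (ε := 1 / ((m : ℝ) + 1) ^ 2) (by positivity)
  choose T hTS hTm hTv hTu using hT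
  set H : ℕ → Set E := fun m => T m ∪ excSet f (m + 1) with hH
  have hHm : ∀ m, MeasurableSet (H m) := fun m =>
    (hTm m).union (isOpen_excSet f _).measurableSet
  have hTfin : ∀ m, volume (T m) ≠ ∞ := fun m => ((hTv m).trans_lt ENNReal.ofReal_lt_top).ne
  have hHv : ∀ m, volume (H m) ≠ ∞ := fun m =>
    ((measure_union_le _ _).trans_lt (ENNReal.add_lt_top.2
      ⟨(hTfin m).lt_top, (hΩv m).lt_top⟩)).ne
  have hHL : ∀ m : ℕ, (m + 1) * volume.real (H m) ≤
      1 / (m + 1) + 4 ^ Module.finrank ℝ E * a m := by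
    intro m
    have h1 : volume.real (T m) ≤ 1 / ((m : ℝ) + 1) ^ 2 :=
      ENNReal.toReal_le_of_le_ofReal (by positivity) (hTv m)
    calc ((m : ℝ) + 1) * volume.real (H m)
        ≤ (m + 1) * (volume.real (T m) + volume.real (excSet f (m + 1))) := by
          gcongr
          exact measureReal_union_le _ _
      _ ≤ (m + 1) * (1 / ((m : ℝ) + 1) ^ 2) + (m + 1) * volume.real (excSet f (m + 1)) := by
          rw [mul_add]
          gcongr
      _ ≤ _ := by
          refine add_le_add (le_of_eq ?_) (hΩ m)
          field_simp
  have hclim : Tendsto (fun m : ℕ => 1 / ((m : ℝ) + 1) + 4 ^ Module.finrank ℝ E * a m) atTop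
      (𝓝 0) := by
    have := (tendsto_one_div_add_atTop_nhds_zero_nat (𝕜 := ℝ)).add
      (halim.const_mul (4 ^ Module.finrank ℝ E))
    simpa using this
  have hHlim : Tendsto (volume ∘ H) atTop (𝓝 0) := by
    have h0 : Tendsto (fun m => volume.real (H m)) atTop (𝓝 0) := by
      refine squeeze_zero (fun m => measureReal_nonneg) (fun m => ?_) hclim
      refine le_trans ?_ (hHL m)
      have : 0 ≤ volume.real (H m) := measureReal_nonneg
      nlinarith [(Nat.cast_nonneg m : (0 : ℝ) ≤ m)]
    have := ENNReal.tendsto_ofReal h0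
    rw [ENNReal.ofReal_zero] at this
    refine this.congr fun m => ENNReal.ofReal_toReal (hHv m)
  have hφg : Integrable fun x => (φ x : ℂ) * g x := by
    have : Integrable fun x => g x * (φ x : ℂ) := hg.mul_bdd (c := A)
      hφ.ofReal.aestronglyMeasurable (Eventually.of_forall fun x => by
        rw [Complex.norm_real]; exact hA x)
    simpa only [mul_comm] using this
  have hφu : ∀ j, Integrable fun x => (φ x : ℂ) * conjInt v (η j) f x := fun j =>
    hφ.ofReal.mul_bdd (hcm j).aestronglyMeasurable
      (Eventually.of_forall fun x => norm_conjInt_le v (hη j) hf x)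
  set N := (1 + 15 ^ Module.finrank ℝ E) * ∫ x, ‖f x‖ with hN
  have hN0 : 0 ≤ N := by positivity
  set bound : ℕ → ℝ := fun m => multC v * √(A ^ 2 * N *
    (1 / ((m : ℝ) + 1) + 4 ^ Module.finrank ℝ E * a m)) +
    (2 * B + A * (regC v * ∫ x : E, maj 1 x)) * a m + ‖∫ x in H m, (φ x : ℂ) * g x‖ with hbound
  have hblim : Tendsto bound atTop (𝓝 0) := by
    have h1 := (Real.continuous_sqrt.tendsto _).comp (hclim.const_mul (A ^ 2 * N))
    have h3 := (hφg.tendsto_setIntegral_nhds_zero hHlim).norm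
    have := ((h1.const_mul (multC v)).add
      (halim.const_mul (2 * B + A * (regC v * ∫ x : E, maj 1 x)))).add h3
    simp only [mul_zero, Real.sqrt_zero, add_zero, norm_zero] at this
    exact this
  have hHbound : ∀ m j, ‖∫ x in H m, ((φ x : ℂ) * conjInt v (η j) f x - φ x * g x)‖ ≤
      bound m := by
    intro m j
    rw [integral_sub (hφu j).integrableOn hφg.integrableOn]
    refine (norm_sub_le _ _).trans (add_le_add ?_ le_rfl)
    refine (norm_setIntegral_mul_conjInt_le v (hη j) hf hφ hA (hB j) (hL m) (hHm m) (hHv m)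
      subset_union_right).trans (add_le_add ?_ le_rfl)
    have := multC_nonneg v
    rw [mul_assoc, ← Real.sqrt_mul (by positivity)]
    refine mul_le_mul_of_nonneg_left (Real.sqrt_le_sqrt ?_) this
    calc A ^ 2 * volume.real (H m) * ((1 + 15 ^ Module.finrank ℝ E) * (m + 1) * ∫ x, ‖f x‖)
        = A ^ 2 * N * ((m + 1) * volume.real (H m)) := by rw [hN]; ring
      _ ≤ _ := by
          gcongr
          exact hHL m
  rw [tendsto_iff_norm_sub_tendsto_zero]
  rw [Metric.tendsto_atTop]
  intro δ hδ
  obtain ⟨m, hm⟩ := (hblim.eventually_lt_const (half_pos hδ)).exists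
  set P := ∫ x, |φ x| with hP
  have hP0 : 0 ≤ P := integral_nonneg fun x => abs_nonneg _
  obtain ⟨j₀, hj₀⟩ := eventually_atTop.1 ((Metric.tendstoUniformlyOn_iff.1 (hTu m))
    (δ / (2 * (P + 1))) (by positivity))
  refine ⟨j₀, fun j hj => ?_⟩
  have hfar : ‖∫ x in (H m)ᶜ, ((φ x : ℂ) * conjInt v (η j) f x - φ x * g x)‖ ≤
      δ / (2 * (P + 1)) * P := by
    calc _ ≤ ∫ x in (H m)ᶜ, δ / (2 * (P + 1)) * |φ x| := by
          refine norm_integral_le_of_norm_le (hφ.abs.const_mul _).integrableOn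
            ((ae_restrict_iff' (hHm m).compl).2 (Eventually.of_forall fun x hx => ?_))
          rw [← mul_sub, norm_mul, Complex.norm_real, Real.norm_eq_abs, mul_comm]
          by_cases hxS : x ∈ S
          · gcongr
            rw [← dist_eq_norm, dist_comm]
            exact (hj₀ j hj x ⟨hxS, fun h => hx (Or.inl h)⟩).le
          · simp [hφS x hxS]
      _ ≤ ∫ x, δ / (2 * (P + 1)) * |φ x| :=
          setIntegral_le_integral (hφ.abs.const_mul _)
            (Eventually.of_forall fun x => by positivity)
      _ = _ := integral_const_mul _ _
  have hlt : δ / (2 * (P + 1)) * P < δ / 2 := by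
    rw [div_mul_eq_mul_div, div_lt_div_iff₀ (by positivity) two_pos]
    nlinarith
  have hd : Integrable fun x => (φ x : ℂ) * conjInt v (η j) f x - φ x * g x := (hφu j).sub hφg
  rw [dist_zero_right, norm_norm, ← integral_sub (hφu j) hφg,
    ← integral_add_compl (hHm m) hd]
  refine (norm_add_le _ _).trans_lt ?_
  linarith [hHbound m j]

end Limit

section Regularization

variable {E : Type*} [NormedAddCommGroup E] [InnerProductSpace ℝ E] [FiniteDimensional ℝ E]
  [MeasurableSpace E] [BorelSpace E]

lemma integrable_norm_sub_mul_maj {f : E → ℂ} (hf : Integrable f) {ε : ℝ} (hε : 0 < ε) (x : E) :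
    Integrable fun y => ‖f y - f x‖ * maj ε (x - y) := by
  have h1 : Integrable fun y => ‖f y‖ * maj ε (x - y) :=
    hf.norm.mul_bdd (c := 1 / ε ^ Module.finrank ℝ E)
      ((continuous_maj hε).comp (by fun_prop)).aestronglyMeasurable
      (Eventually.of_forall fun y => by
        rw [Real.norm_of_nonneg (maj_nonneg hε.le _)]; exact maj_le hε _)
  refine (h1.add (((integrable_maj hε).comp_sub_left x).const_mul ‖f x‖)).mono'
    ((hf.aestronglyMeasurable.sub aestronglyMeasurable_const).norm.mul
      ((continuous_maj hε).comp (by fun_prop)).aestronglyMeasurable)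
    (Eventually.of_forall fun y => ?_)
  have := maj_nonneg hε.le (x - y)
  simp only [Pi.add_apply]
  rw [norm_mul, norm_norm, Real.norm_of_nonneg this, ← add_mul]
  gcongr
  exact norm_sub_le _ _

/-- Convolution with an odd kernel dominated by `maj ε` only sees the oscillation of `f`. -/
lemma norm_integral_mul_odd_le {D : E → ℝ} (hD : Measurable D) (hodd : ∀ x, D (-x) = -D x)
    {c ε : ℝ} (hε : 0 < ε) (hDc : ∀ x, |D x| ≤ c * maj ε x) {f : E → ℂ} (hf : Integrable f)
    (x : E) :
    ‖∫ y, f y * (D (x - y) : ℂ)‖ ≤ c * ∫ y, ‖f y - f x‖ * maj ε (x - y) := by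
  have hc : 0 ≤ c := by
    have h0 : 0 < maj ε (0 : E) := by unfold maj; positivity
    nlinarith [(abs_nonneg _).trans (hDc 0)]
  have hDi : Integrable D := ((integrable_maj hε).const_mul c).mono' hD.aestronglyMeasurable
    (Eventually.of_forall hDc)
  have hD0 : ∫ y, D (x - y) = 0 := by
    rw [integral_sub_left_eq_self D volume x]
    have h := integral_neg_eq_self D volume
    simp_rw [hodd] at h
    rw [integral_neg] at h
    linarith
  have hDx : Integrable fun y => (D (x - y) : ℂ) := (hDi.comp_sub_left x).ofReal
  have hfD : Integrable fun y => f y * (D (x - y) : ℂ) := by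
    refine hf.mul_bdd (c := c * (1 / ε ^ Module.finrank ℝ E)) hDx.aestronglyMeasurable
      (Eventually.of_forall fun y => ?_)
    rw [Complex.norm_real]
    exact (hDc _).trans (mul_le_mul_of_nonneg_left (maj_le hε _) hc)
  have e : ∫ y, f y * (D (x - y) : ℂ) = ∫ y, (f y - f x) * (D (x - y) : ℂ) := by
    simp_rw [sub_mul]
    rw [integral_sub hfD (hDx.const_mul _), integral_const_mul, integral_complex_ofReal, hD0]
    simp
  have hmi := integrable_norm_sub_mul_maj hf hε x
  rw [e, ← integral_const_mul]
  refine norm_integral_le_of_norm_le (hmi.const_mul c) (Eventually.of_forall fun y => ?_)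
  rw [norm_mul, Complex.norm_real, Real.norm_eq_abs]
  calc ‖f y - f x‖ * |D (x - y)| ≤ ‖f y - f x‖ * (c * maj ε (x - y)) := by
        gcongr
        exact hDc _
    _ = _ := by ring

lemma measurable_conjPoisson (v : E) (η : ℝ) : Measurable (conjPoisson v η) := by
  unfold conjPoisson hyp
  fun_prop

/-- Truncations of the singular integral are asymptotic to its conjugate Poisson regularization. -/
theorem ae_tendsto_truncation_sub_conjInt (v : E) {f : E → ℂ} (hf : Integrable f) :
    ∀ᵐ x, Tendsto (fun ε => (∫ y in {y : E | ε < ‖y‖}, f (x - y) * (conjPoisson v 0 y : ℂ)) -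
      conjInt v ε f x) (𝓝[>] 0) (𝓝 0) := by
  filter_upwards [ae_tendsto_integral_norm_sub_mul_maj hf] with x hx
  have hx' := hx.const_mul (regC v)
  rw [mul_zero] at hx'
  rw [tendsto_zero_iff_norm_tendsto_zero]
  refine squeeze_zero' (Eventually.of_forall fun _ => norm_nonneg _) ?_ hx'
  filter_upwards [self_mem_nhdsWithin] with ε hε
  have hε : 0 < ε := hε
  have hs : MeasurableSet {y : E | ε < ‖y‖} := measurableSet_lt measurable_const measurable_norm
  set K : E → ℝ := {y : E | ε < ‖y‖}.indicator (conjPoisson v 0) with hK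
  have hKb : ∀ z, |K z| ≤ ‖v‖ / ε ^ Module.finrank ℝ E := by
    intro z
    by_cases hz : ε < ‖z‖
    · rw [hK, indicator_of_mem (show z ∈ {y : E | ε < ‖y‖} from hz)]
      exact abs_conjPoisson_le z hε (by rw [hyp_zero]; exact hz.le)
    · rw [hK, indicator_of_notMem (show z ∉ {y : E | ε < ‖y‖} from hz), abs_zero]
      positivity
  have hKm : Measurable K := (measurable_conjPoisson v 0).indicator hs
  set D : E → ℝ := fun z => K z - conjPoisson v ε z with hD
  have hodd : ∀ z, D (-z) = -D z := by
    intro z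
    have : K (-z) = -K z := by
      by_cases hz : ε < ‖z‖ <;> simp [hK, hz, conjPoisson_neg]
    simp only [hD, this, conjPoisson_neg]
    ring
  have hDb : ∀ z, |D z| ≤ regC v * maj ε z := by
    intro z
    by_cases hz : ε < ‖z‖
    · rw [hD, hK]
      simp only [mem_ofPred_eq, hz, indicator_of_mem]
      exact abs_conjPoisson_sub_le_maj' hε hz.le (by simp [abs_of_pos hε])
    · simp only [hD, hK, mem_ofPred_eq, hz, not_false_eq_true, indicator_of_notMem, zero_sub,
        abs_neg]
      exact abs_conjPoisson_le_maj hε (by linarith)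
  have h1 : Integrable fun y => f y * (K (x - y) : ℂ) :=
    hf.mul_bdd (c := ‖v‖ / ε ^ Module.finrank ℝ E) (Complex.measurable_ofReal.comp
      (hKm.comp (measurable_const.sub measurable_id))).aestronglyMeasurable
      (Eventually.of_forall fun y => (Complex.norm_real _).trans_le (hKb _))
  have e : (∫ y in {y : E | ε < ‖y‖}, f (x - y) * (conjPoisson v 0 y : ℂ)) - conjInt v ε f x =
      ∫ y, f y * (D (x - y) : ℂ) := by
    have e1 : ∫ y in {y : E | ε < ‖y‖}, f (x - y) * (conjPoisson v 0 y : ℂ) =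
        ∫ y, f y * (K (x - y) : ℂ) := by
      rw [← integral_indicator hs, ← integral_sub_left_eq_self _ volume x]
      congr 1 with y
      by_cases hz : ε < ‖x - y‖ <;> simp [hK, indicator, hz]
    rw [e1, conjInt, ← integral_sub h1 (integrable_mul_conjPoisson_sub v hε hf x)]
    congr 1 with y
    simp only [hD]
    push_cast
    ring
  rw [e]
  exact norm_integral_mul_odd_le (hKm.sub (measurable_conjPoisson v ε)) hodd hε hDb hf x

/-- The convolution of `f` with the tent function. -/
def tentInt (ε : ℝ) (f : E → ℂ) (x : E) : ℂ := ∫ y, (tent ε (x - y) : ℂ) * f y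

lemma integrable_tent_mul {ε : ℝ} (hε : 0 < ε) {f : E → ℂ} (hf : Integrable f) (x : E) :
    Integrable fun y => (tent ε (x - y) : ℂ) * f y :=
  hf.bdd_mul (c := (tentMass E * ε ^ Module.finrank ℝ E)⁻¹)
    (Complex.continuous_ofReal.comp
      ((continuous_tent ε).comp (by fun_prop))).aestronglyMeasurable
    (Eventually.of_forall fun y => by
      rw [Complex.norm_real, Real.norm_of_nonneg (tent_nonneg hε _)]
      exact tent_le hε _)

lemma ae_tendsto_tentInt {f : E → ℂ} (hf : Integrable f) :
    ∀ᵐ x, Tendsto (fun ε => tentInt ε f x) (𝓝[>] 0) (𝓝 (f x)) := by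
  filter_upwards [ae_tendsto_integral_norm_sub_mul_maj hf] with x hx
  have hx' := hx.const_mul ((tentMass E)⁻¹ * 2 ^ (Module.finrank ℝ E + 1))
  rw [mul_zero] at hx'
  rw [tendsto_iff_norm_sub_tendsto_zero]
  refine squeeze_zero' (Eventually.of_forall fun _ => norm_nonneg _) ?_ hx'
  filter_upwards [self_mem_nhdsWithin] with ε hε
  have hε : 0 < ε := hε
  have hti : Integrable fun y => (tent ε (x - y) : ℂ) :=
    ((integrable_tent hε).comp_sub_left x).ofReal
  have hi := integrable_tent_mul hε hf x
  have e : tentInt ε f x - f x = ∫ y, (tent ε (x - y) : ℂ) * (f y - f x) := by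
    simp_rw [mul_sub]
    rw [integral_sub hi (hti.mul_const _), integral_mul_const, integral_complex_ofReal,
      integral_tent_sub hε]
    simp [tentInt]
  have hmi := integrable_norm_sub_mul_maj hf hε x
  rw [e, ← integral_const_mul]
  refine norm_integral_le_of_norm_le (hmi.const_mul _) (Eventually.of_forall fun y => ?_)
  rw [norm_mul, Complex.norm_real, Real.norm_of_nonneg (tent_nonneg hε _)]
  calc tent ε (x - y) * ‖f y - f x‖
      ≤ (tentMass E)⁻¹ * 2 ^ (Module.finrank ℝ E + 1) * maj ε (x - y) * ‖f y - f x‖ := by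
        gcongr
        exact tent_le_maj hε _
    _ = _ := by ring

lemma integral_tent_mul_conjPoisson (v : E) (η ε : ℝ) (x y : E) :
    ∫ z, tent ε (x - z) * conjPoisson v η (z - y) = mollKernel v η ε (x - y) := by
  rw [mollKernel, ← integral_add_right_eq_self _ y]
  congr 1 with z
  rw [add_sub_cancel_right, mul_comm, sub_add_eq_sub_sub_swap]

lemma continuous_mollKernel (v : E) {η ε : ℝ} (hη : 0 < η) (hε : 0 < ε) :
    Continuous (mollKernel v η ε) := by
  have hk := continuous_conjPoisson v hη
  have e : mollKernel v η ε = fun x => ∫ z, tent ε z * conjPoisson v η (x - z) := by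
    ext x
    rw [mollKernel, ← integral_sub_left_eq_self _ volume x]
    congr 1 with z
    rw [sub_sub_cancel, mul_comm]
  rw [e]
  refine continuous_of_dominated (bound := fun z => tent ε z * (‖v‖ / η ^ Module.finrank ℝ E))
    (fun x => ((continuous_tent ε).mul (by fun_prop)).aestronglyMeasurable)
    (fun x => Eventually.of_forall fun z => ?_) ((integrable_tent hε).mul_const _)
    (Eventually.of_forall fun z => by fun_prop)
  rw [norm_mul, Real.norm_of_nonneg (tent_nonneg hε _)]
  exact mul_le_mul_of_nonneg_left (abs_conjPoisson_le_const v hη _) (tent_nonneg hε _)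

/-- A bound for the mollified kernels at scale `ε`. -/
def mollB (v : E) (ε : ℝ) : ℝ :=
  (‖v‖ + mollC v) / ε ^ Module.finrank ℝ E

lemma tentInt_conjInt (v : E) {η ε : ℝ} (hη : 0 < η) (hε : 0 < ε) {f : E → ℂ} (hf : Integrable f)
    (x : E) : tentInt ε (conjInt v η f) x = ∫ y, f y * (mollKernel v η ε (x - y) : ℂ) := by
  rw [tentInt, integral_mul_conjInt v hη hf ((integrable_tent hε).comp_sub_left x)]
  simp_rw [integral_tent_mul_conjPoisson]

variable [Nontrivial E]

lemma abs_mollKernel_le (v : E) {η ε : ℝ} (hη : 0 < η) (hηε : η ≤ ε) (x : E) :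
    |mollKernel v η ε x| ≤ mollB v ε := by
  have hε := hη.trans_le hηε
  have h1 := abs_mollKernel_sub_le v hη hηε x
  have h2 := abs_conjPoisson_le_const v hε x
  have h3 := mul_le_mul_of_nonneg_left (maj_le hε x) (mollC_nonneg v)
  have h4 := abs_sub_abs_le_abs_sub (mollKernel v η ε x) (conjPoisson v ε x)
  rw [mollB, add_div, div_eq_mul_one_div (mollC v)]
  linarith

lemma norm_tentInt_conjInt_sub_le (v : E) {η ε : ℝ} (hη : 0 < η) (hηε : η ≤ ε) {f : E → ℂ}
    (hf : Integrable f) (x : E) :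
    ‖tentInt ε (conjInt v η f) x - conjInt v ε f x‖ ≤
      mollC v * ∫ y, ‖f y - f x‖ * maj ε (x - y) := by
  have hε := hη.trans_le hηε
  have hm := continuous_mollKernel v hη hε
  have h1 : Integrable fun y => f y * (mollKernel v η ε (x - y) : ℂ) :=
    hf.mul_bdd (c := mollB v ε) (Continuous.aestronglyMeasurable (by fun_prop))
      (Eventually.of_forall fun y => (Complex.norm_real _).trans_le (abs_mollKernel_le v hη hηε _))
  rw [tentInt_conjInt v hη hε hf, conjInt,
    ← integral_sub h1 (integrable_mul_conjPoisson_sub v hε hf x)]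
  refine le_of_eq_of_le ?_ (norm_integral_mul_odd_le
    (D := fun z => mollKernel v η ε z - conjPoisson v ε z)
    (hm.measurable.sub (measurable_conjPoisson v ε)) (fun z => ?_) hε
    (abs_mollKernel_sub_le v hη hηε) hf x)
  · congr 2 with y
    push_cast
    ring
  · simp only [mollKernel_neg, conjPoisson_neg]
    ring

lemma norm_tentInt_conjInt_le (v : E) {η ε : ℝ} (hη : 0 < η) (hηε : η ≤ ε) {f : E → ℂ}
    (hf : Integrable f) (x : E) :
    ‖tentInt ε (conjInt v η f) x‖ ≤ mollB v ε * ∫ y, ‖f y‖ := by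
  refine norm_integral_mul_conjInt_le v hη hf ((integrable_tent (hη.trans_le hηε)).comp_sub_left x)
    fun y => ?_
  rw [integral_tent_mul_conjPoisson]
  exact abs_mollKernel_le v hη hηε _

theorem tendsto_tentInt_conjInt (v : E) {η : ℕ → ℝ} (hη : ∀ j, 0 < η j)
    (hη0 : Tendsto η atTop (𝓝 0)) {f g : E → ℂ} (hf : Integrable f) (hg : Integrable g)
    (hlim : ∀ᵐ x, Tendsto (fun j => conjInt v (η j) f x) atTop (𝓝 (g x))) {ε : ℝ} (hε : 0 < ε)
    (x : E) :
    Tendsto (fun j => tentInt ε (conjInt v (η j) f) x) atTop (𝓝 (tentInt ε g x)) := by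
  obtain ⟨N, hN⟩ := eventually_atTop.1 (hη0.eventually_le_const hε)
  rw [← tendsto_add_atTop_iff_nat N]
  refine tendsto_integral_mul_conjInt v (η := fun j => η (j + N)) (fun j => hη _) hf hg
    (hlim.mono fun y hy => (tendsto_add_atTop_iff_nat N).2 hy)
    ((integrable_tent hε).comp_sub_left x) (A := (tentMass E * ε ^ Module.finrank ℝ E)⁻¹)
    (B := mollB v ε) (fun y => ?_) (fun j y => ?_) (S := Metric.closedBall x ε)
    measurableSet_closedBall measure_closedBall_lt_top.ne (fun y hy => ?_)
  · rw [abs_of_nonneg (tent_nonneg hε _)]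
    exact tent_le hε _
  · rw [integral_tent_mul_conjPoisson]
    exact abs_mollKernel_le v (hη _) (hN _ (by omega)) _
  · rw [Metric.mem_closedBall, not_le, dist_comm, dist_eq_norm] at hy
    exact tent_eq_zero hε hy.le

end Regularization

section Convolution

variable {E : Type*} [NormedAddCommGroup E] [InnerProductSpace ℝ E] [FiniteDimensional ℝ E]
  [MeasurableSpace E] [BorelSpace E]

lemma ae_tendsto_conjInt_of_tendsto_tentInt [Nontrivial E] (v : E) {η : ℕ → ℝ} (hη : ∀ j, 0 < η j)
    (hη0 : Tendsto η atTop (𝓝 0)) {F G : E → ℂ} (hF : Integrable F) (hG : Integrable G)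
    (h : ∀ ε, 0 < ε → ∀ x,
      Tendsto (fun j => tentInt ε (conjInt v (η j) F) x) atTop (𝓝 (tentInt ε G x))) :
    ∀ᵐ x, Tendsto (fun ε => conjInt v ε F x) (𝓝[>] 0) (𝓝 (G x)) := by
  filter_upwards [ae_tendsto_integral_norm_sub_mul_maj hF, ae_tendsto_tentInt hG] with x h1 h2
  have h1' := h1.const_mul (mollC v)
  rw [mul_zero] at h1'
  have h3 : Tendsto (fun ε => tentInt ε G x - conjInt v ε F x) (𝓝[>] 0) (𝓝 0) := by
    rw [tendsto_zero_iff_norm_tendsto_zero]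
    refine squeeze_zero' (Eventually.of_forall fun _ => norm_nonneg _) ?_ h1'
    filter_upwards [self_mem_nhdsWithin] with ε hε
    have hε : 0 < ε := hε
    refine le_of_tendsto ((h ε hε x).sub_const _).norm ?_
    filter_upwards [hη0.eventually_le_const hε] with j hj
    exact norm_tentInt_conjInt_sub_le v (hη j) hj hF x
  simpa using h2.sub h3

lemma integrable_mul_sub_translate {ψ lam : E → ℂ} (hψ : Integrable ψ) (hlam : Integrable lam) :
    Integrable (fun p : E × E => lam p.2 * (ψ p.1 - ψ (p.1 - p.2)))
      ((volume : Measure E).prod volume) := by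
  have h1 : Integrable (fun p : E × E => lam p.2 * ψ p.1) ((volume : Measure E).prod volume) := by
    simpa only [mul_comm] using hψ.mul_prod hlam
  have h2 : Integrable (fun p : E × E => lam p.2 * ψ (p.1 - p.2))
      ((volume : Measure E).prod volume) :=
    hlam.convolution_integrand (ContinuousLinearMap.mul ℝ ℂ) hψ
  simp_rw [mul_sub]
  exact h1.sub h2

lemma ae_sub_conv_eq {ψ lam : E → ℂ} (hψ : Integrable ψ) (hlam : Integrable lam)
    (hlam1 : ∫ y, lam y = 1) :
    (fun x => ψ x - ∫ y, lam y * ψ (x - y)) =ᵐ[volume]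
      fun x => ∫ y, lam y * (ψ x - ψ (x - y)) := by
  filter_upwards [(hlam.convolution_integrand (ContinuousLinearMap.mul ℝ ℂ)
    hψ).prod_right_ae] with x hx
  have hx : Integrable fun y => lam y * ψ (x - y) := hx
  simp_rw [mul_sub]
  rw [integral_sub (hlam.mul_const _) hx, integral_mul_const, hlam1, one_mul]

lemma integral_tent_mul_integral {ε : ℝ} (hε : 0 < ε) {T : E × E → ℂ}
    (hT : Integrable T ((volume : Measure E).prod volume)) (x : E) :
    tentInt ε (fun w => ∫ y, T (w, y)) x = ∫ y, tentInt ε (fun w => T (w, y)) x := by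
  have ht := continuous_tent (E := E) ε
  simp_rw [tentInt, ← integral_const_mul]
  refine integral_integral_swap (f := fun w y => (tent ε (x - w) : ℂ) * T (w, y))
    (hT.bdd_mul (f := fun p : E × E => (tent ε (x - p.1) : ℂ))
      (c := (tentMass E * ε ^ Module.finrank ℝ E)⁻¹)
      (Continuous.aestronglyMeasurable (by fun_prop)) (Eventually.of_forall fun p => ?_))
  rw [Complex.norm_real, Real.norm_of_nonneg (tent_nonneg hε _)]
  exact tent_le hε _

variable [Nontrivial E]

lemma tentInt_conjInt_sub_conv (v : E) {η ε : ℝ} (hη : 0 < η) (hηε : η ≤ ε) {ψ lam : E → ℂ}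
    (hψ : Integrable ψ) (hlam : Integrable lam) (hlam1 : ∫ y, lam y = 1) (x : E) :
    Integrable (fun y => lam y * tentInt ε (conjInt v η fun w => ψ w - ψ (w - y)) x) ∧
    tentInt ε (conjInt v η fun w => ψ w - ∫ y, lam y * ψ (w - y)) x =
      ∫ y, lam y * tentInt ε (conjInt v η fun w => ψ w - ψ (w - y)) x := by
  have hε := hη.trans_le hηε
  have hm := continuous_mollKernel v hη hε
  have hP := integrable_mul_sub_translate hψ hlam
  have hF : Integrable fun w => ψ w - ∫ y, lam y * ψ (w - y) :=
    hP.integral_prod_left.congr (ae_sub_conv_eq hψ hlam hlam1).symm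
  have hi : Integrable (fun p : E × E => lam p.2 * (ψ p.1 - ψ (p.1 - p.2)) *
      (mollKernel v η ε (x - p.1) : ℂ)) ((volume : Measure E).prod volume) :=
    hP.mul_bdd (c := mollB v ε) (Continuous.aestronglyMeasurable (by fun_prop))
      (Eventually.of_forall fun y => (Complex.norm_real _).trans_le (abs_mollKernel_le v hη hηε _))
  have e : ∀ y, lam y * tentInt ε (conjInt v η fun w => ψ w - ψ (w - y)) x =
      ∫ w, lam y * (ψ w - ψ (w - y)) * (mollKernel v η ε (x - w) : ℂ) := by
    intro y
    have hd : Integrable fun w => ψ w - ψ (w - y) := hψ.sub (hψ.comp_sub_right y)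
    rw [tentInt_conjInt v hη hε hd, ← integral_const_mul]
    simp_rw [mul_assoc]
  simp_rw [e]
  refine ⟨hi.integral_prod_right, ?_⟩
  rw [tentInt_conjInt v hη hε hF, ← integral_integral_swap hi]
  refine integral_congr_ae ?_
  filter_upwards [ae_sub_conv_eq hψ hlam hlam1] with w hw
  rw [hw, integral_mul_const]

/-- If the regularized transforms of all differences `ψ - ψ (· - y)` converge, then so does
that of `ψ - ψ * lam`. -/
theorem ae_tendsto_conjInt_sub_conv (v : E) {η : ℕ → ℝ} (hη : ∀ j, 0 < η j)
    (hη0 : Tendsto η atTop (𝓝 0)) {ψ lam : E → ℂ} (hψ : Integrable ψ) (hlam : Integrable lam)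
    (hlam1 : ∫ y, lam y = 1) {T : E × E → ℂ} (hT : ∀ y, Integrable fun x => T (x, y))
    (hlT : Integrable (fun p : E × E => lam p.2 * T p) ((volume : Measure E).prod volume))
    (hlim : ∀ y, ∀ᵐ x, Tendsto (fun j => conjInt v (η j) (fun w => ψ w - ψ (w - y)) x) atTop
      (𝓝 (T (x, y)))) :
    ∀ᵐ x, Tendsto (fun ε => conjInt v ε (fun w => ψ w - ∫ y, lam y * ψ (w - y)) x) (𝓝[>] 0)
      (𝓝 (∫ y, lam y * T (x, y))) := by
  have hF : Integrable fun w => ψ w - ∫ y, lam y * ψ (w - y) :=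
    (integrable_mul_sub_translate hψ hlam).integral_prod_left.congr
      (ae_sub_conv_eq hψ hlam hlam1).symm
  refine ae_tendsto_conjInt_of_tendsto_tentInt v hη hη0 hF hlT.integral_prod_left fun ε hε x => ?_
  rw [integral_tent_mul_integral hε hlT]
  have e : ∀ y, tentInt ε (fun w => lam y * T (w, y)) x =
      lam y * tentInt ε (fun w => T (w, y)) x := by
    intro y
    simp_rw [tentInt, ← integral_const_mul, mul_left_comm]
  simp_rw [e]
  have hev := hη0.eventually_le_const hε
  refine Tendsto.congr' (hev.mono fun j hj =>
    (tentInt_conjInt_sub_conv v (hη j) hj hψ hlam hlam1 x).2.symm) ?_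
  refine tendsto_integral_filter_of_dominated_convergence
    (fun y => ‖lam y‖ * (mollB v ε * (2 * ∫ w, ‖ψ w‖)))
    (hev.mono fun j hj =>
      (tentInt_conjInt_sub_conv v (hη j) hj hψ hlam hlam1 x).1.aestronglyMeasurable)
    (hev.mono fun j hj => Eventually.of_forall fun y => ?_) (hlam.norm.mul_const _)
    (Eventually.of_forall fun y => ?_)
  · have hd := hψ.sub (hψ.comp_sub_right y)
    have hB : 0 ≤ mollB v ε := (abs_nonneg _).trans (abs_mollKernel_le v (hη j) hj 0)
    rw [norm_mul]
    gcongr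
    refine (norm_tentInt_conjInt_le v (hη j) hj hd x).trans ?_
    gcongr
    calc ∫ w, ‖ψ w - ψ (w - y)‖ ≤ ∫ w, (‖ψ w‖ + ‖ψ (w - y)‖) :=
          integral_mono hd.norm (hψ.norm.add (hψ.comp_sub_right y).norm) fun w => norm_sub_le _ _
      _ = 2 * ∫ w, ‖ψ w‖ := by
          rw [integral_add hψ.norm (hψ.comp_sub_right y).norm,
            integral_sub_right_eq_self (fun w => ‖ψ w‖) y]
          ring
  · exact (tendsto_tentInt_conjInt v hη hη0 (hψ.sub (hψ.comp_sub_right y)) (hT y) (hlim y) hε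
      x).const_mul _

end Convolution

section Growth

variable {E V : Type*} [NormedAddCommGroup E] [NormedSpace ℝ E]
  [MeasurableSpace E] [BorelSpace E] {μ : Measure E} [μ.IsAddRightInvariant]
  [NormedAddCommGroup V]

/-- If the differences `U j - U j (· - y)` converge to a function of `L¹` norm at most `C` for
all `‖y‖ ≤ 1`, then the `L¹` norm of the limit grows at most linearly in `y`. -/
lemma exists_limit_of_norm_le_one {U : ℕ → E → V} {C : ℝ}
    (h : ∀ y, ‖y‖ ≤ 1 → ∃ g : E → V, Integrable g μ ∧
      (∀ᵐ x ∂μ, Tendsto (fun j => U j x - U j (x - y)) atTop (𝓝 (g x))) ∧ ∫ x, ‖g x‖ ∂μ ≤ C)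
    (y : E) : ∃ g : E → V, Integrable g μ ∧
      (∀ᵐ x ∂μ, Tendsto (fun j => U j x - U j (x - y)) atTop (𝓝 (g x))) ∧
      ∫ x, ‖g x‖ ∂μ ≤ C * (‖y‖ + 1) := by
  set m := ⌊‖y‖⌋₊ + 1 with hm
  have hm0 : (0 : ℝ) < m := by positivity
  set z := (m : ℝ)⁻¹ • y with hz
  have hz1 : ‖z‖ ≤ 1 := by
    rw [hz, norm_smul, norm_inv, Real.norm_natCast, inv_mul_le_one₀ hm0, hm]
    push_cast
    exact (Nat.lt_floor_add_one _).le
  obtain ⟨g₁, hg₁, hl₁, hC₁⟩ := h z hz1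
  have key : ∀ k : ℕ, ∃ g : E → V, Integrable g μ ∧
      (∀ᵐ x ∂μ, Tendsto (fun j => U j x - U j (x - (k : ℝ) • z)) atTop (𝓝 (g x))) ∧
      ∫ x, ‖g x‖ ∂μ ≤ k * C := by
    intro k
    induction k with
    | zero => exact ⟨0, integrable_zero _ _ _, by simp, by simp⟩
    | succ k ih =>
      obtain ⟨g, hg, hl, hC⟩ := ih
      have hg' := hg₁.comp_sub_right ((k : ℝ) • z)
      refine ⟨fun x => g x + g₁ (x - (k : ℝ) • z), hg.add hg', ?_, ?_⟩
      · filter_upwards [hl, (measurePreserving_sub_right μ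
          ((k : ℝ) • z)).quasiMeasurePreserving.ae hl₁] with x hx hx'
        refine (hx.add hx').congr fun j => ?_
        rw [sub_add_sub_cancel, sub_sub, Nat.cast_succ, add_smul, one_smul]
      · calc ∫ x, ‖g x + g₁ (x - (k : ℝ) • z)‖ ∂μ
            ≤ ∫ x, (‖g x‖ + ‖g₁ (x - (k : ℝ) • z)‖) ∂μ :=
              integral_mono (hg.add hg').norm (hg.norm.add hg'.norm) fun x => norm_add_le _ _
          _ = (∫ x, ‖g x‖ ∂μ) + ∫ x, ‖g₁ x‖ ∂μ := by
              rw [integral_add hg.norm hg'.norm,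
                integral_sub_right_eq_self (fun x => ‖g₁ x‖) ((k : ℝ) • z)]
          _ ≤ (k + 1 : ℕ) * C := by
              push_cast
              linarith
  obtain ⟨g, hg, hl, hC⟩ := key m
  refine ⟨g, hg, ?_, hC.trans ?_⟩
  · rwa [hz, smul_inv_smul₀ hm0.ne'] at hl
  · have hC0 : 0 ≤ C := (integral_nonneg fun x => norm_nonneg _).trans hC₁
    rw [mul_comm, hm]
    gcongr
    push_cast
    have := Nat.floor_le (norm_nonneg y)
    linarith

end Growth

section Main

variable {E : Type*} [NormedAddCommGroup E] [InnerProductSpace ℝ E] [FiniteDimensional ℝ E]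
  [MeasurableSpace E] [BorelSpace E]

lemma conjInt_sub_translate (v : E) {η : ℝ} (hη : 0 < η) {ψ : E → ℂ} (hψ : Integrable ψ)
    (x y : E) : conjInt v η (fun w => ψ w - ψ (w - y)) x =
      conjInt v η ψ x - conjInt v η ψ (x - y) := by
  rw [conjInt_sub v hη hψ (hψ.comp_sub_right y)]
  congr 1
  simp only [conjInt]
  rw [← integral_add_right_eq_self _ y]
  congr 1 with w
  rw [add_sub_cancel_right, sub_add_eq_sub_sub_swap]

theorem exists_limit_sub_conv [Nontrivial E] {ι : Type*} [Fintype ι] (v : ι → E)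
    {η : ℕ → ℝ} (hη : ∀ j, 0 < η j)
    (hη0 : Tendsto η atTop (𝓝 0)) {ψ lam : E → ℂ} (hψ : Integrable ψ) (hlam : Integrable lam)
    (hlam0 : Integrable fun y => ‖y‖ • lam y) (hlam1 : ∫ y, lam y = 1) {C : ℝ}
    (h : ∀ y : E, ‖y‖ ≤ 1 → ∃ g : E → ι → ℂ, Integrable g ∧
      (∀ᵐ x, ∀ i, Tendsto (fun j => conjInt (v i) (η j) (fun w => ψ w - ψ (w - y)) x) atTop
        (𝓝 (g x i))) ∧ ∫ x, ‖g x‖ ≤ C) :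
    ∃ g : E → ι → ℂ, Integrable g ∧
      (∀ᵐ x, ∀ i, Tendsto (fun ε =>
        conjInt (v i) ε (fun w => ψ w - ∫ y, lam y * ψ (w - y)) x) (𝓝[>] 0) (𝓝 (g x i))) ∧
      ∫ x, ‖g x‖ ≤ C * ∫ y, (‖y‖ + 1) * ‖lam y‖ := by
  set U : ℕ → E → ι → ℂ := fun j x i => conjInt (v i) (η j) ψ x with hU
  have hUc : ∀ j, Continuous (U j) := fun j =>
    continuous_pi fun i => continuous_conjInt (v i) (hη j) hψ
  have hgrow := exists_limit_of_norm_le_one (μ := volume) (U := U) (C := C) fun y hy => by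
    obtain ⟨g, hg, hl, hgC⟩ := h y hy
    refine ⟨g, hg, hl.mono fun x hx => tendsto_pi_nhds.2 fun i => ?_, hgC⟩
    exact (hx i).congr fun j => conjInt_sub_translate (v i) (hη j) hψ x y
  set T : E × E → ι → ℂ := fun p => limUnder atTop fun j => U j p.1 - U j (p.1 - p.2) with hT
  have hTm : StronglyMeasurable T := StronglyMeasurable.limUnder fun j =>
    (((hUc j).comp continuous_fst).sub
      ((hUc j).comp (continuous_fst.sub continuous_snd))).stronglyMeasurable
  have hTy : ∀ y, Integrable (fun x => T (x, y)) ∧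
      (∀ᵐ x, Tendsto (fun j => U j x - U j (x - y)) atTop (𝓝 (T (x, y)))) ∧
      ∫ x, ‖T (x, y)‖ ≤ C * (‖y‖ + 1) := by
    intro y
    obtain ⟨g, hg, hl, hgC⟩ := hgrow y
    have e : g =ᵐ[volume] fun x => T (x, y) := hl.mono fun x hx => hx.limUnder_eq.symm
    refine ⟨hg.congr e, ?_, ?_⟩
    · filter_upwards [hl, e] with x hx hxe
      rwa [← hxe]
    · exact (integral_congr_ae (e.fun_comp norm)).symm.trans_le hgC
  have hbi : Integrable fun y => (‖y‖ + 1) * ‖lam y‖ := by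
    refine (hlam0.norm.add hlam.norm).congr (Eventually.of_forall fun y => ?_)
    simp only [Pi.add_apply, norm_smul, norm_norm]
    ring
  have hQm : AEStronglyMeasurable (fun p : E × E => lam p.2 • T p)
      ((volume : Measure E).prod volume) :=
    hlam.aestronglyMeasurable.comp_snd.smul hTm.aestronglyMeasurable
  have hQn : ∀ y, ∫ x, ‖lam y • T (x, y)‖ ≤ C * ((‖y‖ + 1) * ‖lam y‖) := by
    intro y
    simp_rw [norm_smul, integral_const_mul]
    have := mul_le_mul_of_nonneg_left (hTy y).2.2 (norm_nonneg (lam y))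
    linarith
  have hQni : Integrable fun y => ∫ x, ‖lam y • T (x, y)‖ := by
    refine (hbi.const_mul C).mono' hQm.norm.prod_swap.integral_prod_right'
      (Eventually.of_forall fun y => ?_)
    rw [Real.norm_of_nonneg (integral_nonneg fun x => norm_nonneg _)]
    exact hQn y
  have hQ : Integrable (fun p : E × E => lam p.2 • T p) ((volume : Measure E).prod volume) :=
    (integrable_prod_iff' hQm).2 ⟨Eventually.of_forall fun y => (hTy y).1.smul (lam y), hQni⟩
  refine ⟨fun x => ∫ y, lam y • T (x, y), hQ.integral_prod_left, ?_, ?_⟩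
  · have hi : ∀ i, ∀ᵐ x, Tendsto (fun ε =>
        conjInt (v i) ε (fun w => ψ w - ∫ y, lam y * ψ (w - y)) x) (𝓝[>] 0)
        (𝓝 (∫ y, lam y * T (x, y) i)) := by
      intro i
      refine ae_tendsto_conjInt_sub_conv (v i) hη hη0 hψ hlam hlam1 (T := fun p => T p i)
        (fun y => (hTy y).1.eval i) (hQ.eval i) fun y => ?_
      filter_upwards [(hTy y).2.1] with x hx
      refine (tendsto_pi_nhds.1 hx i).congr fun j => ?_
      exact (conjInt_sub_translate (v i) (hη j) hψ x y).symm
    filter_upwards [ae_all_iff.2 hi, hQ.prod_right_ae] with x hx hxi i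
    rw [eval_integral fun i => hxi.eval i]
    exact hx i
  · calc ∫ x, ‖∫ y, lam y • T (x, y)‖ ≤ ∫ x, ∫ y, ‖lam y • T (x, y)‖ :=
          integral_mono hQ.integral_prod_left.norm hQ.norm.integral_prod_left
            fun x => norm_integral_le_integral_norm _
      _ = ∫ y, ∫ x, ‖lam y • T (x, y)‖ := integral_integral_swap hQ.norm
      _ ≤ ∫ y, C * ((‖y‖ + 1) * ‖lam y‖) := integral_mono hQni (hbi.const_mul C) hQn
      _ = _ := integral_const_mul _ _

end Main

section Euclidean

variable {d : ℕ}

lemma measurableEmbedding_ofLp :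
    MeasurableEmbedding (WithLp.ofLp : EuclideanSpace ℝ (Fin d) → Fin d → ℝ) :=
  (MeasurableEquiv.toLp 2 (Fin d → ℝ)).symm.measurableEmbedding

lemma integrable_comp_ofLp_iff {G : Type*} [NormedAddCommGroup G] {f : (Fin d → ℝ) → G} :
    Integrable (fun x : EuclideanSpace ℝ (Fin d) => f x.ofLp) ↔ Integrable f :=
  (PiLp.volume_preserving_ofLp (Fin d)).integrable_comp_emb measurableEmbedding_ofLp

lemma integral_comp_ofLp {G : Type*} [NormedAddCommGroup G] [NormedSpace ℝ G]
    (f : (Fin d → ℝ) → G) :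
    ∫ x : EuclideanSpace ℝ (Fin d), f x.ofLp = ∫ x, f x :=
  (PiLp.volume_preserving_ofLp (Fin d)).integral_comp measurableEmbedding_ofLp f

lemma ae_ofLp_iff {p : (Fin d → ℝ) → Prop} :
    (∀ᵐ x : EuclideanSpace ℝ (Fin d), p x.ofLp) ↔ ∀ᵐ x, p x := by
  rw [← measurableEmbedding_ofLp.ae_map_iff, (PiLp.volume_preserving_ofLp (Fin d)).map_eq]

lemma eucNorm_ofLp (x : EuclideanSpace ℝ (Fin d)) : eucNorm x.ofLp = ‖x‖ := by
  simp [eucNorm, EuclideanSpace.norm_eq]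

/-- The direction whose conjugate Poisson kernel at height zero is the `i`-th Riesz kernel. -/
def rieszDir (d : ℕ) (i : Fin d) : EuclideanSpace ℝ (Fin d) :=
  EuclideanSpace.single i (rieszConst d)

lemma rieszKernel_ofLp (x : EuclideanSpace ℝ (Fin d)) (i : Fin d) :
    rieszKernel d x.ofLp i = conjPoisson (rieszDir d i) 0 x := by
  by_cases hx : x = 0
  · simp [hx, rieszKernel, conjPoisson]
  · have hx' : x.ofLp ≠ 0 := by simpa using hx
    simp [rieszKernel, conjPoisson, hx', hyp_zero, rieszDir, EuclideanSpace.inner_single_left,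
      eucNorm_ofLp]

lemma integrableOn_mul_rieszKernel {f : (Fin d → ℝ) → ℂ} (hf : Integrable f) {ε : ℝ} (hε : 0 < ε)
    (x : Fin d → ℝ) (i : Fin d) :
    IntegrableOn (fun y => f (x - y) * ((rieszKernel d y i : ℝ) : ℂ)) {y | ε < eucNorm y} := by
  have hs : MeasurableSet {y : Fin d → ℝ | ε < eucNorm y} := by
    unfold eucNorm
    exact measurableSet_lt measurable_const (by fun_prop)
  have hm : Measurable fun y : Fin d → ℝ => rieszKernel d y i := by
    have : (fun y : Fin d → ℝ => rieszKernel d y i) =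
        fun y => conjPoisson (rieszDir d i) 0 (WithLp.toLp 2 y) := by
      ext y
      rw [← rieszKernel_ofLp]
    rw [this]
    exact (measurable_conjPoisson _ _).comp (WithLp.measurable_toLp 2 _)
  refine (hf.comp_sub_left x).integrableOn.mul_bdd
    (c := ‖rieszDir d i‖ / ε ^ Module.finrank ℝ (EuclideanSpace ℝ (Fin d)))
    (Complex.measurable_ofReal.comp hm).aestronglyMeasurable
    ((ae_restrict_iff' hs).2 (Eventually.of_forall fun y hy => ?_))
  have hy : ε < ‖WithLp.toLp 2 y‖ := by
    rw [← eucNorm_ofLp]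
    exact hy
  refine (Complex.norm_real _).trans_le ?_
  rw [show y = (WithLp.toLp 2 y).ofLp from rfl, rieszKernel_ofLp]
  exact abs_conjPoisson_le _ hε (by rw [hyp_zero]; exact hy.le)

lemma truncRiesz_ofLp {f : (Fin d → ℝ) → ℂ} (hf : Integrable f) {ε : ℝ} (hε : 0 < ε)
    (x : EuclideanSpace ℝ (Fin d)) (i : Fin d) :
    truncRiesz f x.ofLp ε i = ∫ y in {y : EuclideanSpace ℝ (Fin d) | ε < ‖y‖},
      f (x - y).ofLp * (conjPoisson (rieszDir d i) 0 y : ℂ) := by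
  rw [truncRiesz, eval_integral fun i => integrableOn_mul_rieszKernel hf hε x.ofLp i,
    ← (PiLp.volume_preserving_ofLp (Fin d)).setIntegral_preimage_emb measurableEmbedding_ofLp]
  simp only [preimage_ofPred_eq, eucNorm_ofLp, rieszKernel_ofLp, WithLp.ofLp_sub]

/-- The Riesz transform is the limit of its conjugate Poisson regularizations. -/
theorem hasRiesz_iff {f : (Fin d → ℝ) → ℂ} (hf : Integrable f) {g : (Fin d → ℝ) → Fin d → ℂ} :
    HasRiesz f g ↔ ∀ᵐ x : EuclideanSpace ℝ (Fin d), ∀ i, Tendsto (fun ε =>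
      conjInt (rieszDir d i) ε (fun y => f y.ofLp) x) (𝓝[>] 0) (𝓝 (g x.ofLp i)) := by
  have hf' := integrable_comp_ofLp_iff.2 hf
  rw [HasRiesz, ← ae_ofLp_iff]
  refine eventually_congr ?_
  filter_upwards [ae_all_iff.2 fun i => ae_tendsto_truncation_sub_conjInt (rieszDir d i) hf']
    with x hx
  rw [tendsto_pi_nhds]
  refine forall_congr' fun i => ?_
  have hc : (fun ε => truncRiesz f x.ofLp ε i) =ᶠ[𝓝[>] 0] fun ε =>
      ∫ y in {y : EuclideanSpace ℝ (Fin d) | ε < ‖y‖},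
        f (x - y).ofLp * (conjPoisson (rieszDir d i) 0 y : ℂ) := by
    filter_upwards [self_mem_nhdsWithin] with ε hε
    exact truncRiesz_ofLp hf hε x i
  rw [tendsto_congr' hc]
  constructor <;> intro h
  · simpa using h.sub (hx i)
  · simpa using h.add (hx i)

lemma conv_ofLp (f g : (Fin d → ℝ) → ℂ) (x : EuclideanSpace ℝ (Fin d)) :
    conv f g x.ofLp = ∫ y : EuclideanSpace ℝ (Fin d), g y.ofLp * f (x - y).ofLp := by
  rw [conv, ← integral_comp_ofLp, ← integral_sub_left_eq_self _ volume x]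
  congr 1 with y
  rw [mul_comm, WithLp.ofLp_sub, sub_sub_cancel]

end Euclidean

/-- Lemma: smoothing.
Suppose `ψ ∈ L¹` satisfies `‖R(ψ - ψ(·-y))‖₁ ≤ C < ∞` for all `|y| ≤ 1`, and
`λ ∈ L¹` with `|y| λ(y) ∈ L¹` and `∫ λ = 1`.  Then `ψ - ψ*λ ∈ H¹` with
`‖R(ψ - ψ*λ)‖₁ ≤ C ∫ (|y| + 1) |λ(y)| dy`. -/
theorem statement14
    (d : ℕ)
    (ψ : (Fin d → ℝ) → ℂ) (hψ : Integrable ψ volume)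
    (C : ℝ)
    (hC : ∀ y : Fin d → ℝ, eucNorm y ≤ 1 →
      ∃ g : (Fin d → ℝ) → Fin d → ℂ, Integrable g volume ∧
        HasRiesz (fun x => ψ x - ψ (x - y)) g ∧ (∫ x : Fin d → ℝ, ‖g x‖) ≤ C)
    (lam : (Fin d → ℝ) → ℂ) (hlam : Integrable lam volume)
    (hlam1 : Integrable (fun y : Fin d → ℝ => eucNorm y • lam y) volume)
    (hlamint : ∫ y : Fin d → ℝ, lam y = 1) :
    Integrable (fun x => ψ x - conv ψ lam x) volume ∧
    ∃ g : (Fin d → ℝ) → Fin d → ℂ, Integrable g volume ∧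
      HasRiesz (fun x => ψ x - conv ψ lam x) g ∧
      (∫ x : Fin d → ℝ, ‖g x‖) ≤ C * ∫ y : Fin d → ℝ, (eucNorm y + 1) * ‖lam y‖ := by
  have hψ' := integrable_comp_ofLp_iff.2 hψ
  have hlam' := integrable_comp_ofLp_iff.2 hlam
  have hlam1' := integrable_comp_ofLp_iff.2 hlam1
  have hlamint' := (integral_comp_ofLp lam).trans hlamint
  have hF : Integrable (fun x => ψ x - conv ψ lam x) := by
    rw [← integrable_comp_ofLp_iff]
    simp_rw [conv_ofLp]
    exact (integrable_mul_sub_translate hψ' hlam').integral_prod_left.congr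
      (ae_sub_conv_eq hψ' hlam' hlamint').symm
  refine ⟨hF, ?_⟩
  rcases Nat.eq_zero_or_pos d with rfl | hd
  · obtain ⟨g, hg, -, hgC⟩ := hC 0 (by simp [eucNorm])
    have hC0 : 0 ≤ C := (integral_nonneg fun x => norm_nonneg _).trans hgC
    refine ⟨0, integrable_zero _ _ _, Eventually.of_forall fun x =>
      tendsto_pi_nhds.2 fun i => i.elim0, ?_⟩
    simp only [Pi.zero_apply, norm_zero, integral_zero]
    exact mul_nonneg hC0 (integral_nonneg fun y =>
      mul_nonneg (add_nonneg (Real.sqrt_nonneg _) zero_le_one) (norm_nonneg _))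
  have : Nonempty (Fin d) := ⟨⟨0, hd⟩⟩
  have hη : ∀ j : ℕ, (0 : ℝ) < 1 / ((j : ℝ) + 1) := fun j => Nat.one_div_pos_of_nat
  have hη0 := tendsto_one_div_add_atTop_nhds_zero_nat (𝕜 := ℝ)
  have hη1 : Tendsto (fun j : ℕ => 1 / ((j : ℝ) + 1)) atTop (𝓝[>] 0) :=
    tendsto_nhdsWithin_iff.2 ⟨hη0, Eventually.of_forall hη⟩
  obtain ⟨g, hg, hl, hgC⟩ := exists_limit_sub_conv (rieszDir d) hη hη0 hψ' hlam'
    (by simpa only [eucNorm_ofLp] using hlam1') hlamint' (C := C) fun y hy => by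
      obtain ⟨g, hg, hl, hgC⟩ := hC y.ofLp (by rwa [eucNorm_ofLp])
      refine ⟨fun x => g x.ofLp, integrable_comp_ofLp_iff.2 hg, ?_, ?_⟩
      · filter_upwards [(hasRiesz_iff (hψ.sub (hψ.comp_sub_right _))).1 hl] with x hx i
        exact (hx i).comp hη1
      · exact (integral_comp_ofLp fun x => ‖g x‖).trans_le hgC
  refine ⟨fun x => g (WithLp.toLp 2 x), integrable_comp_ofLp_iff.1 hg, ?_, ?_⟩
  · rw [hasRiesz_iff hF]
    simp_rw [conv_ofLp]
    exact hl
  · rw [← integral_comp_ofLp, ← integral_comp_ofLp]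
    simpa only [eucNorm_ofLp] using hgC

end AffinePaper
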